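/- There exist universal constants δ ∈ (0,1) and c > 0 such that for every integer n ≥ 2 the following holds: if (Ω,ν) is a σ-finite measure space, D ≥ 1, and f : {0,1,…,n}³ → L¹(ν) satisfies ρ(x,y) ≤ ‖f(x)−f(y)‖₁ ≤ D·ρ(x,y) for all x,y ∈ {0,1,…,n}³, then D ≥ c·(log n)^δ. In other words, the L¹ distortion of ({0,1,…,n}³, ρ) is at least c·(log n)^δ. -/

import Mathlib

open MeasureTheory Filter

noncomputable section

namespace Heis

/-- The Heisenberg group, as `ℝ³` with the Heisenberg product. -/
abbrev H : Type := ℝ × ℝ × ℝ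

/-- The Heisenberg group multiplication
`(a,b,c)·(a',b',c') = (a+a', b+b', c+c'+ab'−ba')`. -/
def hmul (x y : H) : H :=
  (x.1 + y.1, x.2.1 + y.2.1, x.2.2 + y.2.2 + x.1 * y.2.1 - x.2.1 * y.1)

/-- The Carnot–Carathéodory distance on the Heisenberg group: the infimum of
lengths of horizontal curves from `x` to `y`.  A curve `γ` is horizontal when its
velocity `d t` at `γ t` lies in the tangent plane of the horizontal plane at
`γ t`, i.e. `(d t).2.2 = (γ t).1 * (d t).2.1 - (γ t).2.1 * (d t).1`, and the
left-invariant length of such a velocity is the Euclidean norm of its first two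
components. -/
def dH (x y : H) : ℝ :=
  sInf { l : ℝ | ∃ γ d : ℝ → H,
    γ 0 = x ∧ γ 1 = y ∧
    (∀ t ∈ Set.Icc (0:ℝ) 1, HasDerivWithinAt γ (d t) (Set.Icc (0:ℝ) 1) t) ∧
    (∀ t ∈ Set.Icc (0:ℝ) 1,
      (d t).2.2 = (γ t).1 * (d t).2.1 - (γ t).2.1 * (d t).1) ∧
    l = ∫ t in (0:ℝ)..1, Real.sqrt ((d t).1 ^ 2 + (d t).2.1 ^ 2) }

/-- The open ball for the Carnot–Carathéodory distance. -/
def ball (x : H) (r : ℝ) : Set H := { y : H | dH x y < r }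

/-- The horizontal line through `(a,b,c)` with direction `(u,v)`; it is
arclength-parameterized when `u² + v² = 1`. -/
def hline (a b c u v : ℝ) : ℝ → H :=
  fun t => (a + t * u, b + t * v, c + t * (a * v - b * u))

/-- A horizontal line parameterized by arclength. -/
def IsUnitLine (L : ℝ → H) : Prop :=
  ∃ a b c u v : ℝ, u ^ 2 + v ^ 2 = 1 ∧ L = hline a b c u v

/-- A subset of `ℍ` which is a horizontal line. -/
def IsHLine (ℓ : Set H) : Prop :=
  ∃ a b c u v : ℝ, (u, v) ≠ ((0:ℝ), (0:ℝ)) ∧ ℓ = Set.range (hline a b c u v)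

/-- The projection `π : ℍ → ℝ²`. -/
def proj (x : H) : ℝ × ℝ := (x.1, x.2.1)

/-- Parameterization of the oriented horizontal lines: to `(θ, p, h)` we associate
the horizontal lift at height `h` of the line in `ℝ²` with direction
`(cos θ, sin θ)` and signed distance `p` from the origin. -/
def lineOf (q : ℝ × ℝ × ℝ) : ℝ → H :=
  hline (-q.2.1 * Real.sin q.1) (q.2.1 * Real.cos q.1) q.2.2 (Real.cos q.1) (Real.sin q.1)

/-- The (unnormalized) left-invariant measure on the space of oriented horizontal
lines, in the parameterization `lineOf`. -/
def lineMeas₀ : Measure (ℝ × ℝ × ℝ) :=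
  (volume : Measure (ℝ × ℝ × ℝ)).restrict
    ((Set.Ico (0:ℝ) (2 * Real.pi)) ×ˢ (Set.univ : Set (ℝ × ℝ)))

/-- The parameters of the lines meeting a given subset of `ℍ`. -/
def linesMeeting (U : Set H) : Set (ℝ × ℝ × ℝ) := { q | ∃ t : ℝ, lineOf q t ∈ U }

/-- The left-invariant measure `𝒩` on horizontal lines, normalized so that the
lines meeting `B₁(e)` have measure `1`. -/
def lineMeas : Measure (ℝ × ℝ × ℝ) :=
  (lineMeas₀ (linesMeeting (ball ((0:ℝ), (0:ℝ), (0:ℝ)) 1)))⁻¹ • lineMeas₀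

/-- `ℝ`-valued indicator function of a subset of `ℍ`. -/
def ind (E : Set H) (x : H) : ℝ := Set.indicator E (fun _ => (1:ℝ)) x

/-- The nonconvexity `NC_{B_r(x)}(E, L)` of `E` along the arclength-parameterized
horizontal line `L`, inside the ball `B_r(x)`; the infimum runs over subintervals
(`OrdConnected` subsets) of `L ∩ B_r(x)`, possibly empty. -/
def NCline (E : Set H) (x : H) (r : ℝ) (L : ℝ → H) : ℝ :=
  sInf { v : ℝ | ∃ I : Set ℝ, I.OrdConnected ∧ I ⊆ { t : ℝ | L t ∈ ball x r } ∧
    v = ∫ t in { t : ℝ | L t ∈ ball x r },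
      |Set.indicator I (fun _ => (1:ℝ)) t - ind E (L t)| }

/-- The nonmonotonicity `NM_{B_r(x)}(E, L)`. -/
def NMline (E : Set H) (x : H) (r : ℝ) (L : ℝ → H) : ℝ :=
  NCline E x r L + NCline Eᶜ x r L

/-- Total normalized nonconvexity `NC_{B_r(x)}(E)`. -/
def NCtot (E : Set H) (x : H) (r : ℝ) : ℝ :=
  (1 / r ^ 4) * ∫ q in linesMeeting (ball x r), NCline E x r (lineOf q) ∂lineMeas

/-- Total normalized nonmonotonicity `NM_{B_r(x)}(E)`. -/
def NMtot (E : Set H) (x : H) (r : ℝ) : ℝ :=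
  (1 / r ^ 4) * ∫ q in linesMeeting (ball x r), NMline E x r (lineOf q) ∂lineMeas

/-- `E` is `δ`-monotone on `B_r(x)`. -/
def DeltaMonotone (δ : ℝ) (E : Set H) (x : H) (r : ℝ) : Prop := NMtot E x r < δ

/-- `E` is `δ`-convex on `B_r(x)`. -/
def DeltaConvex (δ : ℝ) (E : Set H) (x : H) (r : ℝ) : Prop := NCtot E x r < δ

/-- The quantitative interior `int_{α,u}(E)`. -/
def qInt (α u : ℝ) (E : Set H) : Set H :=
  { x : H | ENNReal.ofReal (1 - α) * volume (ball x u) ≤ volume (E ∩ ball x u) }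

/-- The quantitative boundary `∂_{α,u}(E)`. -/
def qBdry (α u : ℝ) (E : Set H) : Set H :=
  { x : H | ENNReal.ofReal α * volume (ball x u) < volume (E ∩ ball x u) ∧
      volume (E ∩ ball x u) < ENNReal.ofReal (1 - α) * volume (ball x u) }

/-- Half-spaces in `ℝ³`: points lying on one closed side of an affine 2-plane. -/
def IsHalfSpace (P : Set H) : Prop :=
  ∃ w : ℝ × ℝ × ℝ, ∃ b : ℝ, w ≠ 0 ∧
    P = { x : H | w.1 * x.1 + w.2.1 * x.2.1 + w.2.2 * x.2.2 ≤ b }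

/-- Affine 2-planes in `ℝ³`. -/
def IsPlane (Q : Set H) : Prop :=
  ∃ w : ℝ × ℝ × ℝ, ∃ b : ℝ, w ≠ 0 ∧
    Q = { x : H | w.1 * x.1 + w.2.1 * x.2.1 + w.2.2 * x.2.2 = b }

/-- The pointwise upper Lipschitz constant of `h` at `x` w.r.t. `dH`
(`limsup_{y→x} |h(y)−h(x)|/dH(x,y)`). -/
def pLip (h : H → ℝ) (x : H) : ℝ :=
  sInf { M : ℝ | ∃ ε : ℝ, 0 < ε ∧ ∀ y : H, dH x y < ε → |h y - h x| ≤ M * dH x y }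

/-- `h` is Lipschitz for the Carnot–Carathéodory distance. -/
def LipschitzH (h : H → ℝ) : Prop := ∃ M : ℝ, ∀ x y : H, |h x - h y| ≤ M * dH x y

/-- The perimeter `Per(E)(U)`: the infimum, over sequences of `dH`-Lipschitz
functions converging to `χ_E` in `L¹_loc(U)`, of `liminf ∫_U Lip(h_i)`. -/
def perimeter (E U : Set H) : ℝ :=
  sInf { v : ℝ | ∃ h : ℕ → H → ℝ,
    (∀ i, LipschitzH (h i)) ∧
    (∀ K : Set H, K ⊆ U → IsCompact K →
      Tendsto (fun i => ∫ x in K, |h i x - ind E x|) atTop (nhds 0)) ∧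
    v = liminf (fun i => ∫ x in U, pLip (h i) x) atTop }

/-- The `dH`-distance from a point to a set. -/
def distSetH (x : H) (A : Set H) : ℝ := sInf { d : ℝ | ∃ a ∈ A, d = dH x a }

/-- The closed `ε`-tubular neighborhood of `A ⊆ ℍ`. -/
def tube (ε : ℝ) (A : Set H) : Set H := { x : H | distSetH x A ≤ ε }

/-- The Euclidean distance from a point of `ℝ²` to a subset of `ℝ²`. -/
def dist2 (q : ℝ × ℝ) (A : Set (ℝ × ℝ)) : ℝ :=
  sInf { d : ℝ | ∃ a ∈ A, d = Real.sqrt ((q.1 - a.1) ^ 2 + (q.2 - a.2) ^ 2) }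

/-- Two horizontal lines are skew if they are neither parallel (left translates of
each other) nor intersecting. -/
def Skew (ℓ₁ ℓ₂ : Set H) : Prop :=
  IsHLine ℓ₁ ∧ IsHLine ℓ₂ ∧ ¬ (∃ g : H, ℓ₂ = (hmul g) '' ℓ₁) ∧ ℓ₁ ∩ ℓ₂ = ∅

/-- The rotation `O_θ` of the Heisenberg group. -/
def rot (θ : ℝ) (x : H) : H :=
  (x.1 * Real.cos θ - x.2.1 * Real.sin θ, x.1 * Real.sin θ + x.2.1 * Real.cos θ, x.2.2)

/-- The first line `{(t, wt, c)}` of the normal form of a pair of skew lines. -/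
def nf₁ (w c : ℝ) : Set H := Set.range (fun t : ℝ => ((t, w * t, c) : H))

/-- The second line `{(s, −ws, −c)}` of the normal form of a pair of skew lines. -/
def nf₂ (w c : ℝ) : Set H := Set.range (fun s : ℝ => ((s, -(w * s), -c) : H))

/-- The pair `(ℓ₁, ℓ₂)` has normal-form parameters `(w, c)`: after a left
translation, a rotation, and possibly relabeling, it becomes the normal pair. -/
def HasNormalForm (ℓ₁ ℓ₂ : Set H) (w c : ℝ) : Prop :=
  0 < w ∧ 0 < c ∧ ∃ g : H, ∃ θ : ℝ,
    (((rot θ) ∘ (hmul g)) '' ℓ₁ = nf₁ w c ∧ ((rot θ) ∘ (hmul g)) '' ℓ₂ = nf₂ w c) ∨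
    (((rot θ) ∘ (hmul g)) '' ℓ₁ = nf₂ w c ∧ ((rot θ) ∘ (hmul g)) '' ℓ₂ = nf₁ w c)

/-- The arclength-parameterized horizontal line through `y` with direction angle `θ`. -/
def lineThrough (y : H) (θ : ℝ) : ℝ → H :=
  hline y.1 y.2.1 y.2.2 (Real.cos θ) (Real.sin θ)

/-- The measure `σ_{r,x}` on pairs of points of `B_r(x)` lying on a common coset
of the center: the pushforward of `ℒ³ ⊗ ℒ¹` under `(y,t) ↦ (y, y·(0,0,t))`,
restricted to `B_r(x) × B_r(x)`. -/
def pairMeasure (x : H) (r : ℝ) : Measure (H × H) :=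
  (((volume : Measure H).prod (volume : Measure ℝ)).map
    (fun p : H × ℝ => (p.1, hmul p.1 ((0:ℝ), (0:ℝ), p.2)))).restrict
      ((ball x r) ×ˢ (ball x r))

/-- The metric `ρ` of negative type on `ℝ³`. -/
def rho (p q : H) : ℝ :=
  Real.sqrt (Real.sqrt (((q.1 - p.1) ^ 2 + (q.2.1 - p.2.1) ^ 2) ^ 2 +
      (q.2.2 - p.2.2 + 2 * p.1 * q.2.1 - 2 * p.2.1 * q.1) ^ 2) +
    (q.1 - p.1) ^ 2 + (q.2.1 - p.2.1) ^ 2)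

/-- The grid `{0, 1, …, n}³ ⊆ ℝ³`. -/
def cube (n : ℕ) : Set H :=
  { v : H | ∃ a b k : ℕ, a ≤ n ∧ b ≤ n ∧ k ≤ n ∧ v = ((a:ℝ), (b:ℝ), (k:ℝ)) }

/-- The discrete Heisenberg group `ℍ(ℤ)`, as `ℤ³`. -/
abbrev Hz : Type := ℤ × ℤ × ℤ

/-- The multiplication of the discrete Heisenberg group. -/
def zmul (x y : Hz) : Hz :=
  (x.1 + y.1, x.2.1 + y.2.1, x.2.2 + y.2.2 + x.1 * y.2.1 - x.2.1 * y.1)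

/-- The standard generating set `T` of `ℍ(ℤ)`. -/
def genSet : Set Hz :=
  {((1:ℤ), (0:ℤ), (0:ℤ)), (-1, 0, 0), (0, 1, 0), (0, -1, 0), (0, 0, 1), (0, 0, -1)}

/-- The word metric `d_T` on `ℍ(ℤ)` w.r.t. the generating set `T`. -/
def dT (x y : Hz) : ℕ :=
  sInf { n : ℕ | ∃ w : List Hz, (∀ g ∈ w, g ∈ genSet) ∧ w.length = n ∧
    w.foldl zmul x = y }

/-- The Euclidean norm on `ℝ³`. -/
def norm3 (v : H) : ℝ := Real.sqrt (v.1 ^ 2 + v.2.1 ^ 2 + v.2.2 ^ 2)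

/-- A rotation-invariant measure on directions, obtained by pushing the Lebesgue
measure of the annulus `1 ≤ |v| ≤ 2` forward under radial projection. -/
def sphereMeasure : Measure H :=
  ((volume : Measure H).restrict { v : H | 1 ≤ norm3 v ∧ norm3 v ≤ 2 }).map
    (fun v : H => (((norm3 v)⁻¹ * v.1, (norm3 v)⁻¹ * v.2.1, (norm3 v)⁻¹ * v.2.2) : H))

/-- The affine line in `ℝ³` with direction `v` through the point `(ab.1, ab.2, 0)`,
parameterized by `t` (Euclidean arclength when `|v| = 1`). -/
def lineDir (v : H) (ab : ℝ × ℝ) : ℝ → H :=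
  fun t => (ab.1 + t * v.1, ab.2 + t * v.2.1, t * v.2.2)

/-- The kinematic measure on affine lines of `ℝ³` transverse to the horizontal
plane, in the parameterization `lineDir` by a unit direction `v` and a base point
in the plane `z = 0`; the density `|v₃|` converts Lebesgue measure on `z = 0` into
Lebesgue measure on the plane orthogonal to the direction. -/
def kinMeas : Measure (H × (ℝ × ℝ)) :=
  (sphereMeasure.prod (volume : Measure (ℝ × ℝ))).withDensity
    (fun q => ENNReal.ofReal |q.1.2.2|)

/-- The cut semimetric of a two-valued function. -/
def cutI (g : H → Bool) (p q : H) : ℝ := if g p = g q then 0 else 1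

/-- Finite linear combinations of evaluations of a kernel at pairs of points. -/
def evals : Submodule ℝ ((H → H → ℝ) → ℝ) :=
  Submodule.span ℝ (Set.range fun (pq : H × H) (d : H → H → ℝ) => d pq.1 pq.2)

/-- A kernel satisfying every linear inequality that all cut semimetrics satisfy. -/
def CutPos (d : H → H → ℝ) : Prop := ∀ l ∈ evals, (∀ g, 0 ≤ l (cutI g)) → 0 ≤ l d

lemma eval_mem (p q : H) : (fun d : H → H → ℝ => d p q) ∈ evals :=
  Submodule.subset_span ⟨(p, q), rfl⟩

lemma CutPos.integral {X : Type*} [MeasurableSpace X] {μ : Measure X} {D : X → H → H → ℝ}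
    {d : H → H → ℝ} (hD : ∀ y, CutPos (D y)) (hi : ∀ p q, Integrable (fun y => D y p q) μ)
    (hd : ∀ p q, d p q = ∫ y, D y p q ∂μ) : CutPos d := by
  intro l hl hg
  have key : Integrable (fun y => l (D y)) μ ∧ ∫ y, l (D y) ∂μ = l d := by
    clear hg
    unfold evals at hl
    induction hl using Submodule.span_induction with
    | mem x hx =>
      obtain ⟨pq, rfl⟩ := hx
      exact ⟨hi _ _, (hd _ _).symm⟩
    | zero => simp
    | add x y _ _ hx hy =>
      exact ⟨hx.1.add hy.1, by
        simp only [Pi.add_apply]; rw [integral_add hx.1 hy.1, hx.2, hy.2]⟩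
    | smul a x _ hx =>
      exact ⟨hx.1.smul a, by
        simp only [Pi.smul_apply]; rw [integral_smul, hx.2]⟩
  rw [← key.2]
  exact integral_nonneg fun y => hD y l hl hg

lemma CutPos.cutI (g : H → Bool) : CutPos (cutI g) := fun _ _ h => h g

lemma integral_sublevel_diff (a b : ℝ) :
    Integrable (fun s : ℝ => if decide (s < a) = decide (s < b) then (0 : ℝ) else 1) ∧
      ∫ s : ℝ, (if decide (s < a) = decide (s < b) then (0 : ℝ) else 1) = |a - b| := by
  have : (fun s : ℝ => if decide (s < a) = decide (s < b) then (0 : ℝ) else 1)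
      = Set.indicator (Set.Ico (min a b) (max a b)) (fun _ => (1 : ℝ)) := by
    ext s
    by_cases h1 : s < a <;> by_cases h2 : s < b <;>
      simp [Set.indicator, h1, h2]
  rw [this]
  constructor
  · rw [integrable_indicator_iff measurableSet_Ico]
    simp
  · rw [integral_indicator measurableSet_Ico]
    simp [max_sub_min_eq_abs']

lemma CutPos.abs_sub (u : H → ℝ) : CutPos fun p q => |u p - u q| :=
  CutPos.integral (D := fun s : ℝ => Heis.cutI fun p => decide (s < u p)) (μ := volume)
    (fun _ => .cutI _) (fun p q => (integral_sublevel_diff (u p) (u q)).1)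
    fun p q => (integral_sublevel_diff (u p) (u q)).2.symm

lemma CutPos.norm_sub {Ω : Type*} [MeasurableSpace Ω] {ν : Measure Ω} (F : H → Lp ℝ 1 ν) :
    CutPos fun p q => ‖F p - F q‖ := by
  refine CutPos.integral (D := fun ω p q => |F p ω - F q ω|) (μ := ν) (fun ω => .abs_sub _)
    (fun p q => ?_) fun p q => ?_
  · exact ((L1.integrable_coeFn (F p)).sub (L1.integrable_coeFn (F q))).abs
  · rw [L1.norm_eq_integral_norm]
    refine integral_congr_ae ?_
    filter_upwards [Lp.coeFn_sub (F p) (F q)] with ω h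
    rw [h]; rfl

lemma CutPos.nonneg {d : H → H → ℝ} (h : CutPos d) (p q : H) : 0 ≤ d p q :=
  h _ (eval_mem p q) fun g => by unfold Heis.cutI; split_ifs <;> norm_num

lemma CutPos.le_of {d : H → H → ℝ} (h : CutPos d) {l r : (H → H → ℝ) → ℝ} (hl : l ∈ evals)
    (hr : r ∈ evals) (hg : ∀ g, l (Heis.cutI g) ≤ r (Heis.cutI g)) : l d ≤ r d := by
  have := h (r - l) (evals.sub_mem hr hl) fun g => sub_nonneg.2 (hg g)
  exact sub_nonneg.1 this

lemma CutPos.self {d : H → H → ℝ} (h : CutPos d) (p : H) : d p p = 0 :=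
  le_antisymm (h.le_of (eval_mem p p) evals.zero_mem fun g => by simp [Heis.cutI]) (h.nonneg p p)

lemma CutPos.triangle {d : H → H → ℝ} (h : CutPos d) (p q r : H) : d p r ≤ d p q + d q r :=
  h.le_of (eval_mem p r) (evals.add_mem (eval_mem p q) (eval_mem q r)) fun g => by
    simp only [Pi.add_apply, Heis.cutI]
    cases g p <;> cases g q <;> cases g r <;> simp

/-- A `4`-Lipschitz cut-off supported on `[0, 1]` and equal to `1` on `[1/4, 3/4]`. -/
def trap (s : ℝ) : ℝ := max 0 (min 1 (min (4 * s) (4 - 4 * s)))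

lemma trap_nonneg (s : ℝ) : 0 ≤ trap s := le_max_left _ _

lemma trap_le_one (s : ℝ) : trap s ≤ 1 := max_le zero_le_one (min_le_left _ _)

lemma trap_eq_one {s : ℝ} (h1 : 1 / 4 ≤ s) (h2 : s ≤ 3 / 4) : trap s = 1 := by
  have : (1 : ℝ) ≤ min (4 * s) (4 - 4 * s) := le_min (by linarith) (by linarith)
  rw [trap, min_eq_left this, max_eq_right zero_le_one]

lemma trap_eq_zero {s : ℝ} (h : ¬ (0 ≤ s ∧ s ≤ 1)) : trap s = 0 := by
  refine max_eq_left ((min_le_right _ _).trans ?_)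
  by_contra! hc
  rw [lt_min_iff] at hc
  exact h ⟨by linarith, by linarith⟩

lemma abs_trap_sub_le (s t : ℝ) : |trap s - trap t| ≤ 4 * |s - t| := by
  have key : ∀ s t, trap s ≤ trap t + 4 * |s - t| := by
    intro s t
    have h1 := le_abs_self (s - t)
    have h2 := neg_abs_le (s - t)
    have h3 := abs_nonneg (s - t)
    rw [trap]
    refine max_le (by have := trap_nonneg t; linarith) ?_
    by_contra! hc
    rw [lt_min_iff, lt_min_iff] at hc
    have h4 : min 1 (min (4 * t) (4 - 4 * t)) ≤ trap t := le_max_right _ _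
    rcases min_choice 1 (min (4 * t) (4 - 4 * t)) with e | e <;> rw [e] at h4
    · linarith
    · rcases min_choice (4 * t) (4 - 4 * t) with e | e <;> rw [e] at h4 <;> linarith
  rw [abs_le]
  have h1 := key s t
  have h2 := key t s
  rw [abs_sub_comm] at h2
  constructor <;> linarith

lemma abs_mul_trap_sub_le {a b c d ε η : ℝ} (ha : 0 ≤ a) (ha' : a ≤ 1) (hd : 0 ≤ d) (hd' : d ≤ 1)
    (h1 : |a - b| ≤ ε) (h2 : |c - d| ≤ η) : |a * c - b * d| ≤ ε + η := by
  have : a * c - b * d = a * (c - d) + (a - b) * d := by ring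
  rw [this]
  refine (abs_add_le _ _).trans ?_
  rw [abs_mul, abs_mul, abs_of_nonneg ha, abs_of_nonneg hd]
  have := abs_nonneg (a - b)
  have := abs_nonneg (c - d)
  nlinarith

/-- A lattice point as a point of the Heisenberg group. -/
def lat (P : ℤ × ℤ × ℤ) : H := ((P.1 : ℝ), (P.2.1 : ℝ), (P.2.2 : ℝ))

/-- The lattice box of horizontal size `M`. -/
def latBox (M : ℕ) : Set (ℤ × ℤ × ℤ) :=
  {P | (0 ≤ P.1 ∧ P.1 ≤ M) ∧ (0 ≤ P.2.1 ∧ P.2.1 ≤ M) ∧ 0 ≤ P.2.2 ∧ P.2.2 ≤ (M : ℤ) ^ 2}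

/-- A Lipschitz cut-off adapted to the box of size `M`. -/
def boxCut (M : ℕ) (P : ℤ × ℤ × ℤ) : ℝ :=
  trap (P.1 / M) * trap (P.2.1 / M) * trap (P.2.2 / (M : ℝ) ^ 2)

lemma boxCut_nonneg (M : ℕ) (P : ℤ × ℤ × ℤ) : 0 ≤ boxCut M P :=
  mul_nonneg (mul_nonneg (trap_nonneg _) (trap_nonneg _)) (trap_nonneg _)

lemma boxCut_le_one (M : ℕ) (P : ℤ × ℤ × ℤ) : boxCut M P ≤ 1 :=
  mul_le_one₀ (mul_le_one₀ (trap_le_one _) (trap_nonneg _) (trap_le_one _)) (trap_nonneg _)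
    (trap_le_one _)

lemma trap_div_eq_zero {x : ℤ} {y : ℕ} (hy : 0 < y) (h : ¬ (0 ≤ x ∧ x ≤ y)) :
    trap (x / y) = 0 := by
  refine trap_eq_zero fun hc => h ?_
  have hy' : (0 : ℝ) < y := by exact_mod_cast hy
  rw [div_le_one hy', le_div_iff₀ hy', zero_mul] at hc
  exact_mod_cast hc

lemma boxCut_eq_zero {M : ℕ} (hM : 0 < M) {P : ℤ × ℤ × ℤ} (h : P ∉ latBox M) :
    boxCut M P = 0 := by
  have h : ¬ (0 ≤ P.1 ∧ P.1 ≤ M) ∨ ¬ (0 ≤ P.2.1 ∧ P.2.1 ≤ M) ∨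
      ¬ (0 ≤ P.2.2 ∧ P.2.2 ≤ (M : ℤ) ^ 2) := by
    by_contra! hc
    exact h hc
  unfold boxCut
  rcases h with h | h | h
  · rw [trap_div_eq_zero hM h]; ring
  · rw [trap_div_eq_zero hM (x := P.2.1) h]; ring
  · have := trap_div_eq_zero (x := P.2.2) (y := M ^ 2) (by positivity) (by push_cast; exact h)
    push_cast at this
    rw [this]; ring

/-- Two lattice points at gauge distance at most `r`, for the group law underlying `rho`. -/
def LatClose (r : ℝ) (P Q : ℤ × ℤ × ℤ) : Prop :=
  |(Q.1 : ℝ) - P.1| ≤ r ∧ |(Q.2.1 : ℝ) - P.2.1| ≤ r ∧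
    |(Q.2.2 : ℝ) - P.2.2 + 2 * P.1 * Q.2.1 - 2 * P.2.1 * Q.1| ≤ r ^ 2

lemma LatClose.symm {r : ℝ} {P Q : ℤ × ℤ × ℤ} (h : LatClose r P Q) : LatClose r Q P := by
  obtain ⟨h1, h2, h3⟩ := h
  refine ⟨by rwa [abs_sub_comm], by rwa [abs_sub_comm], ?_⟩
  rw [← abs_neg]
  convert h3 using 2
  ring

lemma LatClose.rho_le {r : ℝ} (hr : 0 ≤ r) {P Q : ℤ × ℤ × ℤ} (h : LatClose r P Q) :
    rho (lat P) (lat Q) ≤ 3 * r := by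
  obtain ⟨h1, h2, h3⟩ := h
  have e1 := sq_le_sq.2 (h1.trans (le_abs_self r))
  have e2 := sq_le_sq.2 (h2.trans (le_abs_self r))
  have e3 := sq_le_sq.2 (h3.trans (le_abs_self _))
  unfold rho lat
  simp only
  refine Real.sqrt_le_iff.2 ⟨by positivity, ?_⟩
  have : √((((Q.1 : ℝ) - P.1) ^ 2 + ((Q.2.1 : ℝ) - P.2.1) ^ 2) ^ 2 +
      ((Q.2.2 : ℝ) - P.2.2 + 2 * P.1 * Q.2.1 - 2 * P.2.1 * Q.1) ^ 2) ≤ 3 * r ^ 2 := by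
    refine Real.sqrt_le_iff.2 ⟨by positivity, ?_⟩
    have : (((Q.1 : ℝ) - P.1) ^ 2 + ((Q.2.1 : ℝ) - P.2.1) ^ 2) ^ 2 ≤ (2 * r ^ 2) ^ 2 := by
      gcongr; linarith
    nlinarith
  nlinarith

lemma LatClose.abs_boxCut_sub_le {M : ℕ} (hM : 0 < M) {r : ℝ} (hr : r ≤ M)
    {P Q : ℤ × ℤ × ℤ} (h : LatClose r P Q) (hP : P ∈ latBox M) :
    |boxCut M P - boxCut M Q| ≤ 28 * r / M := by
  obtain ⟨h1, h2, h3⟩ := h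
  obtain ⟨⟨x0, x1⟩, ⟨y0, y1⟩, -⟩ := hP
  have hM' : (0 : ℝ) < M := by exact_mod_cast hM
  have x0' : (0 : ℝ) ≤ P.1 := by exact_mod_cast x0
  have x1' : (P.1 : ℝ) ≤ M := by exact_mod_cast x1
  have y0' : (0 : ℝ) ≤ P.2.1 := by exact_mod_cast y0
  have y1' : (P.2.1 : ℝ) ≤ M := by exact_mod_cast y1
  have hr0 : 0 ≤ r := (abs_nonneg _).trans h1
  have key : ∀ {a b c ε : ℝ}, 0 < c → |b - a| ≤ ε → |trap (a / c) - trap (b / c)| ≤ 4 * ε / c := by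
    intro a b c ε hc hab
    refine (abs_trap_sub_le _ _).trans ?_
    rw [← sub_div, abs_div, abs_of_pos hc, abs_sub_comm, mul_div_assoc]
    gcongr
  have e3 : |(Q.2.2 : ℝ) - P.2.2| ≤ 5 * M * r := by
    have : (Q.2.2 : ℝ) - P.2.2 = (Q.2.2 - P.2.2 + 2 * P.1 * Q.2.1 - 2 * P.2.1 * Q.1)
        - 2 * P.1 * (Q.2.1 - P.2.1) + 2 * P.2.1 * (Q.1 - P.1) := by ring
    rw [this]
    rw [abs_le] at *
    have := mul_le_mul_of_nonneg_left hr hr0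
    constructor <;> nlinarith [mul_nonneg x0' (sub_nonneg.2 h2.2),
      mul_nonneg y0' (sub_nonneg.2 h1.2),
      mul_nonneg x0' (sub_nonneg.2 h2.1), mul_nonneg y0' (sub_nonneg.2 h1.1)]
  have := abs_mul_trap_sub_le
    (mul_nonneg (trap_nonneg (P.1 / M)) (trap_nonneg (P.2.1 / M)))
    (mul_le_one₀ (trap_le_one _) (trap_nonneg _) (trap_le_one _))
    (trap_nonneg (Q.2.2 / (M : ℝ) ^ 2)) (trap_le_one _)
    (abs_mul_trap_sub_le (trap_nonneg (P.1 / M)) (trap_le_one _) (trap_nonneg (Q.2.1 / M))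
      (trap_le_one _) (key hM' h1) (key hM' h2)) (key (by positivity) e3)
  refine this.trans (le_of_eq ?_)
  field_simp
  ring

section Extension

variable {Ω : Type} [MeasurableSpace Ω] {ν : Measure Ω}

/-- The map `f`, based at the origin and cut off outside a box. -/
def cutoffMap (M : ℕ) (f : H → Lp ℝ 1 ν) (P : ℤ × ℤ × ℤ) : Lp ℝ 1 ν :=
  boxCut M P • (f (lat P) - f (lat 0))

lemma cutoffMap_eq_zero {M : ℕ} (hM : 0 < M) (f : H → Lp ℝ 1 ν) {P : ℤ × ℤ × ℤ}
    (h : P ∉ latBox M) : cutoffMap M f P = 0 := by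
  rw [cutoffMap, boxCut_eq_zero hM h, zero_smul]

lemma lat_mem_cube {M n : ℕ} (hMn : M ^ 2 ≤ n) {P : ℤ × ℤ × ℤ} (h : P ∈ latBox M) :
    lat P ∈ cube n := by
  obtain ⟨⟨x0, x1⟩, ⟨y0, y1⟩, z0, z1⟩ := h
  have hM : M ≤ n := (Nat.le_self_pow two_ne_zero M).trans hMn
  refine ⟨P.1.toNat, P.2.1.toNat, P.2.2.toNat, by omega, by omega, ?_, ?_⟩
  · zify at hMn
    have := z1.trans hMn
    omega
  · unfold lat
    refine Prod.ext ?_ (Prod.ext ?_ ?_) <;> simp only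
    · exact_mod_cast (Int.toNat_of_nonneg x0).symm
    · exact_mod_cast (Int.toNat_of_nonneg y0).symm
    · exact_mod_cast (Int.toNat_of_nonneg z0).symm

variable {M n : ℕ} {D : ℝ} {f : H → Lp ℝ 1 ν}

lemma norm_sub_zero_le (hMn : M ^ 2 ≤ n) (hD : 1 ≤ D)
    (hf : ∀ x ∈ cube n, ∀ y ∈ cube n, rho x y ≤ ‖f x - f y‖ ∧ ‖f x - f y‖ ≤ D * rho x y)
    {P : ℤ × ℤ × ℤ} (h : P ∈ latBox M) : ‖f (lat P) - f (lat 0)‖ ≤ 3 * D * M := by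
  have h0 : (0 : ℤ × ℤ × ℤ) ∈ latBox M := by simp [latBox]
  refine (hf _ (lat_mem_cube hMn h) _ (lat_mem_cube hMn h0)).2.trans ?_
  have hc : LatClose M P 0 := by
    obtain ⟨⟨x0, x1⟩, ⟨y0, y1⟩, z0, z1⟩ := h
    refine LatClose.symm ?_
    simp only [LatClose, Prod.fst_zero, Prod.snd_zero, Int.cast_zero, mul_zero, zero_mul, sub_zero,
      add_zero]
    refine ⟨abs_le.2 ⟨?_, by exact_mod_cast x1⟩, abs_le.2 ⟨?_, by exact_mod_cast y1⟩,
      abs_le.2 ⟨?_, by exact_mod_cast z1⟩⟩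
    · exact le_trans (by simp) (by exact_mod_cast x0 : (0 : ℝ) ≤ P.1)
    · exact le_trans (by simp) (by exact_mod_cast y0 : (0 : ℝ) ≤ P.2.1)
    · exact le_trans (by simp) (by exact_mod_cast z0 : (0 : ℝ) ≤ P.2.2)
  have := hc.rho_le (Nat.cast_nonneg M)
  nlinarith

lemma norm_cutoffMap_le (hM : 0 < M) (hMn : M ^ 2 ≤ n) (hD : 1 ≤ D)
    (hf : ∀ x ∈ cube n, ∀ y ∈ cube n, rho x y ≤ ‖f x - f y‖ ∧ ‖f x - f y‖ ≤ D * rho x y)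
    (P : ℤ × ℤ × ℤ) : ‖cutoffMap M f P‖ ≤ 3 * D * M := by
  by_cases h : P ∈ latBox M
  · rw [cutoffMap, norm_smul, Real.norm_of_nonneg (boxCut_nonneg _ _)]
    have := norm_sub_zero_le hMn hD hf h
    have := boxCut_le_one M P
    have := boxCut_nonneg M P
    nlinarith [norm_nonneg (f (lat P) - f (lat 0))]
  · rw [cutoffMap_eq_zero hM f h, norm_zero]; positivity

lemma norm_cutoffMap_sub_le (hM : 0 < M) (hMn : M ^ 2 ≤ n) (hD : 1 ≤ D)
    (hf : ∀ x ∈ cube n, ∀ y ∈ cube n, rho x y ≤ ‖f x - f y‖ ∧ ‖f x - f y‖ ≤ D * rho x y)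
    {r : ℝ} (hr : 0 < r) {P Q : ℤ × ℤ × ℤ} (h : LatClose r P Q) :
    ‖cutoffMap M f P - cutoffMap M f Q‖ ≤ 87 * D * r := by
  have hM' : (0 : ℝ) < M := by exact_mod_cast hM
  wlog hP : P ∈ latBox M generalizing P Q
  · by_cases hQ : Q ∈ latBox M
    · rw [norm_sub_rev]; exact this h.symm hQ
    · rw [cutoffMap_eq_zero hM f hP, cutoffMap_eq_zero hM f hQ, sub_zero, norm_zero]; positivity
  rcases le_or_gt r M with hrM | hrM
  · have hχ := h.abs_boxCut_sub_le hM hrM hP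
    have e : 28 * r / M * (3 * D * M) = 84 * D * r := by field_simp; ring
    by_cases hQ : Q ∈ latBox M
    · have : cutoffMap M f P - cutoffMap M f Q = boxCut M P • (f (lat P) - f (lat Q)) +
          (boxCut M P - boxCut M Q) • (f (lat Q) - f (lat 0)) := by
        simp only [cutoffMap, smul_sub, sub_smul]; abel
      rw [this]
      refine (norm_add_le _ _).trans ?_
      rw [norm_smul, norm_smul, Real.norm_of_nonneg (boxCut_nonneg _ _), Real.norm_eq_abs]
      have h1 := (hf _ (lat_mem_cube hMn hP) _ (lat_mem_cube hMn hQ)).2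
      have h2 := h.rho_le hr.le
      have h3 := mul_le_mul (boxCut_le_one M P) h1 (norm_nonneg _) zero_le_one
      have h4 := mul_le_mul hχ (norm_sub_zero_le hMn hD hf hQ) (norm_nonneg _) (by positivity)
      rw [e] at h4
      nlinarith
    · have : cutoffMap M f P - cutoffMap M f Q =
          (boxCut M P - boxCut M Q) • (f (lat P) - f (lat 0)) := by
        rw [cutoffMap_eq_zero hM f hQ, boxCut_eq_zero hM hQ, cutoffMap, sub_zero, sub_zero]
      rw [this, norm_smul, Real.norm_eq_abs]
      have h4 := mul_le_mul hχ (norm_sub_zero_le hMn hD hf hP) (norm_nonneg _) (by positivity)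
      rw [e] at h4
      nlinarith
  · have h1 := norm_cutoffMap_le hM hMn hD hf P
    have h2 := norm_cutoffMap_le hM hMn hD hf Q
    refine (norm_sub_le _ _).trans ?_
    nlinarith

end Extension

lemma measurePreserving_shear (a b : ℝ) {h : ℝ × ℝ → ℝ} (hh : Measurable h) :
    MeasurePreserving (fun x : H => ((x.1 + a, x.2.1 + b, x.2.2 + h (x.1, x.2.1)) : H)) := by
  have inner : ∀ s : ℝ, MeasurePreserving
      (fun y : ℝ × ℝ => (y.1 + b, y.2 + h (s, y.1))) := fun s => by
    refine (measurePreserving_add_right volume b).skew_product (g := fun u v => v + h (s, u))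
      (μc := volume) (μd := volume) ?_ (.of_forall fun u => ?_)
    · exact measurable_snd.add (hh.comp (measurable_const.prodMk measurable_fst))
    · exact (measurePreserving_add_right volume (h (s, u))).map_eq
  refine (measurePreserving_add_right volume a).skew_product
    (g := fun s (y : ℝ × ℝ) => (y.1 + b, y.2 + h (s, y.1)))
      (μc := volume) (μd := volume) ?_ (.of_forall fun u => (inner u).map_eq)
  exact (measurable_snd.fst.add_const b).prodMk
    (measurable_snd.snd.add (hh.comp (measurable_fst.prodMk measurable_snd.fst)))

lemma measurePreserving_hmul_right (p : H) : MeasurePreserving (fun x : H => hmul x p) := by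
  have := measurePreserving_shear p.1 p.2.1 (h := fun y => p.2.2 + y.1 * p.2.1 - y.2 * p.1)
    (by fun_prop)
  convert this using 2 with x
  simp only [hmul]
  ring_nf

/-- A lattice point near the given point, in the coordinates of `rho`. -/
def latRound (p : H) : ℤ × ℤ × ℤ :=
  (⌊p.2.1⌋, ⌊p.1⌋, ⌊2 * (p.2.2 + (p.1 * ⌊p.2.1⌋ - p.2.1 * ⌊p.1⌋))⌋)

/-- The shear straightening the third coordinate of `latRound`. -/
def latShear (x : H) : H := (x.1 + 0, x.2.1 + 0, x.2.2 + (x.1 * ⌊x.2.1⌋ - x.2.1 * ⌊x.1⌋))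

lemma measurePreserving_latShear : MeasurePreserving latShear :=
  measurePreserving_shear 0 0 (h := fun y => y.1 * ⌊y.2⌋ - y.2 * ⌊y.1⌋) (by fun_prop)

lemma measurable_latRound : Measurable latRound := by
  unfold latRound
  fun_prop

lemma hmul_assoc (x y z : H) : hmul (hmul x y) z = hmul x (hmul y z) := by
  simp only [hmul]
  refine Prod.ext ?_ (Prod.ext ?_ ?_) <;> simp only <;> ring

lemma floor_sub_floor_abs_le (s t : ℝ) : |((⌊s⌋ : ℝ) - ⌊t⌋) - (s - t)| ≤ 1 := by
  have h1 := Int.floor_le s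
  have h2 := Int.lt_floor_add_one s
  have h3 := Int.floor_le t
  have h4 := Int.lt_floor_add_one t
  rw [abs_le]
  constructor <;> linarith

lemma latClose_latRound {r : ℝ} (hr : 1 ≤ r) {p : H} (h1 : |p.1| ≤ r) (h2 : |p.2.1| ≤ r)
    (h3 : |p.2.2| ≤ r ^ 2) (x : H) : LatClose (5 * r) (latRound x) (latRound (hmul x p)) := by
  obtain ⟨a, b, c⟩ := x
  obtain ⟨α, β, γ⟩ := p
  simp only [latRound, hmul, LatClose] at *
  have f1 := floor_sub_floor_abs_le (a + α) a
  have f2 := floor_sub_floor_abs_le (b + β) b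
  have f3 := floor_sub_floor_abs_le
    (2 * (c + γ + a * β - b * α + ((a + α) * ⌊b + β⌋ - (b + β) * ⌊a + α⌋)))
    (2 * (c + (a * ⌊b⌋ - b * ⌊a⌋)))
  have a1 := Int.floor_le a
  have a2 := Int.lt_floor_add_one a
  have b1 := Int.floor_le b
  have b2 := Int.lt_floor_add_one b
  have a3 := Int.floor_le (a + α)
  have a4 := Int.lt_floor_add_one (a + α)
  have b3 := Int.floor_le (b + β)
  have b4 := Int.lt_floor_add_one (b + β)
  generalize (⌊2 * (c + γ + a * β - b * α + ((a + α) * ⌊b + β⌋ - (b + β) * ⌊a + α⌋))⌋ : ℝ) = V at *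
  generalize (⌊2 * (c + (a * ⌊b⌋ - b * ⌊a⌋))⌋ : ℝ) = Z at *
  generalize (⌊a⌋ : ℝ) = A at *
  generalize (⌊b⌋ : ℝ) = B at *
  generalize (⌊a + α⌋ : ℝ) = A' at *
  generalize (⌊b + β⌋ : ℝ) = B' at *
  obtain ⟨e1, rfl⟩ : ∃ e, a = A + e := ⟨a - A, by ring⟩
  obtain ⟨e2, rfl⟩ : ∃ e, b = B + e := ⟨b - B, by ring⟩
  obtain ⟨d1, rfl⟩ : ∃ e, α = A' - A + e := ⟨α - (A' - A), by ring⟩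
  obtain ⟨d2, rfl⟩ : ∃ e, β = B' - B + e := ⟨β - (B' - B), by ring⟩
  have hA : |A' - A| ≤ 2 * r := by
    rw [abs_le] at *; constructor <;> linarith
  have hB : |B' - B| ≤ 2 * r := by
    rw [abs_le] at *; constructor <;> linarith
  refine ⟨hB.trans (by linarith), hA.trans (by linarith), ?_⟩
  obtain ⟨g1, hg1⟩ : ∃ g, g = e1 + d1 := ⟨_, rfl⟩
  obtain ⟨g2, hg2⟩ : ∃ g, g = e2 + d2 := ⟨_, rfl⟩
  have hE : V - Z + 2 * B * A' - 2 * A * B' = (V - Z -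
      (2 * (c + γ + (A + e1) * (B' - B + d2) - (B + e2) * (A' - A + d1) +
        ((A + e1 + (A' - A + d1)) * B' - (B + e2 + (B' - B + d2)) * A')) -
        2 * (c + ((A + e1) * B - (B + e2) * A)))) + 2 * γ - 2 * (A' - A) * (g2 + e2)
        + 2 * (B' - B) * (g1 + e1) + 2 * (e1 * g2 - e2 * g1) := by
    rw [hg1, hg2]; ring
  rw [hE]
  have hg10 : |g1 + e1| ≤ 2 := by rw [abs_le]; constructor <;> linarith
  have hg20 : |g2 + e2| ≤ 2 := by rw [abs_le]; constructor <;> linarith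
  have m1 : |(A' - A) * (g2 + e2)| ≤ 2 * r * 2 := by
    rw [abs_mul]; gcongr
  have m2 : |(B' - B) * (g1 + e1)| ≤ 2 * r * 2 := by
    rw [abs_mul]; gcongr
  have m3 : |e1 * g2 - e2 * g1| ≤ 1 := by
    rw [abs_le]; constructor <;> nlinarith
  rw [abs_le] at f3 m1 m2 m3 h3 ⊢
  constructor <;> nlinarith

lemma volume_latRound_preimage_le {M : ℕ} (hM : 0 < M) :
    volume (latRound ⁻¹' latBox M) ≤ ENNReal.ofReal (4 * (M : ℝ) ^ 4) := by
  have hM1 : (1 : ℝ) ≤ M := by exact_mod_cast hM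
  set S : Set H := Set.Ico 0 ((M : ℝ) + 1) ×ˢ Set.Ico 0 ((M : ℝ) + 1) ×ˢ
    Set.Ico 0 (((M : ℝ) ^ 2 + 1) / 2) with hS
  have hSm : MeasurableSet S := by measurability
  have hsub : latRound ⁻¹' latBox M ⊆ latShear ⁻¹' S := by
    rintro ⟨a, b, c⟩ ⟨⟨x0, x1⟩, ⟨y0, y1⟩, z0, z1⟩
    simp only [latRound] at x0 x1 y0 y1 z0 z1
    have key : ∀ {s : ℝ} {m : ℤ}, 0 ≤ ⌊s⌋ → ⌊s⌋ ≤ m → 0 ≤ s ∧ s < m + 1 := fun {s m} h0 h1 =>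
      ⟨Int.floor_nonneg.1 h0, (Int.lt_floor_add_one s).trans_le (by
        have : (⌊s⌋ : ℝ) ≤ m := by exact_mod_cast h1
        linarith)⟩
    have k1 := key x0 x1
    have k2 := key y0 y1
    have k3 := key z0 z1
    push_cast at k1 k2 k3
    simp only [hS, latShear, Set.mem_preimage, Set.mem_prod, Set.mem_Ico, add_zero]
    exact ⟨k2, k1, by linarith [k3.1], by linarith [k3.2]⟩
  refine (measure_mono hsub).trans ?_
  rw [measurePreserving_latShear.measure_preimage hSm.nullMeasurableSet, hS, Measure.volume_eq_prod,
    Measure.prod_prod, Measure.volume_eq_prod, Measure.prod_prod]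
  simp only [Real.volume_Ico, sub_zero]
  rw [← ENNReal.ofReal_mul (by positivity), ← ENNReal.ofReal_mul (by positivity)]
  refine ENNReal.ofReal_le_ofReal ?_
  have h1 : ((M : ℝ) + 1) ≤ 2 * M := by linarith
  have h2 : (((M : ℝ) ^ 2 + 1) / 2) ≤ M ^ 2 := by nlinarith
  calc _ ≤ (2 * (M : ℝ)) * ((2 * M) * M ^ 2) := by gcongr
    _ = _ := by ring

/-- Points whose rounding is deep inside the box. -/
def latCore (M : ℕ) : Set H := latShear ⁻¹' (Set.Ico ((M : ℝ) / 4 + 1) (3 * M / 4) ×ˢ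
  Set.Ico ((M : ℝ) / 4 + 1) (3 * M / 4) ×ˢ Set.Ico ((M : ℝ) ^ 2 / 8 + 1 / 2) ((M : ℝ) ^ 2 / 4))

lemma measurableSet_latCore (M : ℕ) : MeasurableSet (latCore M) :=
  measurePreserving_latShear.measurable (by measurability)

lemma le_volume_latCore {M : ℕ} (hM : 8 ≤ M) :
    ENNReal.ofReal ((M : ℝ) ^ 4 / 256) ≤ volume (latCore M) := by
  have hM1 : (8 : ℝ) ≤ M := by exact_mod_cast hM
  rw [latCore, measurePreserving_latShear.measure_preimage
    (by measurability : MeasurableSet _).nullMeasurableSet, Measure.volume_eq_prod,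
    Measure.prod_prod, Measure.volume_eq_prod, Measure.prod_prod]
  simp only [Real.volume_Ico]
  rw [← ENNReal.ofReal_mul (by nlinarith), ← ENNReal.ofReal_mul (by nlinarith)]
  refine ENNReal.ofReal_le_ofReal ?_
  have h1 : (M : ℝ) / 4 ≤ 3 * M / 4 - (M / 4 + 1) := by linarith
  have h2 : (M : ℝ) ^ 2 / 16 ≤ (M : ℝ) ^ 2 / 4 - (M ^ 2 / 8 + 1 / 2) := by nlinarith
  calc (M : ℝ) ^ 4 / 256 = (M / 4) * ((M / 4) * (M ^ 2 / 16)) := by ring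
    _ ≤ _ := by gcongr <;> linarith

lemma boxCut_latRound_eq_one {M : ℕ} (hM : 8 ≤ M) {x : H} (hx : x ∈ latCore M) {t : ℝ}
    (ht : 0 ≤ t) (htM : t ≤ (M : ℝ) ^ 2 / 8) :
    boxCut M (latRound (hmul x (0, 0, t))) = 1 := by
  have hM1 : (8 : ℝ) ≤ M := by exact_mod_cast hM
  obtain ⟨a, b, c⟩ := x
  simp only [latCore, latShear, Set.mem_preimage, Set.mem_prod, Set.mem_Ico, add_zero] at hx
  obtain ⟨⟨a1, a2⟩, ⟨b1, b2⟩, c1, c2⟩ := hx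
  simp only [boxCut, latRound, hmul, add_zero, mul_zero, sub_zero]
  have key : ∀ {s u : ℝ}, 0 < u → u / 4 + 1 ≤ s → s < 3 * u / 4 → trap (⌊s⌋ / u) = 1 := by
    intro s u hu h1 h2
    have := Int.floor_le s
    have := Int.lt_floor_add_one s
    refine trap_eq_one ?_ ?_
    · rw [le_div_iff₀ hu]; linarith
    · rw [div_le_iff₀ hu]; linarith
  rw [key (by linarith) b1 b2, key (by linarith) a1 a2,
    key (by positivity) (by linarith) (by linarith)]
  norm_num

lemma mem_latBox_of_boxCut {M : ℕ} (hM : 0 < M) {P : ℤ × ℤ × ℤ} (h : boxCut M P = 1) :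
    P ∈ latBox M := by
  by_contra hc
  rw [boxCut_eq_zero hM hc] at h
  exact zero_ne_one h

lemma le_rho_latRound {x : H} {t : ℝ} (ht : 1 ≤ t) :
    √t ≤ rho (lat (latRound x)) (lat (latRound (hmul x (0, 0, t)))) := by
  obtain ⟨a, b, c⟩ := x
  simp only [latRound, hmul, add_zero, mul_zero, sub_zero, lat, rho]
  refine Real.sqrt_le_sqrt ?_
  have f3 := floor_sub_floor_abs_le (2 * (c + t + (a * ⌊b⌋ - b * ⌊a⌋)))
    (2 * (c + (a * ⌊b⌋ - b * ⌊a⌋)))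
  rw [abs_le] at f3
  have : ∀ u v : ℝ, t ≤ v - u → t ≤ √(((⌊b⌋ - ⌊b⌋ : ℝ) ^ 2 + (⌊a⌋ - ⌊a⌋ : ℝ) ^ 2) ^ 2 +
      (v - u + 2 * ⌊b⌋ * ⌊a⌋ - 2 * ⌊a⌋ * ⌊b⌋) ^ 2) + (⌊b⌋ - ⌊b⌋ : ℝ) ^ 2 + (⌊a⌋ - ⌊a⌋ : ℝ) ^ 2 := by
    intro u v huv
    have e : ((⌊b⌋ - ⌊b⌋ : ℝ) ^ 2 + (⌊a⌋ - ⌊a⌋ : ℝ) ^ 2) ^ 2 +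
      (v - u + 2 * ⌊b⌋ * ⌊a⌋ - 2 * ⌊a⌋ * ⌊b⌋) ^ 2 = (v - u) ^ 2 := by ring
    rw [e, Real.sqrt_sq (by linarith)]
    linarith [sq_nonneg (⌊b⌋ - ⌊b⌋ : ℝ), sq_nonneg (⌊a⌋ - ⌊a⌋ : ℝ)]
  exact this _ _ (by linarith [f3.1])

lemma measurable_comp_latRound (φ : ℤ × ℤ × ℤ → ℤ × ℤ × ℤ → ℝ) (p q : H) :
    Measurable fun x => φ (latRound (hmul x p)) (latRound (hmul x q)) := by
  have hmeas : ∀ p : H, Measurable fun x => latRound (hmul x p) := fun p =>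
    measurable_latRound.comp (measurePreserving_hmul_right p).measurable
  exact (Measurable.of_discrete (f := Function.uncurry φ)).comp ((hmeas p).prodMk (hmeas q))

/-- From an embedding of a grid to a left-invariant cut-positive semimetric on the Heisenberg
group. -/
lemma exists_invariant {Ω : Type} [MeasurableSpace Ω] {ν : Measure Ω} {M n : ℕ} {D : ℝ}
    {f : H → Lp ℝ 1 ν} (hM : 8 ≤ M) (hMn : M ^ 2 ≤ n) (hD : 1 ≤ D)
    (hf : ∀ x ∈ cube n, ∀ y ∈ cube n, rho x y ≤ ‖f x - f y‖ ∧ ‖f x - f y‖ ≤ D * rho x y) :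
    ∃ d : H → H → ℝ, CutPos d ∧ (∀ a p q, d (hmul a p) (hmul a q) = d p q) ∧
      (∀ r : ℝ, 1 ≤ r → ∀ p : H, |p.1| ≤ r → |p.2.1| ≤ r → |p.2.2| ≤ r ^ 2 →
        d 0 p ≤ 1000000 * D * r) ∧
      ∀ t : ℝ, 1 ≤ t → t ≤ (M : ℝ) ^ 2 / 8 → √t ≤ d 0 (0, 0, t) := by
  have hM0 : 0 < M := by omega
  have hM' : (0 : ℝ) < M := by exact_mod_cast hM0
  set φ : ℤ × ℤ × ℤ → ℤ × ℤ × ℤ → ℝ := fun P Q => ‖cutoffMap M f P - cutoffMap M f Q‖ with hφ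
  set S : H → Set H := fun p => (fun x => latRound (hmul x p)) ⁻¹' latBox M with hS
  have hmeas : ∀ p : H, Measurable fun x => latRound (hmul x p) := fun p =>
    measurable_latRound.comp (measurePreserving_hmul_right p).measurable
  have hSm : ∀ p, MeasurableSet (S p) := fun p => hmeas p (MeasurableSet.of_discrete)
  have hSv : ∀ p, volume (S p) ≤ ENNReal.ofReal (4 * (M : ℝ) ^ 4) := fun p => by
    have := (measurePreserving_hmul_right p).measure_preimage
      (measurable_latRound (MeasurableSet.of_discrete (s := latBox M))).nullMeasurableSet
    exact this.trans_le (volume_latRound_preimage_le hM0)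
  have hSt : ∀ p, volume (S p) ≠ ⊤ := fun p => ((hSv p).trans_lt ENNReal.ofReal_lt_top).ne
  have hSr : ∀ p, volume.real (S p) ≤ 4 * (M : ℝ) ^ 4 := fun p =>
    ENNReal.toReal_le_of_le_ofReal (by positivity) (hSv p)
  have hint1 : ∀ (C : ℝ) (p : H), Integrable ((S p).indicator fun _ => C) := fun C p =>
    (integrable_indicator_iff (hSm p)).2 (integrableOn_const (hSt p))
  have hbd : ∀ (C : ℝ) (p q x : H), 0 ≤ C →
      φ (latRound (hmul x p)) (latRound (hmul x q)) ≤ C →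
      φ (latRound (hmul x p)) (latRound (hmul x q)) ≤
        (S p).indicator (fun _ => C) x + (S q).indicator (fun _ => C) x := by
    intro C p q x hC hle
    by_cases h1 : x ∈ S p
    · rw [Set.indicator_of_mem h1]
      have := Set.indicator_nonneg (s := S q) (fun _ _ => hC) x
      linarith
    · by_cases h2 : x ∈ S q
      · rw [Set.indicator_of_notMem h1, Set.indicator_of_mem h2]
        linarith
      · rw [Set.indicator_of_notMem h1, Set.indicator_of_notMem h2, hφ]
        simp only
        rw [cutoffMap_eq_zero hM0 f h1, cutoffMap_eq_zero hM0 f h2]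
        simp
  have hφm : ∀ p q : H, Measurable fun x => φ (latRound (hmul x p)) (latRound (hmul x q)) :=
    fun p q => measurable_comp_latRound φ p q
  have hφi : ∀ p q : H, Integrable fun x => φ (latRound (hmul x p)) (latRound (hmul x q)) := by
    intro p q
    refine ((hint1 (6 * D * M) p).add (hint1 (6 * D * M) q)).mono' (hφm p q).aestronglyMeasurable
      (.of_forall fun x => ?_)
    rw [Real.norm_of_nonneg (norm_nonneg _)]
    refine hbd _ p q x (by positivity) ((norm_sub_le _ _).trans ?_)
    have h1 := norm_cutoffMap_le hM0 hMn hD hf (latRound (hmul x p))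
    have h2 := norm_cutoffMap_le hM0 hMn hD hf (latRound (hmul x q))
    linarith
  set c : ℝ := 256 / (M : ℝ) ^ 4 with hc
  have hc0 : 0 < c := by positivity
  refine ⟨fun p q => c * ∫ x, φ (latRound (hmul x p)) (latRound (hmul x q)), ?_, ?_, ?_, ?_⟩
  · refine CutPos.integral (μ := ENNReal.ofReal c • volume)
      (D := fun (x p q : H) => φ (latRound (hmul x p)) (latRound (hmul x q)))
      (fun x => CutPos.norm_sub fun p => cutoffMap M f (latRound (hmul x p)))
      (fun p q => (hφi p q).smul_measure ENNReal.ofReal_ne_top) fun p q => ?_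
    rw [integral_smul_measure, ENNReal.toReal_ofReal hc0.le, smul_eq_mul]
  · intro a p q
    simp only [← hmul_assoc]
    congr 1
    clear_value φ
    have hmp := measurePreserving_hmul_right a
    rw [← hmp.map_eq, integral_map hmp.measurable.aemeasurable (hφm p q).aestronglyMeasurable,
      hmp.map_eq]
  · intro r hr p h1 h2 h3
    have : ∫ x, φ (latRound (hmul x 0)) (latRound (hmul x p)) ≤
        ∫ x, ((S 0).indicator (fun _ => 435 * D * r) x +
          (S p).indicator (fun _ => 435 * D * r) x) := by
      refine integral_mono (hφi _ _) ((hint1 _ _).add (hint1 _ _)) fun x => ?_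
      refine hbd _ _ _ _ (by positivity) ?_
      have h := norm_cutoffMap_sub_le hM0 hMn hD hf (by positivity : 0 < 5 * r)
        (latClose_latRound hr h1 h2 h3 x)
      have e : hmul x 0 = x := by simp [hmul]
      rw [e]
      exact h.trans (le_of_eq (by ring))
    rw [integral_add (hint1 _ _) (hint1 _ _), integral_indicator (hSm _),
      integral_indicator (hSm _), setIntegral_const, setIntegral_const, smul_eq_mul,
      smul_eq_mul] at this
    have h5 : 0 ≤ 435 * D * r := by positivity
    have h4 := this.trans (add_le_add (mul_le_mul_of_nonneg_right (hSr 0) h5)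
      (mul_le_mul_of_nonneg_right (hSr p) h5))
    refine (mul_le_mul_of_nonneg_left h4 hc0.le).trans ?_
    have : c * (4 * (M : ℝ) ^ 4 * (435 * D * r) + 4 * (M : ℝ) ^ 4 * (435 * D * r)) =
        890880 * (D * r) := by
      rw [hc]; field_simp; norm_num
    rw [this]
    nlinarith [mul_nonneg (by linarith : 0 ≤ D) (by linarith : 0 ≤ r)]
  · intro t ht htM
    have hCt : volume (latCore M) ≠ ⊤ := by
      refine ((measure_mono fun x hx => ?_).trans_lt (hSt 0).lt_top).ne
      exact mem_latBox_of_boxCut hM0 (boxCut_latRound_eq_one hM hx le_rfl (by positivity))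
    have hcore : (M : ℝ) ^ 4 / 256 ≤ volume.real (latCore M) := by
      have := ENNReal.toReal_mono hCt (le_volume_latCore hM)
      rwa [ENNReal.toReal_ofReal (by positivity)] at this
    have : ∫ x, (latCore M).indicator (fun _ => √t) x ≤
        ∫ x, φ (latRound (hmul x 0)) (latRound (hmul x (0, 0, t))) := by
      refine integral_mono ((integrable_indicator_iff (measurableSet_latCore M)).2
        (integrableOn_const hCt)) (hφi _ _) fun x => ?_
      by_cases hx : x ∈ latCore M
      · rw [Set.indicator_of_mem hx]
        have e : hmul x 0 = x := by simp [hmul]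
        have c1 := boxCut_latRound_eq_one hM hx le_rfl (by positivity)
        have c2 := boxCut_latRound_eq_one hM hx (by linarith) htM
        have e' : hmul x (0, 0, 0) = x := e
        rw [e'] at c1
        simp only [hφ, cutoffMap, e, c1, c2, one_smul, sub_sub_sub_cancel_right]
        exact (le_rho_latRound ht).trans (hf _ (lat_mem_cube hMn (mem_latBox_of_boxCut hM0 c1)) _
          (lat_mem_cube hMn (mem_latBox_of_boxCut hM0 c2))).1
      · rw [Set.indicator_of_notMem hx]; exact norm_nonneg _
    rw [integral_indicator (measurableSet_latCore M), setIntegral_const, smul_eq_mul] at this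
    have h6 := mul_le_mul_of_nonneg_left
      ((mul_le_mul_of_nonneg_right hcore (Real.sqrt_nonneg t)).trans this) hc0.le
    have e : c * ((M : ℝ) ^ 4 / 256 * √t) = √t := by rw [hc]; field_simp
    rwa [e] at h6

lemma sum_inv_two_pow_le (m : ℕ) : ∑ k ∈ Finset.range m, ((2 : ℝ) ^ k)⁻¹ ≤ 2 := by
  have : ∑ k ∈ Finset.range m, ((2 : ℝ) ^ k)⁻¹ = 2 - 2 * ((2 : ℝ) ^ m)⁻¹ := by
    induction m with
    | zero => simp
    | succ m ih => rw [Finset.sum_range_succ, ih, pow_succ]; field_simp; ring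
  rw [this]
  have : (0 : ℝ) < ((2 : ℝ) ^ m)⁻¹ := by positivity
  linarith

lemma subadditive_nsmul_le {Q : ℝ → ℝ} (h0 : Q 0 = 0)
    (hsub : ∀ a b, 0 ≤ a → 0 ≤ b → Q (a + b) ≤ Q a + Q b) (i : ℕ) {u : ℝ} (hu : 0 ≤ u) :
    Q (i * u) ≤ i * Q u := by
  induction i with
  | zero => simp [h0]
  | succ i ih =>
    have := hsub (i * u) u (by positivity) hu
    push_cast
    rw [add_mul, add_mul, one_mul, one_mul]
    linarith

lemma scale_sum_aux {Q : ℝ → ℝ} {K β : ℝ} (hK0 : 0 ≤ K) (hβ : 0 ≤ β) (h0 : Q 0 = 0)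
    (hnn : ∀ a, 0 ≤ a → 0 ≤ Q a) (hsub : ∀ a b, 0 ≤ a → 0 ≤ b → Q (a + b) ≤ Q a + Q b)
    (hK : ∀ a, 0 ≤ a → Q a ≤ K * (1 + β * a)) {a b : ℝ} (ha : 0 ≤ a) (hb : 0 ≤ b) (m l : ℕ) :
    ∑ k ∈ Finset.range m, (Q (2 ^ k * a) + Q (2 ^ k * b) - Q (2 ^ k * (a + b))) / 2 ^ k ≤
      K * (2 * 2 ^ l + l * (β * (a + b)) + 4 + 2 * m * (β * (a + b)) / 2 ^ l) := by
  set q : ℝ := 2 ^ l with hq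
  have hq1 : 1 ≤ q := one_le_pow₀ (by norm_num)
  have hqp : 0 < q := by linarith
  obtain ⟨u, hu⟩ : ∃ u, u = (a + b) / q := ⟨_, rfl⟩
  have hu0 : 0 ≤ u := by rw [hu]; positivity
  have hqu : q * u = a + b := by rw [hu]; field_simp
  obtain ⟨i, hi1, hi2, hi3⟩ : ∃ i : ℕ, i + 1 ≤ 2 ^ l ∧ i * u ≤ a ∧ a ≤ (i + 1) * u := by
    rcases eq_or_lt_of_le hu0 with h | h
    · refine ⟨0, by simpa using Nat.one_le_two_pow, by simpa using ha, ?_⟩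
      rw [← h] at hqu ⊢; linarith
    · rcases le_or_gt (2 ^ l) (⌊a / u⌋₊) with h1 | h1
      · have : q ≤ a / u := by
          have := Nat.floor_le (div_nonneg ha hu0)
          have h2 : ((2 ^ l : ℕ) : ℝ) ≤ ⌊a / u⌋₊ := by exact_mod_cast h1
          push_cast at h2; linarith
        rw [le_div_iff₀ h] at this
        have e : ((2 ^ l - 1 : ℕ) : ℝ) = q - 1 := by
          rw [Nat.cast_sub Nat.one_le_two_pow]; simp [hq]
        refine ⟨2 ^ l - 1, by have := Nat.one_le_two_pow (n := l); omega, ?_, ?_⟩ <;> rw [e] <;>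
          nlinarith
      · refine ⟨⌊a / u⌋₊, h1, ?_, ?_⟩
        · rw [← le_div_iff₀ h]; exact Nat.floor_le (div_nonneg ha hu0)
        · rw [← div_le_iff₀ h]; exact (Nat.lt_floor_add_one _).le
  have hj : ((2 ^ l - (i + 1) : ℕ) : ℝ) = q - 1 - i := by
    rw [Nat.cast_sub hi1]; simp [hq]; ring
  have step : ∀ k, (Q (2 ^ k * a) + Q (2 ^ k * b) - Q (2 ^ k * (a + b))) / 2 ^ k ≤
      q * (Q (2 ^ k * u) / 2 ^ k - Q (2 ^ (k + l) * u) / 2 ^ (k + l)) +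
        (2 * K * (2 ^ k)⁻¹ + 2 * K * β * u) := by
    intro k
    obtain ⟨s, hs⟩ : ∃ s : ℝ, s = 2 ^ k := ⟨_, rfl⟩
    have hsp : 0 < s := by rw [hs]; positivity
    have e1 : (2 : ℝ) ^ (k + l) * u = s * (a + b) := by rw [pow_add, ← hs, ← hq, ← hqu]; ring
    have e2 : (2 : ℝ) ^ (k + l) = s * q := by rw [pow_add, ← hs, ← hq]
    rw [e1, e2, ← hs]
    have rem : ∀ e, 0 ≤ e → e ≤ u → Q (s * e) ≤ K * (1 + β * (s * u)) := fun e he he' => by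
      exact (hK _ (by positivity)).trans (by gcongr)
    have ea : Q (s * a) ≤ i * Q (s * u) + K * (1 + β * (s * u)) := by
      have := hsub (i * (s * u)) (s * (a - i * u)) (by positivity)
        (mul_nonneg hsp.le (by linarith))
      have h1 := subadditive_nsmul_le h0 hsub i (mul_nonneg hsp.le hu0)
      have h2 := rem (a - i * u) (by linarith) (by linarith)
      rw [show i * (s * u) + s * (a - i * u) = s * a by ring] at this
      linarith
    have eb : Q (s * b) ≤ (q - 1 - i) * Q (s * u) + K * (1 + β * (s * u)) := by
      have hnn : (0 : ℝ) ≤ q - 1 - i := by rw [← hj]; positivity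
      have e : s * b = (q - 1 - i) * (s * u) + s * ((i + 1) * u - a) := by
        linear_combination (-s) * hqu
      have := hsub ((q - 1 - i) * (s * u)) (s * ((i + 1) * u - a)) (by positivity)
        (mul_nonneg hsp.le (by linarith))
      have h1 := subadditive_nsmul_le h0 hsub (2 ^ l - (i + 1)) (mul_nonneg hsp.le hu0)
      have h2 := rem ((i + 1) * u - a) (by linarith) (by linarith)
      rw [← e] at this
      rw [hj] at h1
      linarith
    have hQ := hnn (s * u) (by positivity)
    rw [div_le_iff₀ hsp]
    have : (q * (Q (s * u) / s - Q (s * (a + b)) / (s * q)) + (2 * K * s⁻¹ + 2 * K * β * u)) * s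
        = q * Q (s * u) - Q (s * (a + b)) + 2 * (K * (1 + β * (s * u))) := by
      field_simp
    rw [this]
    nlinarith
  refine (Finset.sum_le_sum fun k _ => step k).trans ?_
  rw [Finset.sum_add_distrib, ← Finset.mul_sum, Finset.sum_sub_distrib, Finset.sum_add_distrib,
    ← Finset.mul_sum, Finset.sum_const, Finset.card_range, nsmul_eq_mul]
  set T : ℕ → ℝ := fun k => Q (2 ^ k * u) / 2 ^ k with hT
  have hTn : ∀ k, 0 ≤ T k := fun k => div_nonneg (hnn _ (by positivity)) (by positivity)
  have e3 : ∑ k ∈ Finset.range m, T k - ∑ k ∈ Finset.range m, T (k + l) ≤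
      ∑ k ∈ Finset.range l, T k := by
    have h1 := Finset.sum_range_add T m l
    have h2 := Finset.sum_range_add T l m
    rw [add_comm l m] at h2
    simp only [add_comm l] at h2
    have h3 : 0 ≤ ∑ x ∈ Finset.range l, T (m + x) := Finset.sum_nonneg fun _ _ => hTn _
    linarith
  have e4 : ∑ k ∈ Finset.range l, T k ≤ K * 2 + l * (K * (β * u)) := by
    have : ∀ k ∈ Finset.range l, T k ≤ K * ((2 : ℝ) ^ k)⁻¹ + K * (β * u) := fun k _ => by
      have h := hK (2 ^ k * u) (by positivity)
      simp only [hT]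
      rw [div_le_iff₀ (by positivity)]
      refine h.trans (le_of_eq ?_)
      field_simp
    refine (Finset.sum_le_sum this).trans ?_
    rw [Finset.sum_add_distrib, ← Finset.mul_sum, Finset.sum_const, Finset.card_range,
      nsmul_eq_mul]
    have := mul_le_mul_of_nonneg_left (sum_inv_two_pow_le l) hK0
    linarith
  have e5 := mul_le_mul_of_nonneg_left (sum_inv_two_pow_le m) hK0
  have e6 := mul_le_mul_of_nonneg_left (e3.trans e4) hqp.le
  have e7 : K * (2 * q + l * (β * (a + b)) + 4 + 2 * m * (β * (a + b)) / q)
      = q * (K * 2 + l * (K * (β * u))) + (4 * K + m * (2 * K * β * u)) := by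
    rw [← hqu]; field_simp; ring
  rw [e7]
  linarith

lemma scale_sum {Q : ℝ → ℝ} {K β : ℝ} (hK0 : 0 ≤ K) (hβ : 0 ≤ β) (h0 : Q 0 = 0)
    (hnn : ∀ a, 0 ≤ a → 0 ≤ Q a) (hsub : ∀ a b, 0 ≤ a → 0 ≤ b → Q (a + b) ≤ Q a + Q b)
    (hK : ∀ a, 0 ≤ a → Q a ≤ K * (1 + β * a)) {a b Λ : ℝ} (ha : 0 ≤ a) (hb : 0 ≤ b)
    (hΛ : β * (a + b) ≤ Λ) {m : ℕ} (hm : 1 ≤ m) :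
    ∑ k ∈ Finset.range m, (Q (2 ^ k * a) + Q (2 ^ k * b) - Q (2 ^ k * (a + b))) / 2 ^ k ≤
      9 * K * √m * (1 + Λ) := by
  have := scale_sum_aux hK0 hβ h0 hnn hsub hK ha hb m (Nat.log 4 m) (β := β)
  set l := Nat.log 4 m
  obtain ⟨q, hq⟩ : ∃ q : ℝ, q = 2 ^ l := ⟨_, rfl⟩
  rw [← hq] at this
  refine this.trans ?_
  have hqp : 1 ≤ q := by rw [hq]; exact one_le_pow₀ (by norm_num)
  have h4 : (2 : ℝ) ^ l * 2 ^ l = ((4 ^ l : ℕ) : ℝ) := by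
    rw [← mul_pow]; norm_num
  have h1 : q ^ 2 ≤ m := by
    rw [hq, sq, h4]; exact_mod_cast Nat.pow_log_le_self 4 (by omega)
  have h2 : (m : ℝ) ≤ 4 * q ^ 2 := by
    have : m ≤ 4 * 4 ^ l := by
      have := (Nat.lt_pow_succ_log_self (b := 4) (by norm_num) m).le
      rwa [pow_succ, mul_comm] at this
    rw [hq, sq, h4]; exact_mod_cast this
  have hs : q ≤ √m := Real.le_sqrt_of_sq_le h1
  have hl : (l : ℝ) ≤ q := by
    rw [hq]; exact_mod_cast (Nat.lt_two_pow_self).le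
  have hx : 0 ≤ β * (a + b) := by positivity
  obtain ⟨x, hx'⟩ : ∃ x, x = β * (a + b) := ⟨_, rfl⟩
  rw [← hx'] at hx hΛ ⊢
  have h3 : 2 * m * x / q ≤ 8 * q * x := by
    rw [div_le_iff₀ (by linarith)]; nlinarith
  have hΛ0 : 0 ≤ Λ := hx.trans hΛ
  have h5 : 2 * q + l * x + 4 + 2 * m * x / q ≤ 9 * √m * (1 + Λ) := by
    have e1 : l * x ≤ √m * Λ := by gcongr; linarith
    have e2 : 8 * q * x ≤ 8 * √m * Λ := by gcongr
    nlinarith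
  calc _ ≤ K * (9 * √m * (1 + Λ)) := by gcongr
    _ = _ := by ring

section Columns

/-- The predicate `P` holds on the window of length `N` starting at `ψ`, up to margin `μ`. -/
def HalfOn (N : ℤ) (P : ℤ → Prop) (ψ μ : ℤ) : Prop := ∀ x, ψ + μ ≤ x → x ≤ ψ + N - μ → P x

/-- Rows of `2N`-periodic predicates, each true at one of any two antipodal positions, without
positively oriented alternating triples. -/
structure RowSystem (N : ℤ) (n : ℕ) (A : ℕ → ℤ → Prop) : Prop where
  large : 20 ≤ N
  periodic : ∀ i a, A i (a + 2 * N) ↔ A i a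
  antipodal : ∀ i, i ≤ n → ∀ a, A i a ∨ A i (a + N)
  no_triple : ∀ i j k, i < j → j < k → k ≤ n → (j - i) % 2 = 1 → (k - j) % 2 = 1 →
    ∀ a b c, a < b → b < c → c < a + N → A i a → A j b → ¬ A k c

variable {N : ℤ} {n : ℕ} {A : ℕ → ℤ → Prop}

lemma RowSystem.exists_half (h : RowSystem N n A) (hn : 3 ≤ n) :
    ∃ r ψ, 1 ≤ r ∧ r ≤ 3 ∧ HalfOn N (A r) ψ 2 := by
  obtain ⟨hN, hp, ho, hc⟩ := h
  obtain ⟨a, ha⟩ : ∃ a, A 0 a := by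
    rcases ho 0 (by omega) 0 with h | h <;> exact ⟨_, h⟩
  obtain ⟨m, ⟨hm1, hm2⟩, hm3⟩ : ∃ m, (a < m ∧ A 1 m) ∧ ∀ z, a < z ∧ A 1 z → m ≤ z := by
    refine Int.exists_least_of_bdd ⟨a, fun z hz => hz.1.le⟩ ?_
    rcases ho 1 (by omega) (a + 1) with h | h
    · exact ⟨_, by omega, h⟩
    · exact ⟨_, by omega, h⟩
  have hm4 : ∀ z, a < z → z < m → A 1 (z + N) := fun z h1 h2 =>
    (ho 1 (by omega) z).resolve_left fun h => absurd (hm3 z ⟨h1, h⟩) (by omega)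
  by_cases c1 : a + N - 1 ≤ m
  · refine ⟨1, a + N, le_rfl, by omega, fun x h1 h2 => ?_⟩
    have := hm4 (x - N) (by omega) (by omega)
    rwa [sub_add_cancel] at this
  by_cases c2 : m = a + 1
  · refine ⟨2, a + N, by omega, by omega, fun x h1 h2 => ?_⟩
    have := (ho 2 (by omega) (x - N)).resolve_left
      (hc 0 1 2 (by omega) (by omega) (by omega) rfl rfl a m (x - N) hm1 (by omega) (by omega)
        ha hm2)
    rwa [sub_add_cancel] at this
  have e1 : A 1 (m - 1 + N) := hm4 _ (by omega) (by omega)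
  have e2 : A 2 (m + 1 + N) := (ho 2 (by omega) (m + 1)).resolve_left
      (hc 0 1 2 (by omega) (by omega) (by omega) rfl rfl a m (m + 1) hm1 (by omega) (by omega)
        ha hm2)
  refine ⟨3, m + 2 * N, by omega, by omega, fun x h1 h2 => ?_⟩
  have := (ho 3 (by omega) (x - N)).resolve_left
      (hc 1 2 3 (by omega) (by omega) (by omega) rfl rfl _ _ (x - N) (by omega) (by omega)
        (by omega) e1 e2)
  rwa [sub_add_cancel] at this

lemma RowSystem.half_next (h : RowSystem N n A) {r j : ℕ} {ψ μ : ℤ}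
    (hr : HalfOn N (A r) ψ μ) (hj : r < j) (hjn : j < n) (hpar : (j - r) % 2 = 1) :
    HalfOn N (A j) (ψ + N) (μ + 5) := by
  obtain ⟨hN, hp, ho, hc⟩ := h
  intro x h1 h2
  by_contra hx
  obtain ⟨b, rfl⟩ : ∃ b, x = b + N := ⟨x - N, by omega⟩
  have hb : A j b := (ho j hjn.le b).resolve_right hx
  have hc' := hc r j (j + 1) hj (by omega) (by omega) hpar (by omega)
  have hk : ∀ y, b + N < y → y < b + 2 * N - 1 → A (j + 1) y := fun y h3 h4 => by
    have := (ho (j + 1) (by omega) (y - N)).resolve_left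
      (hc' (b - 1) b (y - N) (by omega) (by omega) (by omega)
        (hr _ (by omega) (by omega)) hb)
    rwa [sub_add_cancel] at this
  rcases ho j hjn.le (b + 3) with h3 | h3
  · exact hc' (b + 2) (b + 3) (b + N + 1) (by omega) (by omega) (by omega)
      (hr _ (by omega) (by omega)) h3 (hk _ (by omega) (by omega))
  · exact hc' (b + 5) (b + 3 + N) (b + N + 4) (by omega) (by omega) (by omega)
      (hr _ (by omega) (by omega)) h3 (hk _ (by omega) (by omega))

lemma RowSystem.exists_phase (h : RowSystem N n A) (hn : 5 ≤ n) :
    ∃ ψ : ℤ, ∀ j, 5 ≤ j → j < n → HalfOn N (A j) (ψ + (j % 2 : ℕ) * N) 12 := by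
  obtain ⟨r, ψ, h1, h3, hr⟩ := h.exists_half (by omega)
  have odd : ∀ j, r < j → j < n → (j - r) % 2 = 1 → HalfOn N (A j) (ψ + N) 7 :=
    fun j a b c => h.half_next hr a b c
  have even : ∀ j, r + 1 < j → j < n → (j - r) % 2 = 0 → HalfOn N (A j) ψ 12 := by
    intro j a b c x hx hx'
    have := h.half_next (odd (r + 1) (by omega) (by omega) (by omega)) a b
      (by omega) (x + 2 * N) (by omega) (by omega)
    exact (h.periodic j x).1 this
  have hN := h.large
  refine ⟨ψ + (r % 2 : ℕ) * N, fun j a b x hx hx' => ?_⟩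
  rcases Nat.mod_two_eq_zero_or_one r with e | e <;>
  rcases Nat.mod_two_eq_zero_or_one j with f | f <;> simp only [e, f] at hx hx' <;>
  push_cast at hx hx'
  · exact even j (by omega) b (by omega) x (by omega) (by omega)
  · exact odd j (by omega) b (by omega) x (by omega) (by omega)
  · exact odd j (by omega) b (by omega) x (by omega) (by omega)
  · exact (h.periodic j x).1 (by
      have := even j (by omega) b (by omega) (x - 2 * N) (by omega) (by omega)
      have h2 := (h.periodic j (x - 2 * N))
      rw [sub_add_cancel] at h2
      exact (h.periodic j x).2 (h2.2 this))

end Columns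

/-- The planar determinant. -/
def det2 (v w : ℝ × ℝ) : ℝ := v.1 * w.2 - v.2 * w.1

/-- The point of the Heisenberg group above `v` at height `z`. -/
def lift2 (v : ℝ × ℝ) (z : ℝ) : H := (v.1, v.2, z)

/-- The unit vector at angle `π a / N`. -/
def unitDir (N : ℕ) (a : ℤ) : ℝ × ℝ :=
  (Real.cos (Real.pi * a / N), Real.sin (Real.pi * a / N))

lemma unitDir_add_half {N : ℕ} (hN : 0 < N) (a : ℤ) : unitDir N (a + N) = -unitDir N a := by
  have hN' : (N : ℝ) ≠ 0 := by positivity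
  have : Real.pi * ((a + N : ℤ) : ℝ) / N = Real.pi * a / N + Real.pi := by
    push_cast; field_simp
  rw [unitDir, unitDir, this, Real.cos_add_pi, Real.sin_add_pi]
  rfl

lemma unitDir_add_full {N : ℕ} (hN : 0 < N) (a : ℤ) : unitDir N (a + 2 * N) = unitDir N a := by
  rw [two_mul, ← add_assoc, unitDir_add_half hN, unitDir_add_half hN, neg_neg]

lemma det2_neg_left (v w : ℝ × ℝ) : det2 (-v) w = -det2 v w := by simp [det2]; ring

lemma det2_neg_right (v w : ℝ × ℝ) : det2 v (-w) = -det2 v w := by simp [det2]; ring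

/-- The point at height `j` on the horizontal line through `lift2 w ζ` with direction `u`. -/
def footAt (u w : ℝ × ℝ) (ζ j : ℝ) : ℝ × ℝ := w + ((ζ - j) / det2 u w) • u

/-- The values of `G` along the ray from height `i` on the vertical axis in the direction `u`, at
the parameters in `T`, agree with the value at the apex. -/
def RayConst (T : Set ℝ) (G : H → Bool) (u : ℝ × ℝ) (i : ℕ) : Prop :=
  ∀ t ∈ T, G (lift2 (t • u) i) = G (lift2 0 i)

/-- The consequences of monotonicity along a finite family of horizontal lines which are used
near a single vertical line. -/
structure AxisMono (N h : ℕ) (η η' : ℝ) (W : Set ((ℝ × ℝ) × ℝ)) (S : Set (ℝ × ℝ)) (T : Set ℝ)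
    (G : H → Bool) : Prop where
  large : 30 ≤ N
  one_mem : (1 : ℝ) ∈ T
  unit_mem : ∀ a, unitDir N a ∈ S
  neg_mem : ∀ u ∈ S, -u ∈ S
  foot_mem : ∀ τ ∈ W, ∀ a, ∀ j ≤ h, η ≤ det2 (unitDir N a) τ.1 →
    footAt (unitDir N a) τ.1 τ.2 j ∈ S
  ray : ∀ u ∈ S, ∀ i ≤ h, RayConst T G u i ∨ RayConst T G (-u) i
  transversal : ∀ u₁ ∈ S, ∀ u₂ ∈ S, ∀ u₃ ∈ S, ∀ i j k : ℕ, i < j → j < k → k ≤ h →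
    η' ≤ det2 u₁ u₂ → η' ≤ det2 u₂ u₃ → η' ≤ det2 u₁ u₃ →
    RayConst T G u₁ i → RayConst T G u₂ j → RayConst T G u₃ k →
    G (lift2 0 i) = G (lift2 0 k) → G (lift2 0 j) = G (lift2 0 i)
  foot_mono : ∀ τ ∈ W, ∀ a, ∀ l k : ℕ, l ≤ h → k ≤ h → l < τ.2 → τ.2 < k →
    η ≤ det2 (unitDir N a) τ.1 →
    G (lift2 (footAt (unitDir N a) τ.1 τ.2 l) l) = G (lift2 (footAt (unitDir N a) τ.1 τ.2 k) k) →
    G (lift2 τ.1 τ.2) = G (lift2 (footAt (unitDir N a) τ.1 τ.2 l) l)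
  unit_det : ∀ a b : ℤ, a < b → b < a + N → η' ≤ det2 (unitDir N a) (unitDir N b)
  foot_det_left : ∀ τ ∈ W, ∀ a, ∀ j ≤ h, η ≤ det2 (unitDir N a) τ.1 →
    η' ≤ det2 (unitDir N (a + 12)) (footAt (unitDir N a) τ.1 τ.2 j)
  foot_det_right : ∀ τ ∈ W, ∀ a, ∀ j ≤ h, η ≤ det2 (unitDir N a) τ.1 →
    η' ≤ det2 (footAt (unitDir N a) τ.1 τ.2 j) (unitDir N (a + N - 12))

namespace AxisMono

variable {N h : ℕ} {η η' : ℝ} {W : Set ((ℝ × ℝ) × ℝ)} {S : Set (ℝ × ℝ)} {T : Set ℝ} {G : H → Bool}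
  {n : ℕ} {x : ℕ → ℕ}

lemma rowSystem (hG : AxisMono N h η η' W S T G) (hx : ∀ i j, i < j → j ≤ n → x i < x j)
    (hxn : x n ≤ h) (hal : ∀ i < n, G (lift2 0 (x (i + 1))) ≠ G (lift2 0 (x i))) :
    RowSystem N n (fun i a => RayConst T G (unitDir N a) (x i)) := by
  have hN : 0 < N := by have := hG.large; omega
  have hxh : ∀ i ≤ n, x i ≤ h := fun i hi => by
    rcases hi.eq_or_lt with rfl | hi
    · exact hxn
    · exact (hx i n hi le_rfl).le.trans hxn
  have par : ∀ i d, i + d ≤ n → G (lift2 0 (x (i + d))) =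
      (if d % 2 = 0 then G (lift2 0 (x i)) else !G (lift2 0 (x i))) := by
    intro i d
    induction d with
    | zero => simp
    | succ d ih =>
      intro hd
      have h1 := ih (by omega)
      have h2 := hal (i + d) (by omega)
      rw [← add_assoc]
      revert h1 h2
      rcases Nat.mod_two_eq_zero_or_one d with e | e
      · rw [if_pos e, if_neg (by omega : ¬ (d + 1) % 2 = 0)]
        intro h1 h2; rw [h1] at h2; exact Bool.eq_not_of_ne h2
      · rw [if_neg (by omega), if_pos (by omega : (d + 1) % 2 = 0)]
        intro h1 h2; rw [h1] at h2
        have := Bool.eq_not_of_ne h2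
        rwa [Bool.not_not] at this
  refine ⟨by have := hG.large; omega, fun i a => ?_, fun i hi a => ?_, ?_⟩
  · simp only [unitDir_add_full hN]
  · simp only [unitDir_add_half hN]
    exact hG.ray _ (hG.unit_mem a) _ (hxh i hi)
  · intro i j k hij hjk hk p1 p2 a b c hab hbc hca A1 A2 A3
    have e1 := par i (j - i) (by omega)
    have e2 := par j (k - j) (by omega)
    rw [Nat.add_sub_cancel' hij.le, if_neg (by omega)] at e1
    rw [Nat.add_sub_cancel' hjk.le, if_neg (by omega)] at e2
    have := hG.transversal _ (hG.unit_mem a) _ (hG.unit_mem b) _ (hG.unit_mem c) _ _ _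
      (hx i j hij (by omega)) (hx j k hjk hk) (hxh k hk) (hG.unit_det a b hab (by omega))
      (hG.unit_det b c hbc (by omega)) (hG.unit_det a c (by omega) hca) A1 A2 A3
      (by rw [e2, e1, Bool.not_not])
    rw [e1] at this
    simp at this

lemma foot_value (hG : AxisMono N h η η' W S T G) {τ : (ℝ × ℝ) × ℝ} (hτ : τ ∈ W) {a : ℤ}
    (hη : η ≤ det2 (unitDir N a) τ.1) {i j k : ℕ} (hij : i < j) (hjk : j < k) (hk : k ≤ h)
    (hi : HalfOn N (fun b => RayConst T G (unitDir N b) i) (a + N) 12)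
    (hk' : HalfOn N (fun b => RayConst T G (unitDir N b) k) (a + N) 12)
    (hik : G (lift2 0 i) = G (lift2 0 k)) (hne : G (lift2 0 j) ≠ G (lift2 0 i)) :
    G (lift2 (footAt (unitDir N a) τ.1 τ.2 j) j) = G (lift2 0 j) := by
  have hN := hG.large
  have hN0 : 0 < N := by omega
  set P := footAt (unitDir N a) τ.1 τ.2 j with hP
  have hPS := hG.foot_mem τ hτ a j (by omega) hη
  have key : ¬ RayConst T G (-P) j := by
    intro hneg
    have r1 : RayConst T G (unitDir N (a + 12 + N)) i := hi _ (by omega) (by omega)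
    have r3 : RayConst T G (unitDir N (a + N - 12 + N)) k := hk' _ (by omega) (by omega)
    have d1 : η' ≤ det2 (unitDir N (a + 12 + N)) (-P) := by
      rw [unitDir_add_half hN0, det2_neg_left, det2_neg_right, neg_neg]
      exact hG.foot_det_left τ hτ a j (by omega) hη
    have d3 : η' ≤ det2 (-P) (unitDir N (a + N - 12 + N)) := by
      rw [unitDir_add_half hN0, det2_neg_left, det2_neg_right, neg_neg]
      exact hG.foot_det_right τ hτ a j (by omega) hη
    exact hne (hG.transversal _ (hG.unit_mem _) _ (hG.neg_mem _ hPS) _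
      (hG.unit_mem _) i j k hij hjk hk d1 d3
      (hG.unit_det _ _ (by omega) (by omega)) r1 hneg r3 hik)
  have := ((hG.ray P hPS j (by omega)).resolve_right key) 1 hG.one_mem
  rwa [one_smul] at this

/-- Near a wiggle with many alternations below and above it, `G` is a half-plane indicator. -/
lemma dichotomy (hG : AxisMono N h η η' W S T G) (hx : ∀ i j, i < j → j ≤ 20 → x i < x j)
    (hxn : x 20 ≤ h) (hal : ∀ i < 20, G (lift2 0 (x (i + 1))) ≠ G (lift2 0 (x i))) :
    ∃ (a : ℤ) (e : Bool), ∀ τ ∈ W, (x 8 : ℝ) < τ.2 → τ.2 < x 17 →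
      (η ≤ det2 (unitDir N a) τ.1 → G (lift2 τ.1 τ.2) = e) ∧
      (det2 (unitDir N a) τ.1 ≤ -η → G (lift2 τ.1 τ.2) = !e) := by
  have hN := hG.large
  have hN0 : 0 < N := by omega
  obtain ⟨ψ, hψ⟩ := (hG.rowSystem hx hxn hal).exists_phase (by norm_num)
  have hxh : ∀ i ≤ 20, x i ≤ h := fun i hi => by
    rcases hi.eq_or_lt with rfl | hi
    · exact hxn
    · exact (hx i 20 hi le_rfl).le.trans hxn
  have two : ∀ i, i + 2 ≤ 20 → G (lift2 0 (x i)) = G (lift2 0 (x (i + 2))) := fun i hi => by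
    have h1 := hal i (by omega)
    have h2 := hal (i + 1) (by omega)
    revert h1 h2
    rw [show i + 1 + 1 = i + 2 from rfl]
    cases G (lift2 0 (x i)) <;> cases G (lift2 0 (x (i + 1))) <;>
      cases G (lift2 0 (x (i + 2))) <;> simp
  have main : ∀ (a : ℤ) (l k : ℕ), l = 7 ∨ l = 8 → k = l + 10 →
      HalfOn N (fun b => RayConst T G (unitDir N b) (x (l - 1))) (a + N) 12 →
      HalfOn N (fun b => RayConst T G (unitDir N b) (x (l + 1))) (a + N) 12 →
      HalfOn N (fun b => RayConst T G (unitDir N b) (x (k - 1))) (a + N) 12 →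
      HalfOn N (fun b => RayConst T G (unitDir N b) (x (k + 1))) (a + N) 12 →
      ∀ τ ∈ W, (x 8 : ℝ) < τ.2 → τ.2 < x 17 → η ≤ det2 (unitDir N a) τ.1 →
      G (lift2 τ.1 τ.2) = G (lift2 0 (x l)) := by
    intro a l k hl hk H1 H2 H3 H4 τ hτ t1 t2 hη
    have val : ∀ r, 6 ≤ r → r ≤ 19 →
        HalfOn N (fun b => RayConst T G (unitDir N b) (x (r - 1))) (a + N) 12 →
        HalfOn N (fun b => RayConst T G (unitDir N b) (x (r + 1))) (a + N) 12 →
        G (lift2 (footAt (unitDir N a) τ.1 τ.2 (x r)) (x r)) = G (lift2 0 (x r)) := by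
      intro r h6 h19 K1 K2
      have e1 := two (r - 1) (by omega)
      have e2 := hal (r - 1) (by omega)
      rw [show r - 1 + 2 = r + 1 by omega] at e1
      rw [show r - 1 + 1 = r by omega] at e2
      exact hG.foot_value hτ hη (hx (r - 1) r (by omega) (by omega))
        (hx r (r + 1) (by omega) (by omega)) (hxh _ (by omega)) K1 K2 e1 e2
    have v1 := val l (by omega) (by omega) H1 H2
    have v2 := val k (by omega) (by omega) H3 H4
    have same : G (lift2 0 (x l)) = G (lift2 0 (x k)) := by
      rw [hk, two l (by omega), two (l + 2) (by omega), two (l + 4) (by omega),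
        two (l + 6) (by omega), two (l + 8) (by omega)]
    have c1 : x l ≤ x 8 := by
      rcases hl with rfl | rfl
      · exact (hx 7 8 (by omega) (by omega)).le
      · exact le_rfl
    have c2 : x 17 ≤ x k := by
      rcases hl with rfl | rfl <;> subst hk
      · exact le_rfl
      · exact (hx 17 18 (by omega) (by omega)).le
    have c1' : (x l : ℝ) ≤ x 8 := by exact_mod_cast c1
    have c2' : (x 17 : ℝ) ≤ x k := by exact_mod_cast c2
    rw [hG.foot_mono τ hτ a (x l) (x k) (hxh _ (by omega)) (hxh _ (by omega))
      (by linarith) (by linarith) hη (by rw [v1, v2, same]), v1]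
  have even : ∀ j, 5 ≤ j → j < 20 → j % 2 = 0 →
      HalfOn N (fun b => RayConst T G (unitDir N b) (x j)) ψ 12 := fun j h1 h2 h3 => by
    have := hψ j h1 h2
    simpa [h3] using this
  have odd : ∀ j, 5 ≤ j → j < 20 → j % 2 = 1 →
      HalfOn N (fun b => RayConst T G (unitDir N b) (x j)) (ψ + N) 12 := fun j h1 h2 h3 => by
    have := hψ j h1 h2
    simpa [h3] using this
  have even' : ∀ j, 5 ≤ j → j < 20 → j % 2 = 0 →
      HalfOn N (fun b => RayConst T G (unitDir N b) (x j)) (ψ + N + N) 12 := by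
    intro j h1 h2 h3 b h4 h5
    have := even j h1 h2 h3 (b - 2 * N) (by omega) (by omega)
    simp only at this ⊢
    rwa [← unitDir_add_full hN0, sub_add_cancel] at this
  refine ⟨ψ, G (lift2 0 (x 8)), fun τ hτ t1 t2 => ⟨fun hη => ?_, fun hη => ?_⟩⟩
  · exact main ψ 8 18 (by omega) rfl (odd 7 (by omega) (by omega) rfl)
      (odd 9 (by omega) (by omega) rfl) (odd 17 (by omega) (by omega) rfl)
      (odd 19 (by omega) (by omega) rfl) τ hτ t1 t2 hη
  · rw [main (ψ + N) 7 17 (by omega) rfl (even' 6 (by omega) (by omega) rfl)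
      (even' 8 (by omega) (by omega) rfl) (even' 16 (by omega) (by omega) rfl)
      (even' 18 (by omega) (by omega) rfl) τ hτ t1 t2
      (by rw [unitDir_add_half hN0, det2_neg_left]; linarith)]
    exact Bool.eq_not_of_ne (hal 7 (by omega)).symm

end AxisMono

/-- Monotonicity of `G` at the points `0`, `a`, `a + b` of the horizontal line through `p` in the
direction `w`. -/
def LineMono (G : H → Bool) (p : H) (w : ℝ × ℝ) (a b : ℝ) : Prop :=
  G p = G (hmul p (lift2 ((a + b) • w) 0)) → G (hmul p (lift2 (a • w) 0)) = G p

lemma hmul_lift2 (v w : ℝ × ℝ) (y z : ℝ) :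
    hmul (lift2 v y) (lift2 w z) = lift2 (v + w) (y + z + det2 v w) := by
  simp only [hmul, lift2, det2]
  refine Prod.ext rfl (Prod.ext rfl ?_)
  simp only
  ring

lemma LineMono.ray {G : H → Bool} {u : ℝ × ℝ} {t t' z : ℝ}
    (h : LineMono G (lift2 (-t' • u) z) u t' t)
    (he : G (lift2 (-t' • u) z) = G (lift2 (t • u) z)) :
    G (lift2 0 z) = G (lift2 (-t' • u) z) := by
  simp only [LineMono, hmul_lift2] at h
  have e1 : -t' • u + (t' + t) • u = t • u := by rw [← add_smul]; congr 1; ring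
  have e2 : -t' • u + t' • u = 0 := by rw [← add_smul, neg_add_cancel, zero_smul]
  have e3 : ∀ s : ℝ, det2 (-t' • u) (s • u) = 0 := fun s => by simp [det2]; ring
  rw [e1, e2, e3, e3, add_zero, add_zero] at h
  exact h he

/-- The parameter, on the middle ray, of the horizontal line meeting three rays. -/
def midParam (u₁ u₂ u₃ : ℝ × ℝ) (Δ₁ Δ₂ : ℝ) : ℝ :=
  √(Δ₁ * Δ₂ * det2 u₁ u₃ / ((Δ₁ + Δ₂) * (det2 u₁ u₂ * det2 u₂ u₃)))

/-- The parameter, on the first ray, of the horizontal line meeting three rays. -/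
def lowParam (u₁ u₂ u₃ : ℝ × ℝ) (Δ₁ Δ₂ : ℝ) : ℝ :=
  (Δ₁ + Δ₂) / Δ₂ * (midParam u₁ u₂ u₃ Δ₁ Δ₂ * det2 u₂ u₃ / det2 u₁ u₃)

/-- The parameter, on the last ray, of the horizontal line meeting three rays. -/
def highParam (u₁ u₂ u₃ : ℝ × ℝ) (Δ₁ Δ₂ : ℝ) : ℝ :=
  (Δ₁ + Δ₂) / Δ₁ * (midParam u₁ u₂ u₃ Δ₁ Δ₂ * det2 u₁ u₂ / det2 u₁ u₃)

lemma LineMono.transversal {G : H → Bool} {u₁ u₂ u₃ : ℝ × ℝ} {Δ₁ Δ₂ z : ℝ} (h12 : 0 < det2 u₁ u₂)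
    (h23 : 0 < det2 u₂ u₃) (h13 : 0 < det2 u₁ u₃) (hΔ₁ : 0 < Δ₁) (hΔ₂ : 0 < Δ₂)
    (h : LineMono G (lift2 (lowParam u₁ u₂ u₃ Δ₁ Δ₂ • u₁) z)
      (midParam u₁ u₂ u₃ Δ₁ Δ₂ • u₂ - lowParam u₁ u₂ u₃ Δ₁ Δ₂ • u₁) 1 (Δ₂ / Δ₁))
    (he : G (lift2 (lowParam u₁ u₂ u₃ Δ₁ Δ₂ • u₁) z) =
      G (lift2 (highParam u₁ u₂ u₃ Δ₁ Δ₂ • u₃) (z + Δ₁ + Δ₂))) :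
    G (lift2 (midParam u₁ u₂ u₃ Δ₁ Δ₂ • u₂) (z + Δ₁)) =
      G (lift2 (lowParam u₁ u₂ u₃ Δ₁ Δ₂ • u₁) z) := by
  set t₂ := midParam u₁ u₂ u₃ Δ₁ Δ₂ with ht₂
  set t₁ := lowParam u₁ u₂ u₃ Δ₁ Δ₂ with ht₁
  set t₃ := highParam u₁ u₂ u₃ Δ₁ Δ₂ with ht₃
  have sq : t₂ * t₂ = Δ₁ * Δ₂ * det2 u₁ u₃ / ((Δ₁ + Δ₂) * (det2 u₁ u₂ * det2 u₂ u₃)) :=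
    Real.mul_self_sqrt (by positivity)
  have dw : ∀ s : ℝ, det2 (t₁ • u₁) (s • (t₂ • u₂ - t₁ • u₁)) = s * Δ₁ := fun s => by
    have : det2 (t₁ • u₁) (s • (t₂ • u₂ - t₁ • u₁)) = s * (t₁ * t₂ * det2 u₁ u₂) := by
      simp [det2]; ring
    rw [this]
    congr 1
    rw [ht₁, lowParam, ← ht₂]
    have : (Δ₁ + Δ₂) / Δ₂ * (t₂ * det2 u₂ u₃ / det2 u₁ u₃) * t₂ * det2 u₁ u₂ =
      (t₂ * t₂) * ((Δ₁ + Δ₂) / Δ₂ * det2 u₂ u₃ / det2 u₁ u₃ * det2 u₁ u₂) := by ring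
    rw [this, sq]
    field_simp
  have e2 : t₁ • u₁ + (1 : ℝ) • (t₂ • u₂ - t₁ • u₁) = t₂ • u₂ := by
    rw [one_smul]; abel
  have e3 : t₁ • u₁ + (1 + Δ₂ / Δ₁) • (t₂ • u₂ - t₁ • u₁) = t₃ • u₃ := by
    have cr1 : det2 u₁ u₃ * u₂.1 = det2 u₂ u₃ * u₁.1 + det2 u₁ u₂ * u₃.1 := by
      simp only [det2]; ring
    have cr2 : det2 u₁ u₃ * u₂.2 = det2 u₂ u₃ * u₁.2 + det2 u₁ u₂ * u₃.2 := by
      simp only [det2]; ring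
    have k1 : u₂.1 = (det2 u₂ u₃ * u₁.1 + det2 u₁ u₂ * u₃.1) / det2 u₁ u₃ := by
      rw [← cr1]; field_simp
    have k2 : u₂.2 = (det2 u₂ u₃ * u₁.2 + det2 u₁ u₂ * u₃.2) / det2 u₁ u₃ := by
      rw [← cr2]; field_simp
    rw [ht₁, lowParam, ht₃, highParam, ← ht₂]
    refine Prod.ext ?_ ?_
    · simp only [Prod.fst_add, Prod.smul_fst, Prod.fst_sub, smul_eq_mul]
      rw [k1]; field_simp; ring
    · simp only [Prod.snd_add, Prod.smul_snd, Prod.snd_sub, smul_eq_mul]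
      rw [k2]; field_simp; ring
  simp only [LineMono, hmul_lift2] at h
  rw [e2, e3, dw, dw, add_zero, one_mul] at h
  refine h (he.trans ?_)
  congr 2
  field_simp
  ring

lemma LineMono.foot {G : H → Bool} {u w : ℝ × ℝ} {ζ l k : ℝ} (hd : det2 u w ≠ 0)
    (h : LineMono G (lift2 (footAt u w ζ l) l) (-u) ((ζ - l) / det2 u w) ((k - ζ) / det2 u w))
    (he : G (lift2 (footAt u w ζ l) l) = G (lift2 (footAt u w ζ k) k)) :
    G (lift2 w ζ) = G (lift2 (footAt u w ζ l) l) := by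
  simp only [LineMono, hmul_lift2] at h
  have e1 : footAt u w ζ l + ((ζ - l) / det2 u w) • -u = w := by
    simp [footAt]
  have e2 : footAt u w ζ l + ((ζ - l) / det2 u w + (k - ζ) / det2 u w) • -u = footAt u w ζ k := by
    rw [footAt, footAt, smul_neg, add_assoc, ← sub_eq_add_neg, ← sub_smul]
    congr 2
    ring
  have e3 : ∀ s, det2 (footAt u w ζ l) (s • -u) = s * det2 u w := fun s => by
    simp [footAt, det2]; ring
  rw [e1, e2, e3, e3, div_mul_cancel₀ _ hd, ← add_div, div_mul_cancel₀ _ hd] at h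
  have e4 : l + 0 + (ζ - l) = ζ := by ring
  have e5 : l + 0 + (ζ - l + (k - ζ)) = k := by ring
  rw [e4, e5] at h
  exact h he

lemma det2_unitDir {N : ℕ} (a b : ℤ) :
    det2 (unitDir N a) (unitDir N b) = Real.sin (Real.pi * (b - a : ℤ) / N) := by
  have : Real.pi * ((b - a : ℤ) : ℝ) / N = Real.pi * b / N - Real.pi * a / N := by
    push_cast; ring
  rw [this, Real.sin_sub, det2, unitDir, unitDir]
  ring

lemma two_div_le_det2_unitDir {N : ℕ} {a b : ℤ} (hab : a < b) (hb : b < a + N) :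
    2 / (N : ℝ) ≤ det2 (unitDir N a) (unitDir N b) := by
  have hN : (0 : ℝ) < N := by
    have : 0 < N := by omega
    exact_mod_cast this
  rw [det2_unitDir]
  have key : ∀ m : ℝ, 1 ≤ m → m ≤ N / 2 → 2 / (N : ℝ) ≤ Real.sin (Real.pi * m / N) := by
    intro m h1 h2
    have hpi := Real.pi_pos
    have := Real.mul_le_sin (x := Real.pi * m / N) (by positivity) (by
      rw [div_le_div_iff₀ hN two_pos]; nlinarith)
    refine le_trans ?_ this
    have e : 2 / Real.pi * (Real.pi * m / N) = 2 * m / N := by field_simp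
    rw [e]
    gcongr
    linarith
  have c1 : (1 : ℝ) ≤ (b - a : ℤ) := by exact_mod_cast (by omega : 1 ≤ b - a)
  have c2 : ((b - a : ℤ) : ℝ) ≤ N - 1 := by
    have : ((b - a : ℤ) : ℝ) + 1 ≤ N := by exact_mod_cast (by omega : b - a + 1 ≤ (N : ℤ))
    linarith
  rcases le_total ((b - a : ℤ) : ℝ) (N / 2) with h | h
  · exact key _ c1 h
  · have := key (N - (b - a : ℤ)) (by linarith) (by linarith)
    rwa [mul_sub, sub_div, mul_div_cancel_right₀ _ hN.ne', Real.sin_pi_sub] at this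

lemma det2_unitDir_add_foot {N : ℕ} (a m : ℤ) (w : ℝ × ℝ) (ζ j : ℝ) :
    det2 (unitDir N (a + m)) (footAt (unitDir N a) w ζ j) =
      Real.cos (Real.pi * m / N) * det2 (unitDir N a) w -
      Real.sin (Real.pi * m / N) * ((unitDir N a).1 * w.1 + (unitDir N a).2 * w.2 +
        (ζ - j) / det2 (unitDir N a) w) := by
  have e : Real.pi * ((a + m : ℤ) : ℝ) / N = Real.pi * a / N + Real.pi * m / N := by
    push_cast; ring
  rw [footAt]
  generalize (ζ - j) / det2 (unitDir N a) w = r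
  simp only [unitDir, e, Real.cos_add, Real.sin_add, det2, Prod.fst_add, Prod.snd_add,
    Prod.smul_fst, Prod.smul_snd, smul_eq_mul]
  have h1 := Real.sin_sq_add_cos_sq (Real.pi * a / N)
  generalize Real.sin (Real.pi * a / N) = s at *
  generalize Real.cos (Real.pi * a / N) = c at *
  linear_combination (-r * Real.sin (Real.pi * m / N)) * h1

lemma le_det2_add_foot {N : ℕ} (a m : ℤ) {w : ℝ × ℝ} {ζ j η B : ℝ} (hN : 0 < N) (hη0 : 0 < η)
    (hη : η ≤ det2 (unitDir N a) w) (hw1 : |w.1| ≤ 4) (hw2 : |w.2| ≤ 4) (hB : |ζ - j| ≤ B)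
    (hm : |(m : ℝ)| * (8 + B / η) * 16 ≤ N * η) (hm' : |(m : ℝ)| * 8 ≤ N) :
    η / 4 ≤ det2 (unitDir N (a + m)) (footAt (unitDir N a) w ζ j) := by
  have hN' : (0 : ℝ) < N := by exact_mod_cast hN
  rw [det2_unitDir_add_foot]
  set θ := Real.pi * m / N
  set y := det2 (unitDir N a) w
  have hy : 0 < y := hη0.trans_le hη
  have hpi := Real.pi_le_four
  have hθ : |θ| ≤ 4 * |(m : ℝ)| / N := by
    rw [abs_div, abs_mul, abs_of_pos Real.pi_pos, abs_of_pos hN']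
    gcongr
  have hθ1 : |θ| ≤ 1 / 2 := hθ.trans (by rw [div_le_iff₀ hN']; linarith)
  have hc : 1 / 2 ≤ Real.cos θ := by
    have h1 := Real.one_sub_sq_div_two_le_cos (x := θ)
    have h2 : θ ^ 2 ≤ (1 / 2) ^ 2 := by rw [← sq_abs]; gcongr
    linarith
  have hs : |Real.sin θ| ≤ 4 * |(m : ℝ)| / N := Real.abs_sin_le_abs.trans hθ
  have hX : |(unitDir N a).1 * w.1 + (unitDir N a).2 * w.2 + (ζ - j) / y| ≤ 8 + B / η := by
    have u1 : |(unitDir N a).1| ≤ 1 := Real.abs_cos_le_one _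
    have u2 : |(unitDir N a).2| ≤ 1 := Real.abs_sin_le_one _
    have h3 : |(ζ - j) / y| ≤ B / η := by
      rw [abs_div, abs_of_pos hy]
      exact div_le_div₀ ((abs_nonneg _).trans hB) hB hη0 hη
    have h1 : |(unitDir N a).1 * w.1| ≤ 1 * 4 := by rw [abs_mul]; gcongr
    have h2 : |(unitDir N a).2 * w.2| ≤ 1 * 4 := by rw [abs_mul]; gcongr
    have := abs_add_three ((unitDir N a).1 * w.1) ((unitDir N a).2 * w.2) ((ζ - j) / y)
    linarith
  have hsX :
      Real.sin θ * ((unitDir N a).1 * w.1 + (unitDir N a).2 * w.2 + (ζ - j) / y) ≤ η / 4 := by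
    refine (le_abs_self _).trans ?_
    rw [abs_mul]
    calc _ ≤ (4 * |(m : ℝ)| / N) * (8 + B / η) := by gcongr
      _ ≤ η / 4 := by
        rw [div_mul_eq_mul_div, div_le_iff₀ hN']; nlinarith
  have : 1 / 2 * η ≤ Real.cos θ * y := mul_le_mul hc hη hη0.le (by linarith)
  linarith

/-- The columns lie above points of a parabola. -/
def colPt (R c : ℕ) : ℝ × ℝ := (c / R, (c / R) ^ 2)

/-- The planar points used to test half-planes. -/
def testPts (R : ℕ) : Finset (ℝ × ℝ) :=
  (Finset.range R).image (colPt R) ∪ {(3, 0), (-3, 0), (0, 3), (0, -3)}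

/-- The width below which a half-plane is not resolved. -/
def wid (R : ℕ) : ℝ := 1 / (8 * R ^ 3)

/-- The test points at integer heights, in the coordinates of the columns. -/
def slabPts (R : ℕ) : Finset ((ℝ × ℝ) × ℝ) :=
  ((Finset.range R ×ˢ testPts R) ×ˢ Finset.range (R ^ 2 + 1)).image fun x =>
    (x.1.2 - colPt R x.1.1, x.2 - det2 (colPt R x.1.1) x.1.2)

/-- Index set for lines through a slab point which meet integer heights. -/
def footIdx (R : ℕ) : Finset (((ℝ × ℝ) × ℝ) × ℕ) :=
  (slabPts R ×ˢ Finset.range (2 * R ^ 12)).filter fun x =>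
    wid R ≤ det2 (unitDir (R ^ 12) x.2) x.1.1

/-- The feet of the lines through slab points. -/
def feet (R : ℕ) : Finset (ℝ × ℝ) :=
  (footIdx R ×ˢ Finset.range (R ^ 2 + 1)).image fun x =>
    footAt (unitDir (R ^ 12) x.1.2) x.1.1.1 x.1.1.2 x.2

/-- The directions of the rays. -/
def dirs (R : ℕ) : Finset (ℝ × ℝ) :=
  ((Finset.range (2 * R ^ 12)).image fun a : ℕ => unitDir (R ^ 12) a) ∪
    (feet R ∪ (feet R).image fun v => -v)

/-- Index set for lines meeting three rays. -/
def transIdx (R : ℕ) : Finset (((ℝ × ℝ) × (ℝ × ℝ) × (ℝ × ℝ)) × (ℕ × ℕ)) :=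
  ((dirs R ×ˢ dirs R ×ˢ dirs R) ×ˢ
    (Finset.range (R ^ 2 + 1) ×ˢ Finset.range (R ^ 2 + 1))).filter fun x =>
      (1 / (R : ℝ) ^ 12 ≤ det2 x.1.1 x.1.2.1 ∧ 1 / (R : ℝ) ^ 12 ≤ det2 x.1.2.1 x.1.2.2 ∧
        1 / (R : ℝ) ^ 12 ≤ det2 x.1.1 x.1.2.2) ∧ 1 ≤ x.2.1 ∧ 1 ≤ x.2.2

/-- The parameters along rays. -/
def params (R : ℕ) : Finset ℝ :=
  {1} ∪ ((transIdx R).image (fun x => lowParam x.1.1 x.1.2.1 x.1.2.2 x.2.1 x.2.2) ∪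
    ((transIdx R).image (fun x => midParam x.1.1 x.1.2.1 x.1.2.2 x.2.1 x.2.2) ∪
      (transIdx R).image (fun x => highParam x.1.1 x.1.2.1 x.1.2.2 x.2.1 x.2.2)))

/-- Data for three points on a horizontal line: a base point, a direction, and two lengths. -/
abbrev Frame : Type := H × (ℝ × ℝ) × ℝ × ℝ

/-- Monotonicity along a frame. -/
def FrameMono (G : H → Bool) (τ : Frame) : Prop := LineMono G τ.1 τ.2.1 τ.2.2.1 τ.2.2.2

/-- Frames on horizontal lines meeting the vertical axis. -/
def rayFrames (R : ℕ) : Finset Frame :=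
  (Finset.range (R ^ 2 + 1) ×ˢ dirs R ×ˢ params R ×ˢ params R).image fun x =>
    (lift2 (-x.2.2.2 • x.2.1) x.1, x.2.1, x.2.2.2, x.2.2.1)

/-- Frames on horizontal lines meeting three rays. -/
def transFrames (R : ℕ) : Finset Frame :=
  (Finset.range (R ^ 2 + 1) ×ˢ transIdx R).image fun x =>
    (lift2 (lowParam x.2.1.1 x.2.1.2.1 x.2.1.2.2 x.2.2.1 x.2.2.2 • x.2.1.1) x.1,
      midParam x.2.1.1 x.2.1.2.1 x.2.1.2.2 x.2.2.1 x.2.2.2 • x.2.1.2.1 -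
        lowParam x.2.1.1 x.2.1.2.1 x.2.1.2.2 x.2.2.1 x.2.2.2 • x.2.1.1,
      1, (x.2.2.2 : ℝ) / (x.2.2.1 : ℝ))

/-- Frames on horizontal lines through slab points. -/
def footFrames (R : ℕ) : Finset Frame :=
  ((footIdx R ×ˢ (Finset.range (R ^ 2 + 1) ×ˢ Finset.range (R ^ 2 + 1))).filter fun x =>
    (x.2.1 : ℝ) < x.1.1.2 ∧ x.1.1.2 < (x.2.2 : ℝ)).image fun x =>
      (lift2 (footAt (unitDir (R ^ 12) x.1.2) x.1.1.1 x.1.1.2 x.2.1) x.2.1,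
        -unitDir (R ^ 12) x.1.2,
        (x.1.1.2 - x.2.1) / det2 (unitDir (R ^ 12) x.1.2) x.1.1.1,
        (x.2.2 - x.1.1.2) / det2 (unitDir (R ^ 12) x.1.2) x.1.1.1)

lemma abs_colPt {R c : ℕ} (hc : c < R) :
    (0 ≤ (colPt R c).1 ∧ (colPt R c).1 ≤ 1) ∧ 0 ≤ (colPt R c).2 ∧ (colPt R c).2 ≤ 1 := by
  have h0 : (0 : ℝ) ≤ (c : ℝ) / R := by positivity
  have h1 : (c : ℝ) / R ≤ 1 := by
    rw [div_le_one (by exact_mod_cast (by omega : 0 < R))]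
    exact_mod_cast hc.le
  exact ⟨⟨h0, h1⟩, by simp only [colPt]; positivity, by simp only [colPt]; exact pow_le_one₀ h0 h1⟩

lemma abs_testPts {R : ℕ} {p : ℝ × ℝ} (hp : p ∈ testPts R) :
    |p.1| + |p.2| ≤ 3 := by
  simp only [testPts, Finset.mem_union, Finset.mem_image, Finset.mem_range, Finset.mem_insert,
    Finset.mem_singleton] at hp
  rcases hp with ⟨c, hc, rfl⟩ | rfl | rfl | rfl | rfl
  · obtain ⟨⟨h1, h2⟩, h3, h4⟩ := abs_colPt hc
    rw [abs_of_nonneg h1, abs_of_nonneg h3]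
    linarith
  all_goals norm_num

lemma abs_det2_colPt {R c : ℕ} (hc : c < R) {p : ℝ × ℝ} (hp : p ∈ testPts R) :
    |det2 (colPt R c) p| ≤ 3 := by
  obtain ⟨⟨h1, h2⟩, h3, h4⟩ := abs_colPt hc
  have h := abs_testPts hp
  calc |det2 (colPt R c) p| ≤ |(colPt R c).1 * p.2| + |(colPt R c).2 * p.1| := abs_sub _ _
    _ ≤ 1 * |p.2| + 1 * |p.1| := by
      rw [abs_mul, abs_mul, abs_of_nonneg h1, abs_of_nonneg h3]; gcongr
    _ ≤ 3 := by linarith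

lemma slabPts_bound {R : ℕ} {τ : (ℝ × ℝ) × ℝ} (hτ : τ ∈ slabPts R) :
    |τ.1.1| ≤ 4 ∧ |τ.1.2| ≤ 4 ∧ -3 ≤ τ.2 ∧ τ.2 ≤ R ^ 2 + 3 := by
  simp only [slabPts, Finset.mem_image, Finset.mem_product, Finset.mem_range] at hτ
  obtain ⟨⟨⟨c, p⟩, i⟩, ⟨⟨hc, hp⟩, hi⟩, rfl⟩ := hτ
  simp only at hc hp hi ⊢
  obtain ⟨⟨h1, h2⟩, h3, h4⟩ := abs_colPt hc
  have h := abs_testPts hp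
  have hd := abs_le.1 (abs_det2_colPt hc hp)
  have hi' : (i : ℝ) ≤ R ^ 2 := by exact_mod_cast (by omega : i ≤ R ^ 2)
  have hi0 : (0 : ℝ) ≤ i := by positivity
  have a1 := abs_nonneg p.1
  have a2 := abs_nonneg p.2
  refine ⟨?_, ?_, by linarith, by linarith⟩
  · refine (abs_sub _ _).trans ?_
    rw [abs_of_nonneg h1]; linarith
  · refine (abs_sub _ _).trans ?_
    rw [abs_of_nonneg h3]; linarith

lemma exists_unitDir_eq {N : ℕ} (hN : 0 < N) (a : ℤ) :
    ∃ b < 2 * N, unitDir N (b : ℕ) = unitDir N a := by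
  have hN' : (N : ℝ) ≠ 0 := by positivity
  have h0 := Int.emod_nonneg a (by omega : (2 * N : ℤ) ≠ 0)
  refine ⟨(a % (2 * N)).toNat, ?_, ?_⟩
  · have := Int.emod_lt_of_pos a (by omega : (0 : ℤ) < 2 * N)
    omega
  · rw [Int.toNat_of_nonneg h0]
    have e : Real.pi * (a : ℝ) / N =
        Real.pi * ((a % (2 * N) : ℤ) : ℝ) / N + ((a / (2 * N) : ℤ) : ℝ) * (2 * Real.pi) := by
      have : (a : ℝ) = ((a % (2 * N) : ℤ) : ℝ) + 2 * N * ((a / (2 * N) : ℤ) : ℝ) := by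
        exact_mod_cast (Int.emod_add_mul_ediv a (2 * N)).symm
      rw [this]
      generalize ((a % (2 * N) : ℤ) : ℝ) = r
      generalize ((a / (2 * N) : ℤ) : ℝ) = q
      field_simp
    rw [unitDir, unitDir, e, Real.cos_add_int_mul_two_pi, Real.sin_add_int_mul_two_pi]

lemma wid_pos {R : ℕ} (hR : 0 < R) : 0 < wid R := by
  have : (0 : ℝ) < R := by exact_mod_cast hR
  rw [wid]; positivity

lemma unitDir_mem_dirs {R : ℕ} (hR : 0 < R) (a : ℤ) : unitDir (R ^ 12) a ∈ dirs R := by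
  obtain ⟨b, hb, hab⟩ := exists_unitDir_eq (N := R ^ 12) (by positivity) a
  rw [← hab]
  exact Finset.mem_union_left _ (Finset.mem_image_of_mem _ (Finset.mem_range.2 hb))

lemma mem_footIdx {R : ℕ} (hR : 0 < R) {τ : (ℝ × ℝ) × ℝ} (hτ : τ ∈ slabPts R) {a : ℤ}
    (ha : wid R ≤ det2 (unitDir (R ^ 12) a) τ.1) :
    ∃ b : ℕ, (τ, b) ∈ footIdx R ∧ unitDir (R ^ 12) b = unitDir (R ^ 12) a := by
  obtain ⟨b, hb, hab⟩ := exists_unitDir_eq (N := R ^ 12) (by positivity) a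
  refine ⟨b, ?_, hab⟩
  rw [footIdx, Finset.mem_filter, Finset.mem_product, Finset.mem_range]
  exact ⟨⟨hτ, hb⟩, by rw [hab]; exact ha⟩

lemma footAt_mem_feet {R : ℕ} (hR : 0 < R) {τ : (ℝ × ℝ) × ℝ} (hτ : τ ∈ slabPts R) {a : ℤ}
    (ha : wid R ≤ det2 (unitDir (R ^ 12) a) τ.1) {j : ℕ} (hj : j ≤ R ^ 2) :
    footAt (unitDir (R ^ 12) a) τ.1 τ.2 j ∈ feet R := by
  obtain ⟨b, hb, hab⟩ := mem_footIdx hR hτ ha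
  rw [← hab]
  exact Finset.mem_image.2 ⟨((τ, b), j), Finset.mem_product.2 ⟨hb, Finset.mem_range.2 (by
    simp only; omega)⟩, rfl⟩

lemma neg_mem_dirs {R : ℕ} (hR : 0 < R) {u : ℝ × ℝ} (hu : u ∈ dirs R) : -u ∈ dirs R := by
  rcases Finset.mem_union.1 hu with h | h
  · obtain ⟨a, -, rfl⟩ := Finset.mem_image.1 h
    have := unitDir_mem_dirs hR ((a : ℤ) + (R ^ 12 : ℕ))
    rwa [unitDir_add_half (by positivity)] at this
  · refine Finset.mem_union_right _ ?_
    rcases Finset.mem_union.1 h with h | h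
    · exact Finset.mem_union_right _ (Finset.mem_image_of_mem _ h)
    · obtain ⟨v, hv, rfl⟩ := Finset.mem_image.1 h
      rw [neg_neg]
      exact Finset.mem_union_left _ hv

lemma slab_le_det2_add_foot {R : ℕ} (hR : 1000 ≤ R) {τ : (ℝ × ℝ) × ℝ} (hτ : τ ∈ slabPts R) {a : ℤ}
    (ha : wid R ≤ det2 (unitDir (R ^ 12) a) τ.1) {j : ℕ} (hj : j ≤ R ^ 2) {m : ℤ}
    (hm : |(m : ℝ)| = 12) :
    1 / ((R : ℝ) ^ 12) ≤
      det2 (unitDir (R ^ 12) (a + m)) (footAt (unitDir (R ^ 12) a) τ.1 τ.2 j) := by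
  have hR' : (1000 : ℝ) ≤ R := by exact_mod_cast hR
  have hR0 : (0 : ℝ) < R := by linarith
  obtain ⟨h1, h2, h3, h4⟩ := slabPts_bound hτ
  have hj' : (j : ℝ) ≤ R ^ 2 := by exact_mod_cast hj
  have hj0 : (0 : ℝ) ≤ j := by positivity
  have h9 : (1000 : ℝ) ^ 4 ≤ R ^ 4 := by gcongr
  have hR2 : (1000 : ℝ) ^ 2 ≤ R ^ 2 := by gcongr
  refine le_trans ?_ (le_det2_add_foot (η := wid R) (B := 2 * R ^ 2) a m (by positivity)
    (wid_pos (by omega)) ha h1 h2 ?_ ?_ ?_)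
  · rw [wid, div_div, div_le_div_iff₀ (by positivity) (by positivity)]
    have : (R : ℝ) ^ 12 = R ^ 3 * (R ^ 4 * (R ^ 4 * R)) := by ring
    rw [this]
    have h8 : (32 : ℝ) ≤ R ^ 4 * (R ^ 4 * R) := by
      calc (32 : ℝ) ≤ 1000 ^ 4 * (1000 ^ 4 * 1000) := by norm_num
        _ ≤ _ := by gcongr
    nlinarith [pow_pos hR0 3]
  · rw [abs_le]; constructor <;> linarith
  · rw [hm, wid]
    push_cast
    have e1 : 2 * (R : ℝ) ^ 2 / (1 / (8 * R ^ 3)) = 16 * R ^ 5 := by field_simp; ring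
    have e2 : (R : ℝ) ^ 12 * (1 / (8 * R ^ 3)) = R ^ 4 * R ^ 5 / 8 := by field_simp
    rw [e1, e2]
    have h5 : (1 : ℝ) ≤ R ^ 5 := one_le_pow₀ (by linarith)
    nlinarith
  · rw [hm]
    push_cast
    calc (12 : ℝ) * 8 ≤ 1000 ^ 12 := by norm_num
      _ ≤ _ := by gcongr

lemma mem_transIdx {R : ℕ} {u₁ u₂ u₃ : ℝ × ℝ} (h₁ : u₁ ∈ dirs R) (h₂ : u₂ ∈ dirs R)
    (h₃ : u₃ ∈ dirs R) (d12 : 1 / (R : ℝ) ^ 12 ≤ det2 u₁ u₂) (d23 : 1 / (R : ℝ) ^ 12 ≤ det2 u₂ u₃)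
    (d13 : 1 / (R : ℝ) ^ 12 ≤ det2 u₁ u₃) {m n : ℕ} (hm : 1 ≤ m) (hn : 1 ≤ n) (hm' : m ≤ R ^ 2)
    (hn' : n ≤ R ^ 2) : ((u₁, u₂, u₃), (m, n)) ∈ transIdx R := by
  simp only [transIdx, Finset.mem_filter, Finset.mem_product, Finset.mem_range]
  exact ⟨⟨⟨h₁, h₂, h₃⟩, by omega, by omega⟩, ⟨d12, d23, d13⟩, hm, hn⟩

/-- Monotonicity along the frames yields the structure needed near the vertical axis. -/
lemma axisMono_of_frames {R : ℕ} (hR : 1000 ≤ R) {G : H → Bool}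
    (hray : ∀ τ ∈ rayFrames R, FrameMono G τ) (htrans : ∀ τ ∈ transFrames R, FrameMono G τ)
    (hfoot : ∀ τ ∈ footFrames R, FrameMono G τ) :
    AxisMono (R ^ 12) (R ^ 2) (wid R) (1 / (R : ℝ) ^ 12) (slabPts R) (dirs R) (params R) G where
  large := by
    calc 30 ≤ 1000 ^ 12 := by norm_num
      _ ≤ R ^ 12 := by gcongr
  one_mem := by simp [params]
  unit_mem a := unitDir_mem_dirs (by omega) a
  neg_mem u hu := neg_mem_dirs (by omega) hu
  foot_mem τ hτ a j hj ha := by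
    have := footAt_mem_feet (by omega) hτ ha hj
    exact Finset.mem_union_right _ (Finset.mem_union_left _ this)
  ray u hu i hi := by
    by_contra hcon
    simp only [RayConst, not_or, not_forall] at hcon
    obtain ⟨⟨t, ht, h1⟩, t', ht', h2⟩ := hcon
    rw [smul_neg, ← neg_smul] at h2
    have hm := hray _ (Finset.mem_image.2 ⟨(i, u, t, t'), by
      simp only [Finset.mem_product, Finset.mem_range]
      exact ⟨by omega, hu, ht, ht'⟩, rfl⟩)
    have := LineMono.ray hm (by
      revert h1 h2
      cases G (lift2 (t • u) i) <;> cases G (lift2 (-t' • u) i) <;> cases G (lift2 0 i) <;> simp)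
    exact h2 this.symm
  transversal u₁ h₁ u₂ h₂ u₃ h₃ i j k hij hjk hk d12 d23 d13 r1 r2 r3 he := by
    have hp : (0 : ℝ) < 1 / (R : ℝ) ^ 12 := by
      have : (0 : ℝ) < R := by exact_mod_cast (by omega : 0 < R)
      positivity
    have hmem := mem_transIdx h₁ h₂ h₃ d12 d23 d13 (m := j - i) (n := k - j) (by omega) (by omega)
      (by omega) (by omega)
    have hm := htrans _ (Finset.mem_image.2 ⟨(i, ((u₁, u₂, u₃), (j - i, k - j))), by
      simp only [Finset.mem_product, Finset.mem_range]
      exact ⟨by omega, hmem⟩, rfl⟩)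
    have q1 := r1 _ (Finset.mem_union_right _ (Finset.mem_union_left _
      (Finset.mem_image_of_mem _ hmem)))
    have q2 := r2 _ (Finset.mem_union_right _ (Finset.mem_union_right _ (Finset.mem_union_left _
      (Finset.mem_image_of_mem _ hmem))))
    have q3 := r3 _ (Finset.mem_union_right _ (Finset.mem_union_right _ (Finset.mem_union_right _
      (Finset.mem_image_of_mem _ hmem))))
    simp only at q1 q2 q3
    have e1 : (i : ℝ) + (j - i : ℕ) = j := by rw [← Nat.cast_add]; congr 1; omega
    have e2 : (i : ℝ) + (j - i : ℕ) + (k - j : ℕ) = k := by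
      rw [← Nat.cast_add, ← Nat.cast_add]; congr 1; omega
    have := LineMono.transversal (hp.trans_le d12) (hp.trans_le d23) (hp.trans_le d13)
      (by exact_mod_cast (by omega : 0 < j - i)) (by exact_mod_cast (by omega : 0 < k - j)) hm
      (by rw [e2, q1, q3, he])
    rwa [e1, q1, q2] at this
  foot_mono τ hτ a l k hl hk hlt htk ha he := by
    obtain ⟨b, hb, hab⟩ := mem_footIdx (by omega) hτ ha
    have hm := hfoot _ (Finset.mem_image.2 ⟨((τ, b), (l, k)), by
      simp only [Finset.mem_filter, Finset.mem_product, Finset.mem_range]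
      exact ⟨⟨hb, by omega, by omega⟩, hlt, htk⟩, rfl⟩)
    simp only [hab] at hm
    exact LineMono.foot ((wid_pos (by omega)).trans_le ha).ne' hm he
  unit_det a b hab hb := by
    refine le_trans ?_ (two_div_le_det2_unitDir hab hb)
    push_cast
    gcongr
    norm_num
  foot_det_left τ hτ a j hj ha :=
    slab_le_det2_add_foot hR hτ ha hj (m := 12) (by norm_num)
  foot_det_right τ hτ a j hj ha := by
    have := slab_le_det2_add_foot hR hτ ha hj (m := -12) (by norm_num)
    rw [show a + ((R ^ 12 : ℕ) : ℤ) - 12 = a + -12 + ((R ^ 12 : ℕ) : ℤ) by ring,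
      unitDir_add_half (by positivity), det2_neg_right]
    refine this.trans_eq ?_
    simp only [det2]
    ring

lemma card_slabPts_le {R : ℕ} (hR : 1000 ≤ R) : (slabPts R).card ≤ R ^ 6 := by
  have h1 : (testPts R).card ≤ 2 * R := by
    refine (Finset.card_union_le _ _).trans ?_
    have := (Finset.card_image_le (s := Finset.range R) (f := colPt R))
    rw [Finset.card_range] at this
    have h4 : ({(3, 0), (-3, 0), (0, 3), (0, -3)} : Finset (ℝ × ℝ)).card ≤ 4 := Finset.card_le_four
    omega
  refine Finset.card_image_le.trans ?_
  rw [Finset.card_product, Finset.card_product, Finset.card_range, Finset.card_range]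
  have h2 : R ^ 2 + 1 ≤ R ^ 3 := by nlinarith [sq_nonneg R]
  calc R * (testPts R).card * (R ^ 2 + 1) ≤ R * (2 * R) * R ^ 3 := by gcongr
    _ = 2 * R ^ 5 := by ring
    _ ≤ R * R ^ 5 := by gcongr; omega
    _ = R ^ 6 := by ring

lemma sq_add_one_le {R : ℕ} (hR : 1000 ≤ R) : R ^ 2 + 1 ≤ R ^ 3 := by nlinarith [sq_nonneg R]

lemma card_footIdx_le {R : ℕ} (hR : 1000 ≤ R) : (footIdx R).card ≤ R ^ 19 := by
  refine (Finset.card_filter_le _ _).trans ?_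
  rw [Finset.card_product, Finset.card_range]
  calc _ ≤ R ^ 6 * (R * R ^ 12) := by
        gcongr
        · exact card_slabPts_le hR
        · omega
    _ = R ^ 19 := by ring

lemma card_dirs_le {R : ℕ} (hR : 1000 ≤ R) : (dirs R).card ≤ R ^ 23 := by
  have h1 : (feet R).card ≤ R ^ 22 := by
    refine Finset.card_image_le.trans ?_
    rw [Finset.card_product, Finset.card_range]
    calc _ ≤ R ^ 19 * R ^ 3 := by gcongr; exacts [card_footIdx_le hR, sq_add_one_le hR]
      _ = R ^ 22 := by ring
  have h2 : ((feet R).image fun v => -v).card ≤ R ^ 22 := Finset.card_image_le.trans h1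
  have h3 : ((Finset.range (2 * R ^ 12)).image fun a : ℕ => unitDir (R ^ 12) a).card ≤
      2 * R ^ 12 := by
    have := Finset.card_image_le (s := Finset.range (2 * R ^ 12))
      (f := fun a : ℕ => unitDir (R ^ 12) a)
    rwa [Finset.card_range] at this
  have h4 := Finset.card_union_le (feet R) ((feet R).image fun v => -v)
  have h5 : 2 * R ^ 12 ≤ 2 * R ^ 22 := by gcongr <;> omega
  calc (dirs R).card ≤ _ := Finset.card_union_le _ _
    _ ≤ 4 * R ^ 22 := by omega
    _ ≤ R * R ^ 22 := by gcongr; omega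
    _ = R ^ 23 := by ring

lemma card_transIdx_le {R : ℕ} (hR : 1000 ≤ R) : (transIdx R).card ≤ R ^ 75 := by
  refine (Finset.card_filter_le _ _).trans ?_
  simp only [Finset.card_product, Finset.card_range]
  have h1 := card_dirs_le hR
  have h2 := sq_add_one_le hR
  calc _ ≤ (R ^ 23 * (R ^ 23 * R ^ 23)) * (R ^ 3 * R ^ 3) := by gcongr
    _ = R ^ 75 := by ring

lemma card_params_le {R : ℕ} (hR : 1000 ≤ R) : (params R).card ≤ R ^ 76 := by
  have h1 := card_transIdx_le hR
  have h0 : 1 ≤ R ^ 75 := Nat.one_le_pow _ _ (by omega)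
  have h2 : ∀ f : ((ℝ × ℝ) × (ℝ × ℝ) × (ℝ × ℝ)) × (ℕ × ℕ) → ℝ,
      ((transIdx R).image f).card ≤ R ^ 75 := fun f => Finset.card_image_le.trans h1
  have h3 : (params R).card ≤ 1 + (R ^ 75 + (R ^ 75 + R ^ 75)) := by
    refine (Finset.card_union_le _ _).trans (add_le_add (Finset.card_singleton _).le ?_)
    refine (Finset.card_union_le _ _).trans (add_le_add (h2 _) ?_)
    exact (Finset.card_union_le _ _).trans (add_le_add (h2 _) (h2 _))
  calc _ ≤ 4 * R ^ 75 := by omega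
    _ ≤ R * R ^ 75 := by gcongr; omega
    _ = R ^ 76 := by ring

lemma card_rayFrames_le {R : ℕ} (hR : 1000 ≤ R) : (rayFrames R).card ≤ R ^ 178 := by
  refine Finset.card_image_le.trans ?_
  simp only [Finset.card_product, Finset.card_range]
  have h1 := card_dirs_le hR
  have h2 := sq_add_one_le hR
  have h3 := card_params_le hR
  calc _ ≤ R ^ 3 * (R ^ 23 * (R ^ 76 * R ^ 76)) := by gcongr
    _ = R ^ 178 := by ring

lemma card_transFrames_le {R : ℕ} (hR : 1000 ≤ R) : (transFrames R).card ≤ R ^ 178 := by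
  refine Finset.card_image_le.trans ?_
  simp only [Finset.card_product, Finset.card_range]
  have h2 := sq_add_one_le hR
  have h3 := card_transIdx_le hR
  calc _ ≤ R ^ 3 * R ^ 75 := by gcongr
    _ = R ^ 78 := by ring
    _ ≤ R ^ 178 := by gcongr <;> omega

lemma card_footFrames_le {R : ℕ} (hR : 1000 ≤ R) : (footFrames R).card ≤ R ^ 178 := by
  refine Finset.card_image_le.trans ((Finset.card_filter_le _ _).trans ?_)
  simp only [Finset.card_product, Finset.card_range]
  have h2 := sq_add_one_le hR
  have h3 := card_footIdx_le hR
  calc _ ≤ R ^ 19 * (R ^ 3 * R ^ 3) := by gcongr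
    _ = R ^ 25 := by ring
    _ ≤ R ^ 178 := by gcongr <;> omega

/-- Frames have nonnegative lengths and bounded extent. -/
structure Frame.Bounded (L : ℝ) (τ : Frame) : Prop where
  nonneg_left : 0 ≤ τ.2.2.1
  nonneg_right : 0 ≤ τ.2.2.2
  extent : (|τ.2.1.1| + |τ.2.1.2|) * (τ.2.2.1 + τ.2.2.2) ≤ L

lemma abs_unitDir (N : ℕ) (a : ℤ) : |(unitDir N a).1| ≤ 1 ∧ |(unitDir N a).2| ≤ 1 :=
  ⟨Real.abs_cos_le_one _, Real.abs_sin_le_one _⟩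

lemma abs_dirs {R : ℕ} (hR : 1000 ≤ R) {u : ℝ × ℝ} (hu : u ∈ dirs R) :
    |u.1| ≤ (R : ℝ) ^ 6 ∧ |u.2| ≤ (R : ℝ) ^ 6 := by
  have hR' : (1000 : ℝ) ≤ R := by exact_mod_cast hR
  have hR0 : (0 : ℝ) < R := by linarith
  have key : ∀ v ∈ feet R, |v.1| ≤ (R : ℝ) ^ 6 ∧ |v.2| ≤ (R : ℝ) ^ 6 := by
    intro v hv
    simp only [feet, footIdx, Finset.mem_image, Finset.mem_product, Finset.mem_filter,
      Finset.mem_range] at hv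
    obtain ⟨⟨⟨τ, b⟩, j⟩, ⟨⟨⟨hτ, -⟩, hd⟩, hj⟩, rfl⟩ := hv
    simp only at hτ hd hj ⊢
    obtain ⟨h1, h2, h3, h4⟩ := slabPts_bound hτ
    have hj' : (j : ℝ) ≤ R ^ 2 := by exact_mod_cast (by omega : j ≤ R ^ 2)
    have hj0 : (0 : ℝ) ≤ j := by positivity
    have hR2 : (1000 : ℝ) ^ 2 ≤ R ^ 2 := by gcongr
    have hs : |(τ.2 - j) / det2 (unitDir (R ^ 12) b) τ.1| ≤ 16 * (R : ℝ) ^ 5 := by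
      rw [abs_div, abs_of_pos ((wid_pos (by omega)).trans_le hd)]
      have : 16 * (R : ℝ) ^ 5 = 2 * R ^ 2 / wid R := by rw [wid]; field_simp; ring
      rw [this]
      refine div_le_div₀ (by positivity) ?_ (wid_pos (by omega)) hd
      rw [abs_le]; constructor <;> linarith
    have hb := abs_unitDir (R ^ 12) b
    have fin : 4 + 16 * (R : ℝ) ^ 5 * 1 ≤ R ^ 6 := by
      have h5 : (1 : ℝ) ≤ R ^ 5 := one_le_pow₀ (by linarith)
      nlinarith
    constructor
    · refine le_trans ((abs_add_le _ _).trans (add_le_add h1 ?_)) fin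
      simp only [Prod.smul_fst, smul_eq_mul, abs_mul]
      gcongr
      exact hb.1
    · refine le_trans ((abs_add_le _ _).trans (add_le_add h2 ?_)) fin
      simp only [Prod.smul_snd, smul_eq_mul, abs_mul]
      gcongr
      exact hb.2
  rcases Finset.mem_union.1 hu with h | h
  · obtain ⟨a, -, rfl⟩ := Finset.mem_image.1 h
    have h1 : (1 : ℝ) ≤ R ^ 6 := one_le_pow₀ (by linarith)
    exact ⟨(abs_unitDir _ _).1.trans h1, (abs_unitDir _ _).2.trans h1⟩
  · rcases Finset.mem_union.1 h with h | h
    · exact key u h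
    · obtain ⟨v, hv, rfl⟩ := Finset.mem_image.1 h
      simpa using key v hv

lemma det2_dirs_le {R : ℕ} (hR : 1000 ≤ R) {u v : ℝ × ℝ} (hu : u ∈ dirs R) (hv : v ∈ dirs R) :
    det2 u v ≤ (R : ℝ) ^ 13 := by
  have hR' : (1000 : ℝ) ≤ R := by exact_mod_cast hR
  have h1 := abs_dirs hR hu
  have h2 := abs_dirs hR hv
  have e1 : |u.1 * v.2| ≤ (R : ℝ) ^ 6 * R ^ 6 := by rw [abs_mul]; gcongr; exacts [h1.1, h2.2]
  have e2 : |u.2 * v.1| ≤ (R : ℝ) ^ 6 * R ^ 6 := by rw [abs_mul]; gcongr; exacts [h1.2, h2.1]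
  have := (abs_sub (u.1 * v.2) (u.2 * v.1))
  have := le_abs_self (u.1 * v.2 - u.2 * v.1)
  have h0 : (0 : ℝ) ≤ R ^ 12 := by positivity
  rw [det2]
  nlinarith

lemma transIdx_bounds {R : ℕ} (hR : 1000 ≤ R) {x : ((ℝ × ℝ) × (ℝ × ℝ) × (ℝ × ℝ)) × (ℕ × ℕ)}
    (hx : x ∈ transIdx R) :
    (0 ≤ lowParam x.1.1 x.1.2.1 x.1.2.2 x.2.1 x.2.2 ∧
      lowParam x.1.1 x.1.2.1 x.1.2.2 x.2.1 x.2.2 ≤ (R : ℝ) ^ 48) ∧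
    (0 ≤ midParam x.1.1 x.1.2.1 x.1.2.2 x.2.1 x.2.2 ∧
      midParam x.1.1 x.1.2.1 x.1.2.2 x.2.1 x.2.2 ≤ (R : ℝ) ^ 20) ∧
    (0 ≤ highParam x.1.1 x.1.2.1 x.1.2.2 x.2.1 x.2.2 ∧
      highParam x.1.1 x.1.2.1 x.1.2.2 x.2.1 x.2.2 ≤ (R : ℝ) ^ 48) := by
  have hR' : (1000 : ℝ) ≤ R := by exact_mod_cast hR
  have hR0 : (0 : ℝ) < R := by linarith
  obtain ⟨⟨u₁, u₂, u₃⟩, ⟨m, n⟩⟩ := x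
  simp only [transIdx, Finset.mem_filter, Finset.mem_product, Finset.mem_range] at hx
  obtain ⟨⟨⟨h₁, h₂, h₃⟩, hm', hn'⟩, ⟨d12, d23, d13⟩, hm, hn⟩ := hx
  simp only
  have b12 := det2_dirs_le hR h₁ h₂
  have b23 := det2_dirs_le hR h₂ h₃
  have b13 := det2_dirs_le hR h₁ h₃
  have hp : (0 : ℝ) < 1 / (R : ℝ) ^ 12 := by positivity
  have mR : (m : ℝ) ≤ R ^ 2 := by exact_mod_cast (by omega : m ≤ R ^ 2)
  have nR : (n : ℝ) ≤ R ^ 2 := by exact_mod_cast (by omega : n ≤ R ^ 2)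
  have m1 : (1 : ℝ) ≤ m := by exact_mod_cast hm
  have n1 : (1 : ℝ) ≤ n := by exact_mod_cast hn
  generalize (m : ℝ) = Δ₁ at *
  generalize (n : ℝ) = Δ₂ at *
  have p12 := hp.trans_le d12
  have p23 := hp.trans_le d23
  have p13 := hp.trans_le d13
  have hmid0 : 0 ≤ midParam u₁ u₂ u₃ Δ₁ Δ₂ := Real.sqrt_nonneg _
  have hmid : midParam u₁ u₂ u₃ Δ₁ Δ₂ ≤ (R : ℝ) ^ 20 := by
    refine Real.sqrt_le_iff.2 ⟨by positivity, ?_⟩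
    have e : Δ₁ * Δ₂ * det2 u₁ u₃ / ((Δ₁ + Δ₂) * (det2 u₁ u₂ * det2 u₂ u₃)) =
        (Δ₁ * Δ₂ / (Δ₁ + Δ₂)) * (det2 u₁ u₃ / (det2 u₁ u₂ * det2 u₂ u₃)) := by
      field_simp
    have q1 : Δ₁ * Δ₂ / (Δ₁ + Δ₂) ≤ (R : ℝ) ^ 2 := by
      rw [div_le_iff₀ (by positivity)]
      nlinarith
    have q2 : det2 u₁ u₃ / (det2 u₁ u₂ * det2 u₂ u₃) ≤
        (R : ℝ) ^ 13 / (1 / (R : ℝ) ^ 12 * (1 / (R : ℝ) ^ 12)) := by gcongr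
    have q3 : (R : ℝ) ^ 13 / (1 / (R : ℝ) ^ 12 * (1 / (R : ℝ) ^ 12)) = R ^ 37 := by
      field_simp
    rw [e]
    calc _ ≤ (R : ℝ) ^ 2 * R ^ 37 := by rw [q3] at q2; gcongr
      _ = R ^ 39 := by ring
      _ ≤ R ^ 40 := by gcongr; linarith; norm_num
      _ = (R ^ 20) ^ 2 := by ring
  have q : ∀ Δ Δ' d : ℝ, 0 ≤ d → d ≤ R ^ 13 → 1 ≤ Δ → Δ ≤ R ^ 2 → 1 ≤ Δ' → Δ' ≤ R ^ 2 →
      0 ≤ (Δ + Δ') / Δ' * (midParam u₁ u₂ u₃ Δ₁ Δ₂ * d / det2 u₁ u₃) ∧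
      (Δ + Δ') / Δ' * (midParam u₁ u₂ u₃ Δ₁ Δ₂ * d / det2 u₁ u₃) ≤ (R : ℝ) ^ 48 := by
    intro Δ Δ' d hd hd' hΔ hΔR hΔ' hΔR'
    have r1 : (Δ + Δ') / Δ' ≤ (R : ℝ) ^ 3 := by
      rw [div_le_iff₀ (by positivity)]
      have : (R : ℝ) ^ 2 ≤ R ^ 3 / 1000 := by
        rw [le_div_iff₀ (by norm_num)]; nlinarith [pow_pos hR0 2]
      have : (1 : ℝ) ≤ R ^ 2 := one_le_pow₀ (by linarith)
      nlinarith [pow_pos hR0 3]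
    refine ⟨by positivity, ?_⟩
    calc _ ≤ (R : ℝ) ^ 3 * (R ^ 20 * R ^ 13 / (1 / (R : ℝ) ^ 12)) := by gcongr
      _ = (R : ℝ) ^ 48 := by field_simp
  refine ⟨?_, ⟨hmid0, hmid⟩, ?_⟩
  · exact q _ _ _ p23.le b23 m1 mR n1 nR
  · rw [highParam, add_comm Δ₁]
    exact q _ _ _ p12.le b12 n1 nR m1 mR

lemma params_bound {R : ℕ} (hR : 1000 ≤ R) {t : ℝ} (ht : t ∈ params R) :
    0 ≤ t ∧ t ≤ (R : ℝ) ^ 48 := by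
  have hR' : (1000 : ℝ) ≤ R := by exact_mod_cast hR
  simp only [params, Finset.mem_union, Finset.mem_singleton, Finset.mem_image] at ht
  rcases ht with rfl | ⟨x, hx, rfl⟩ | ⟨x, hx, rfl⟩ | ⟨x, hx, rfl⟩
  · exact ⟨by norm_num, one_le_pow₀ (by linarith)⟩
  · exact (transIdx_bounds hR hx).1
  · obtain ⟨h0, h1⟩ := (transIdx_bounds hR hx).2.1
    exact ⟨h0, h1.trans (by gcongr; linarith; norm_num)⟩
  · exact (transIdx_bounds hR hx).2.2

lemma rayFrames_bounded {R : ℕ} (hR : 1000 ≤ R) {τ : Frame} (hτ : τ ∈ rayFrames R) :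
    τ.Bounded ((R : ℝ) ^ 58) := by
  have hR' : (1000 : ℝ) ≤ R := by exact_mod_cast hR
  simp only [rayFrames, Finset.mem_image, Finset.mem_product] at hτ
  obtain ⟨⟨i, u, t, t'⟩, ⟨-, hu, ht, ht'⟩, rfl⟩ := hτ
  obtain ⟨t0, t1⟩ := params_bound hR ht
  obtain ⟨t0', t1'⟩ := params_bound hR ht'
  obtain ⟨u1, u2⟩ := abs_dirs hR hu
  refine ⟨t0', t0, ?_⟩
  simp only at *
  calc _ ≤ ((R : ℝ) ^ 6 + R ^ 6) * (R ^ 48 + R ^ 48) := by gcongr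
    _ = 4 * R ^ 54 := by ring
    _ ≤ R * R ^ 54 := by gcongr; linarith
    _ = (R : ℝ) ^ 55 := by ring
    _ ≤ R ^ 58 := by gcongr; linarith; norm_num

lemma transFrames_bounded {R : ℕ} (hR : 1000 ≤ R) {τ : Frame} (hτ : τ ∈ transFrames R) :
    τ.Bounded ((R : ℝ) ^ 58) := by
  have hR' : (1000 : ℝ) ≤ R := by exact_mod_cast hR
  have hR0 : (0 : ℝ) < R := by linarith
  simp only [transFrames, Finset.mem_image, Finset.mem_product] at hτ
  obtain ⟨⟨i, x⟩, ⟨-, hx⟩, rfl⟩ := hτ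
  simp only at hx
  obtain ⟨⟨l0, l1⟩, ⟨m0, m1⟩, -⟩ := transIdx_bounds hR hx
  obtain ⟨⟨u₁, u₂, u₃⟩, ⟨m, n⟩⟩ := x
  simp only [transIdx, Finset.mem_filter, Finset.mem_product, Finset.mem_range] at hx
  obtain ⟨⟨⟨h₁, h₂, h₃⟩, hm', hn'⟩, -, hm, hn⟩ := hx
  simp only at l0 l1 m0 m1
  have c1 := abs_dirs hR h₁
  have c2 := abs_dirs hR h₂
  refine ⟨zero_le_one, by positivity, ?_⟩
  simp only [Prod.fst_sub, Prod.snd_sub, Prod.smul_fst, Prod.smul_snd, smul_eq_mul]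
  generalize lowParam u₁ u₂ u₃ m n = p at *
  generalize midParam u₁ u₂ u₃ m n = q at *
  have key : ∀ a b : ℝ, |a| ≤ R ^ 6 → |b| ≤ R ^ 6 → |q * a - p * b| ≤ 2 * (R : ℝ) ^ 54 := by
    intro a b ha hb
    refine (abs_sub _ _).trans ?_
    rw [abs_mul, abs_mul, abs_of_nonneg l0, abs_of_nonneg m0]
    calc _ ≤ (R : ℝ) ^ 20 * R ^ 6 + R ^ 48 * R ^ 6 := by gcongr
      _ = R ^ 26 + R ^ 54 := by ring
      _ ≤ R ^ 54 + R ^ 54 := by gcongr; linarith; norm_num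
      _ = _ := by ring
  have m1 : (1 : ℝ) ≤ m := by exact_mod_cast hm
  have nR : (n : ℝ) ≤ R ^ 2 := by exact_mod_cast (by omega : n ≤ R ^ 2)
  have hn0 : (0 : ℝ) ≤ n := by positivity
  have hf : 1 + (n : ℝ) / m ≤ R ^ 3 := by
    have : (n : ℝ) / m ≤ n := div_le_self hn0 m1
    nlinarith
  calc _ ≤ (2 * (R : ℝ) ^ 54 + 2 * R ^ 54) * R ^ 3 := by
        gcongr
        exacts [key _ _ c2.1 c1.1, key _ _ c2.2 c1.2]
    _ = 4 * R ^ 57 := by ring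
    _ ≤ R * R ^ 57 := by gcongr; linarith
    _ = R ^ 58 := by ring

lemma footFrames_bounded {R : ℕ} (hR : 1000 ≤ R) {τ : Frame} (hτ : τ ∈ footFrames R) :
    τ.Bounded ((R : ℝ) ^ 58) := by
  have hR' : (1000 : ℝ) ≤ R := by exact_mod_cast hR
  have hR0 : (0 : ℝ) < R := by linarith
  simp only [footFrames, footIdx, Finset.mem_image, Finset.mem_filter, Finset.mem_product,
    Finset.mem_range] at hτ
  obtain ⟨⟨⟨τ, b⟩, l, k⟩, ⟨⟨⟨-, hd⟩, hl, hk⟩, hlt, htk⟩, rfl⟩ := hτ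
  simp only at hd hl hk hlt htk
  have hd0 := (wid_pos (R := R) (by omega)).trans_le hd
  have hb := abs_unitDir (R ^ 12) b
  refine ⟨div_nonneg (by simp only; linarith) hd0.le,
    div_nonneg (by simp only; linarith) hd0.le, ?_⟩
  simp only [Prod.fst_neg, Prod.snd_neg, abs_neg]
  have hk' : (k : ℝ) ≤ R ^ 2 := by exact_mod_cast (by omega : k ≤ R ^ 2)
  have hl0 : (0 : ℝ) ≤ l := by positivity
  have e : (τ.2 - l) / det2 (unitDir (R ^ 12) b) τ.1 + (k - τ.2) / det2 (unitDir (R ^ 12) b) τ.1 =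
      (k - l) / det2 (unitDir (R ^ 12) b) τ.1 := by rw [← add_div]; congr 1; ring
  rw [e]
  have h1 : ((k : ℝ) - l) / det2 (unitDir (R ^ 12) b) τ.1 ≤ R ^ 2 / wid R :=
    div_le_div₀ (by positivity) (by linarith) (wid_pos (by omega)) hd
  have h2 : (R : ℝ) ^ 2 / wid R = 8 * R ^ 5 := by rw [wid]; field_simp
  rw [h2] at h1
  have h3 : 0 ≤ ((k : ℝ) - l) / det2 (unitDir (R ^ 12) b) τ.1 :=
    div_nonneg (by linarith) hd0.le
  calc _ ≤ (1 + 1) * (8 * (R : ℝ) ^ 5) := by gcongr; exacts [hb.1, hb.2]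
    _ = 16 * R ^ 5 := by ring
    _ ≤ R * R ^ 5 := by gcongr; linarith
    _ = R ^ 6 := by ring
    _ ≤ R ^ 58 := by gcongr; linarith; norm_num

/-- Three equally spaced points on a horizontal line. -/
def walkFrame (v : ℝ × ℝ) (z : ℝ) (w : ℝ × ℝ) : Frame := (hmul (lift2 v z) (lift2 (-w) 0), w, 1, 1)

lemma FrameMono.walk {G : H → Bool} {v w : ℝ × ℝ} {z : ℝ} (h : FrameMono G (walkFrame v z w)) :
    G (lift2 (v + w) (z + det2 v w)) = G (lift2 v z) ∨
      G (lift2 (v - w) (z - det2 v w)) = G (lift2 v z) := by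
  have e1 : hmul (hmul (lift2 v z) (lift2 (-w) 0)) (lift2 ((1 : ℝ) • w) 0) = lift2 v z := by
    simp only [hmul_lift2, one_smul, neg_add_cancel_right]
    congr 1
    simp only [det2, Prod.fst_add, Prod.snd_add, Prod.fst_neg, Prod.snd_neg]; ring
  have e2 : hmul (hmul (lift2 v z) (lift2 (-w) 0)) (lift2 (((1 : ℝ) + 1) • w) 0) =
      lift2 (v + w) (z + det2 v w) := by
    simp only [hmul_lift2, add_smul, one_smul]
    congr 1
    · abel
    · simp only [det2, Prod.fst_add, Prod.snd_add, Prod.fst_neg, Prod.snd_neg]; ring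
  have e3 : hmul (lift2 v z) (lift2 (-w) 0) = lift2 (v - w) (z - det2 v w) := by
    rw [hmul_lift2, det2_neg_right, ← sub_eq_add_neg, add_zero, ← sub_eq_add_neg]
  simp only [FrameMono, walkFrame, LineMono] at h
  rw [e1, e2, e3] at h
  revert h
  cases G (lift2 (v + w) (z + det2 v w)) <;> cases G (lift2 (v - w) (z - det2 v w)) <;>
    cases G (lift2 v z) <;> simp

/-- The corners of the zigzag walks starting on the vertical axis. -/
def cornerPt (R : ℕ) (x : ℤ × ℤ × ℤ) : H :=
  lift2 (x.2.1 / (2 * R), x.1 * R) (x.2.2 / 2)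

/-- Index set for the corners. -/
def cornerIdx (R : ℕ) : Finset (ℤ × ℤ × ℤ) :=
  {1, -1} ×ˢ Finset.Icc (-2 * (R : ℤ) ^ 2) (2 * (R : ℤ) ^ 2) ×ˢ
    Finset.Icc (-2 * (R : ℤ) ^ 2) (4 * (R : ℤ) ^ 2)

/-- First steps of zigzag walks. -/
def walkFrames₁ (R : ℕ) : Finset Frame :=
  (Finset.range (R ^ 2 + 1) ×ˢ Finset.range (R ^ 2 + 1)).image fun x =>
    walkFrame 0 x.1 ((x.2 : ℝ) / (2 * R), 0)

/-- Second steps of zigzag walks. -/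
def walkFrames₂ (R : ℕ) : Finset Frame :=
  (Finset.range (R ^ 2 + 1) ×ˢ Finset.Icc (-(R : ℤ) ^ 2) (R ^ 2)).image fun x =>
    walkFrame ((x.2 : ℝ) / (2 * R), 0) x.1 (0, (R : ℝ))

/-- Third steps of zigzag walks. -/
def walkFrames₃ (R : ℕ) : Finset Frame :=
  ((Finset.range (R ^ 2 + 1) ×ˢ Finset.Icc (-(R : ℤ) ^ 2) (R ^ 2)) ×ˢ
    (Finset.range (R ^ 2 + 1) ×ˢ ({1, -1} : Finset ℤ))).image fun x =>
      walkFrame ((x.1.2 : ℝ) / (2 * R), x.2.2 * R) (x.1.1 + x.2.2 * x.1.2 / 2)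
        ((x.2.1 : ℝ) / (2 * R), 0)

lemma walkFrame_bounded {R : ℕ} (hR : 1000 ≤ R) {v w : ℝ × ℝ} {z : ℝ} (h1 : |w.1| ≤ R)
    (h2 : |w.2| ≤ R) : (walkFrame v z w).Bounded ((R : ℝ) ^ 58) := by
  have hR' : (1000 : ℝ) ≤ R := by exact_mod_cast hR
  refine ⟨zero_le_one, zero_le_one, ?_⟩
  simp only [walkFrame]
  calc _ ≤ ((R : ℝ) + R) * (1 + 1) := by gcongr
    _ = 4 * R := by ring
    _ ≤ R * R := by gcongr; linarith
    _ = R ^ 2 := by ring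
    _ ≤ R ^ 58 := by gcongr; linarith; norm_num

lemma abs_step_le {R n : ℕ} (hR : 1000 ≤ R) (hn : n < R ^ 2 + 1) :
    |(n : ℝ) / (2 * R)| ≤ R := by
  have hR' : (1000 : ℝ) ≤ R := by exact_mod_cast hR
  have hn' : (n : ℝ) ≤ R ^ 2 := by exact_mod_cast (by omega : n ≤ R ^ 2)
  rw [abs_of_nonneg (by positivity), div_le_iff₀ (by positivity)]
  nlinarith

lemma walkFrames_bounded {R : ℕ} (hR : 1000 ≤ R) {τ : Frame}
    (hτ : τ ∈ walkFrames₁ R ∪ (walkFrames₂ R ∪ walkFrames₃ R)) : τ.Bounded ((R : ℝ) ^ 58) := by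
  simp only [walkFrames₁, walkFrames₂, walkFrames₃, Finset.mem_union, Finset.mem_image,
    Finset.mem_product, Finset.mem_range] at hτ
  rcases hτ with ⟨x, hx, rfl⟩ | ⟨x, hx, rfl⟩ | ⟨x, hx, rfl⟩
  · exact walkFrame_bounded hR (abs_step_le hR hx.2) (by simp)
  · exact walkFrame_bounded hR (by simp) (by simp)
  · exact walkFrame_bounded hR (abs_step_le hR hx.2.1) (by simp)

lemma card_walkFrames_le {R : ℕ} (hR : 1000 ≤ R) :
    (walkFrames₁ R ∪ (walkFrames₂ R ∪ walkFrames₃ R)).card ≤ R ^ 178 := by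
  have hs := sq_add_one_le hR
  have h0 : 1 ≤ R ^ 2 := Nat.one_le_pow _ _ (by omega)
  have hI : (Finset.Icc (-(R : ℤ) ^ 2) (R ^ 2)).card ≤ 2 * R ^ 3 := by
    rw [Int.card_Icc]
    zify at hs h0 ⊢
    rw [Int.toNat_of_nonneg (by nlinarith)]
    linarith
  have h2 : ({1, -1} : Finset ℤ).card ≤ 2 := Finset.card_le_two
  have c1 : (walkFrames₁ R).card ≤ R ^ 3 * R ^ 3 := by
    refine Finset.card_image_le.trans ?_
    rw [Finset.card_product, Finset.card_range]
    gcongr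
  have c2 : (walkFrames₂ R).card ≤ R ^ 3 * (2 * R ^ 3) := by
    refine Finset.card_image_le.trans ?_
    rw [Finset.card_product, Finset.card_range]
    gcongr
  have c3 : (walkFrames₃ R).card ≤ (R ^ 3 * (2 * R ^ 3)) * (R ^ 3 * 2) := by
    refine Finset.card_image_le.trans ?_
    simp only [Finset.card_product, Finset.card_range]
    gcongr
  have e1 : R ^ 3 * R ^ 3 ≤ R ^ 9 := by
    rw [← pow_add]; exact Nat.pow_le_pow_right (by omega) (by norm_num)
  have e2 : R ^ 3 * (2 * R ^ 3) ≤ 2 * R ^ 9 := by nlinarith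
  have e3 : (R ^ 3 * (2 * R ^ 3)) * (R ^ 3 * 2) = 4 * R ^ 9 := by ring
  have u1 := Finset.card_union_le (walkFrames₁ R) (walkFrames₂ R ∪ walkFrames₃ R)
  have u2 := Finset.card_union_le (walkFrames₂ R) (walkFrames₃ R)
  calc _ ≤ 7 * R ^ 9 := by omega
    _ ≤ R * R ^ 9 := by gcongr; omega
    _ = R ^ 10 := by ring
    _ ≤ R ^ 178 := Nat.pow_le_pow_right (by omega) (by norm_num)

/-- If the vertical axis is not monochromatic, then many corners differ in color from the origin. -/
lemma card_corner {R : ℕ} (hR : 1000 ≤ R) {G : H → Bool}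
    (hG : ∀ τ ∈ walkFrames₁ R ∪ (walkFrames₂ R ∪ walkFrames₃ R), FrameMono G τ) {i : ℕ}
    (hi : i ≤ R ^ 2) (hne : G (lift2 0 i) ≠ G 0) :
    (R ^ 2 + 1) ^ 2 ≤ ((cornerIdx R).filter fun x => G 0 ≠ G (cornerPt R x)).card := by
  have hR0 : (R : ℝ) ≠ 0 := by
    have : 0 < R := by omega
    positivity
  have f1 : ∀ l : ℕ, ∃ φ : ℤ, l ≤ R ^ 2 → φ.natAbs = l ∧
      G (lift2 ((φ : ℝ) / (2 * R), 0) i) = G (lift2 0 i) := by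
    intro l
    by_cases hl : l ≤ R ^ 2
    · have h1 := FrameMono.walk (hG _ (Finset.mem_union_left _ (Finset.mem_image.2 ⟨(i, l), by
        simp only [Finset.mem_product, Finset.mem_range]; omega, rfl⟩)))
      rcases h1 with h1 | h1
      · refine ⟨l, fun _ => ⟨by simp, ?_⟩⟩
        rw [← h1]; congr 1; simp [det2]
      · refine ⟨-l, fun _ => ⟨by simp, ?_⟩⟩
        rw [← h1]; congr 1; simp [det2, neg_div]
    · exact ⟨0, fun h => absurd h hl⟩
  choose φ hφ using f1
  have mφ : ∀ l ≤ R ^ 2, φ l ∈ Finset.Icc (-(R : ℤ) ^ 2) (R ^ 2) := by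
    intro l hl
    have := (hφ l hl).1
    have h2 : (l : ℤ) ≤ R ^ 2 := by exact_mod_cast hl
    rw [Finset.mem_Icc]
    constructor <;> omega
  have f2 : ∀ l : ℕ, ∃ σ ∈ ({1, -1} : Finset ℤ), l ≤ R ^ 2 →
      G (lift2 ((φ l : ℝ) / (2 * R), σ * R) (i + σ * φ l / 2)) = G (lift2 0 i) := by
    intro l
    by_cases hl : l ≤ R ^ 2
    · have h1 := FrameMono.walk (hG _ (Finset.mem_union_right _ (Finset.mem_union_left _
        (Finset.mem_image.2 ⟨(i, φ l), by
          simp only [Finset.mem_product, Finset.mem_range]; exact ⟨by omega, mφ l hl⟩, rfl⟩))))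
      have e : (φ l : ℝ) / (2 * R) * R = φ l / 2 := by field_simp
      rcases h1 with h1 | h1
      · refine ⟨1, by simp, fun _ => ?_⟩
        rw [← (hφ l hl).2, ← h1]; congr 1; simp [det2, e]
      · refine ⟨-1, by simp, fun _ => ?_⟩
        rw [← (hφ l hl).2, ← h1]; congr 1; simp [det2, e, neg_div, sub_eq_add_neg]
    · exact ⟨1, by simp, fun h => absurd h hl⟩
  choose σ hσ hσ' using f2
  have f3 : ∀ l n : ℕ, ∃ ν : ℤ, l ≤ R ^ 2 → n ≤ R ^ 2 → ν.natAbs = n ∧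
      G (cornerPt R (σ l, φ l + ν, 2 * i + σ l * (φ l - ν))) = G (lift2 0 i) := by
    intro l n
    by_cases hl : l ≤ R ^ 2
    · by_cases hn : n ≤ R ^ 2
      · have h1 := FrameMono.walk (hG _ (Finset.mem_union_right _ (Finset.mem_union_right _
          (Finset.mem_image.2 ⟨((i, φ l), (n, σ l)), by
            simp only [Finset.mem_product, Finset.mem_range]
            exact ⟨⟨by omega, mφ l hl⟩, by omega, hσ l⟩, rfl⟩))))
        rcases h1 with h1 | h1
        · refine ⟨n, fun _ _ => ⟨by simp, ?_⟩⟩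
          rw [← hσ' l hl, ← h1, cornerPt]
          congr 1
          simp only [lift2, det2, Prod.mk_add_mk]
          push_cast
          refine Prod.ext ?_ (Prod.ext ?_ ?_) <;> simp only <;> field_simp <;> ring
        · refine ⟨-n, fun _ _ => ⟨by simp, ?_⟩⟩
          rw [← hσ' l hl, ← h1, cornerPt]
          congr 1
          simp only [lift2, det2, Prod.mk_sub_mk]
          push_cast
          refine Prod.ext ?_ (Prod.ext ?_ ?_) <;> simp only <;> field_simp <;> ring
      · exact ⟨0, fun _ h => absurd h hn⟩
    · exact ⟨0, fun h => absurd h hl⟩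
  choose ν hν using f3
  have hcard : (Finset.range (R ^ 2 + 1) ×ˢ Finset.range (R ^ 2 + 1)).card = (R ^ 2 + 1) ^ 2 := by
    rw [Finset.card_product, Finset.card_range]; ring
  rw [← hcard]
  refine Finset.card_le_card_of_injOn
    (fun x => (σ x.1, φ x.1 + ν x.1 x.2, 2 * (i : ℤ) + σ x.1 * (φ x.1 - ν x.1 x.2))) ?_ ?_
  · rintro ⟨l, n⟩ hx
    simp only [Finset.coe_product, Finset.coe_range, Set.mem_prod, Set.mem_Iio] at hx
    have hl : l ≤ R ^ 2 := by omega
    have hn : n ≤ R ^ 2 := by omega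
    have hl' : (l : ℤ) ≤ R ^ 2 := by exact_mod_cast hl
    have hn' : (n : ℤ) ≤ R ^ 2 := by exact_mod_cast hn
    have hi' : (i : ℤ) ≤ R ^ 2 := by exact_mod_cast hi
    obtain ⟨h1, h2⟩ := hν l n hl hn
    have h3 := (hφ l hl).1
    simp only [Finset.coe_filter, Set.mem_ofPred_eq, cornerIdx, Finset.mem_product,
      Finset.mem_Icc]
    have h4 := hσ l
    refine ⟨⟨h4, ⟨by omega, by omega⟩, ?_⟩, ?_⟩
    · simp only [Finset.mem_insert, Finset.mem_singleton] at h4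
      rcases h4 with h4 | h4 <;> rw [h4] <;> constructor <;> omega
    · rw [h2]; exact hne.symm
  · rintro ⟨l, n⟩ hx ⟨l', n'⟩ hx' he
    simp only [Finset.coe_product, Finset.coe_range, Set.mem_prod, Set.mem_Iio] at hx hx'
    simp only [Prod.mk.injEq] at he
    obtain ⟨e1, e2, e3⟩ := he
    have a1 := (hφ l (by omega)).1
    have a2 := (hφ l' (by omega)).1
    have a3 := (hν l n (by omega) (by omega)).1
    have a4 := (hν l' n' (by omega) (by omega)).1
    have h4 := hσ l
    simp only [Finset.mem_insert, Finset.mem_singleton] at h4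
    rw [← e1] at e3
    rw [Prod.mk.injEq]
    rcases h4 with h4 | h4 <;> rw [h4] at e3 <;> constructor <;> omega

/-- The positions below `h` at which a Boolean sequence changes. -/
def wiggles (b : ℕ → Bool) (h : ℕ) : Finset ℕ := (Finset.range h).filter fun i => b i ≠ b (i + 1)

/-- The changes which are preceded and followed by many others. -/
def innerWiggles (b : ℕ → Bool) (h : ℕ) : Finset ℕ :=
  (wiggles b h).filter fun i => 12 ≤ Nat.count (· ∈ wiggles b h) i ∧
    Nat.count (· ∈ wiggles b h) i + 8 < (wiggles b h).card

section Wiggles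

variable {b : ℕ → Bool} {h : ℕ}

lemma mem_wiggles {i : ℕ} : i ∈ wiggles b h ↔ i < h ∧ b i ≠ b (i + 1) := by simp [wiggles]

lemma count_wiggles_lt {i : ℕ} (hi : i ∈ wiggles b h) :
    Nat.count (· ∈ wiggles b h) i < (wiggles b h).card := by
  have := Nat.count_lt_card (p := (· ∈ wiggles b h)) (wiggles b h).finite_toSet hi
  simpa using this

lemma card_wiggles_le : (wiggles b h).card ≤ 20 + (innerWiggles b h).card := by
  rw [← Finset.card_filter_add_card_filter_not (s := wiggles b h)
    (fun i => 12 ≤ Nat.count (· ∈ wiggles b h) i ∧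
      Nat.count (· ∈ wiggles b h) i + 8 < (wiggles b h).card), add_comm]
  refine add_le_add ?_ le_rfl
  have : (Finset.range 12 ∪
      Finset.Ico ((wiggles b h).card - 8) (wiggles b h).card).card ≤ 20 := by
    refine (Finset.card_union_le _ _).trans ?_
    rw [Finset.card_range, Nat.card_Ico]
    omega
  refine le_trans (Finset.card_le_card_of_injOn (Nat.count (· ∈ wiggles b h)) ?_ ?_) this
  · intro i hi
    simp only [Finset.coe_filter, Set.mem_ofPred_eq] at hi
    have := count_wiggles_lt hi.1
    simp only [Finset.coe_union, Finset.coe_range, Finset.coe_Ico, Set.mem_union, Set.mem_Iio,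
      Set.mem_Ico]
    omega
  · intro i hi j hj hij
    simp only [Finset.coe_filter, Set.mem_ofPred_eq] at hi hj
    exact Nat.count_injective (p := (· ∈ wiggles b h)) hi.1 hj.1 hij

lemma wiggles_eq_empty (hb : ∀ i ≤ h, b i = b 0) : wiggles b h = ∅ := by
  refine Finset.filter_eq_empty_iff.2 fun i hi => ?_
  have := Finset.mem_range.1 hi
  rw [hb i (by omega), hb (i + 1) (by omega)]
  simp

lemma exists_alternation {i : ℕ} (hi : i ∈ innerWiggles b h) :
    ∃ x : ℕ → ℕ, (∀ j k, j < k → k ≤ 20 → x j < x k) ∧ x 20 ≤ h ∧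
      (∀ j < 20, b (x (j + 1)) ≠ b (x j)) ∧ x 8 + 4 ≤ i ∧ i + 5 ≤ x 17 := by
  obtain ⟨hP, h12, h8⟩ := Finset.mem_filter.1 hi
  let P : ℕ → Prop := (· ∈ wiggles b h)
  replace h12 : 12 ≤ Nat.count P i := h12
  replace h8 : Nat.count P i + 8 < (wiggles b h).card := h8
  have hf : (Set.ofPred P).Finite := (wiggles b h).finite_toSet
  have hκ : hf.toFinset.card = (wiggles b h).card := by
    congr 1; ext; simp [P]
  set m := Nat.count P i - 12 with hm
  have mono : ∀ j k, j < k → k ≤ 20 → Nat.nth P (m + j) < Nat.nth P (m + k) := fun j k hjk hk =>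
    Nat.nth_lt_nth_of_lt_card hf (by omega) (by omega)
  have mem : ∀ j ≤ 20, Nat.nth P (m + j) ∈ wiggles b h := fun j hj =>
    Nat.nth_mem_of_lt_card hf (by omega)
  have hx12 : Nat.nth P (m + 12) = i := by
    rw [hm, Nat.sub_add_cancel h12]
    exact Nat.nth_count hP
  refine ⟨fun j => Nat.nth P (m + j), mono, (mem_wiggles.1 (mem 20 le_rfl)).1.le, ?_, ?_, ?_⟩
  · intro j hj
    have h1 := (mem_wiggles.1 (mem j (by omega))).2
    have h2 : ∀ t, Nat.nth P (m + j) + 1 ≤ t → t ≤ Nat.nth P (m + (j + 1)) →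
        b t = b (Nat.nth P (m + j) + 1) := by
      intro t ht
      induction t, ht using Nat.le_induction with
      | base => simp
      | succ t ht ih =>
        intro hle
        rw [← ih (by omega)]
        by_contra hne
        have hth := (mem_wiggles.1 (mem (j + 1) (by omega))).1
        have : P t := mem_wiggles.2 ⟨by omega, fun e => hne e.symm⟩
        have := Nat.le_nth_of_lt_nth_succ (k := m + j) (by
          rw [add_assoc]; omega) this
        omega
    have h3 := mono j (j + 1) (by omega) (by omega)
    simp only
    rw [h2 _ h3 le_rfl]
    exact h1.symm
  · have a1 := mono 8 9 (by omega) (by omega)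
    have a2 := mono 9 10 (by omega) (by omega)
    have a3 := mono 10 11 (by omega) (by omega)
    have a4 := mono 11 12 (by omega) (by omega)
    simp only; omega
  · have a1 := mono 12 13 (by omega) (by omega)
    have a2 := mono 13 14 (by omega) (by omega)
    have a3 := mono 14 15 (by omega) (by omega)
    have a4 := mono 15 16 (by omega) (by omega)
    have a5 := mono 16 17 (by omega) (by omega)
    simp only; omega

end Wiggles

/-- At an inner change of color of a column, the test points are colored by a half-plane. -/
lemma AxisMono.inner {N h : ℕ} {η η' : ℝ} {W : Set ((ℝ × ℝ) × ℝ)} {S : Set (ℝ × ℝ)} {T : Set ℝ}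
    {G : H → Bool} (hG : AxisMono N h η η' W S T G) {i : ℕ}
    (hi : i ∈ innerWiggles (fun j => G (lift2 0 j)) h) :
    ∃ (a : ℤ) (e : Bool), ∀ τ ∈ W, (i : ℝ) - 4 < τ.2 → τ.2 < i + 5 →
      (η ≤ det2 (unitDir N a) τ.1 → G (lift2 τ.1 τ.2) = e) ∧
      (det2 (unitDir N a) τ.1 ≤ -η → G (lift2 τ.1 τ.2) = !e) := by
  obtain ⟨x, hx, hxn, hal, h8, h17⟩ := exists_alternation hi
  obtain ⟨a, e, hd⟩ := hG.dichotomy hx hxn hal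
  have h8' : (x 8 : ℝ) + 4 ≤ i := by exact_mod_cast h8
  have h17' : (i : ℝ) + 5 ≤ x 17 := by exact_mod_cast h17
  exact ⟨a, e, fun τ hτ h1 h2 => hd τ hτ (by linarith) (by linarith)⟩

/-- The color of the column above `v`. -/
def colColor (g : H → Bool) (v : ℝ × ℝ) : ℕ → Bool := fun i => g (lift2 v i)

lemma hmul_colPt (v p : ℝ × ℝ) (z : ℝ) :
    hmul (lift2 v 0) (lift2 (p - v) (z - det2 v p)) = lift2 p z := by
  rw [hmul_lift2]
  congr 1
  · abel
  · simp only [det2, Prod.fst_sub, Prod.snd_sub]; ring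

lemma hmul_axis (v : ℝ × ℝ) (z : ℝ) : hmul (lift2 v 0) (lift2 0 z) = lift2 v z := by
  rw [hmul_lift2]
  simp [det2]

/-- The test points at two consecutive heights are colored by a half-plane through the column. -/
lemma halfPlane_of_inner {R : ℕ} {g : H → Bool} {c : ℕ} (hc : c < R)
    (hG : AxisMono (R ^ 12) (R ^ 2) (wid R) (1 / (R : ℝ) ^ 12) (slabPts R) (dirs R) (params R)
      fun x => g (hmul (lift2 (colPt R c) 0) x)) {i : ℕ}
    (hi : i ∈ innerWiggles (colColor g (colPt R c)) (R ^ 2)) :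
    ∃ (a : ℤ) (e : Bool), ∀ p ∈ testPts R, ∀ j : ℕ, i ≤ j → j ≤ i + 1 →
      (wid R ≤ det2 (unitDir (R ^ 12) a) (p - colPt R c) → g (lift2 p j) = e) ∧
      (det2 (unitDir (R ^ 12) a) (p - colPt R c) ≤ -wid R → g (lift2 p j) = !e) := by
  have hcc : colColor g (colPt R c) =
      fun j : ℕ => (fun x => g (hmul (lift2 (colPt R c) 0) x)) (lift2 0 j) := by
    funext j
    simp only [hmul_axis, colColor]
  have hiR : i < R ^ 2 := (mem_wiggles.1 (Finset.mem_filter.1 hi).1).1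
  rw [hcc] at hi
  obtain ⟨a, e, hd⟩ := hG.inner hi
  refine ⟨a, e, fun p hp j hij hji => ?_⟩
  have hij' : (i : ℝ) ≤ j := by exact_mod_cast hij
  have hji' : (j : ℝ) ≤ i + 1 := by exact_mod_cast hji
  have hdet := abs_le.1 (abs_det2_colPt hc hp)
  have := hd (p - colPt R c, j - det2 (colPt R c) p) (Finset.mem_image.2
    ⟨((c, p), j), by
      simp only [Finset.mem_product, Finset.mem_range]; exact ⟨⟨hc, hp⟩, by omega⟩, rfl⟩)
    (by simp only; linarith) (by simp only; linarith)
  simpa only [hmul_colPt] using this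

lemma colPt_mem_testPts {R c : ℕ} (hc : c < R) : colPt R c ∈ testPts R :=
  Finset.mem_union_left _ (Finset.mem_image_of_mem _ (Finset.mem_range.2 hc))

/-- The color functional which detects half-planes at a given height. -/
def crossCut (d : H → H → ℝ) (i : ℕ) : ℝ :=
  d (lift2 (3, 0) i) (lift2 (-3, 0) i) + d (lift2 (0, 3) i) (lift2 (0, -3) i)

lemma cutI_nonneg (g : H → Bool) (p q : H) : 0 ≤ cutI g p q := by
  rw [cutI]; split_ifs <;> norm_num

lemma one_le_crossCut {R : ℕ} (hR : 1000 ≤ R) {g : H → Bool} {c i : ℕ} (hc : c < R) {a : ℤ}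
    {e : Bool} (h : ∀ p ∈ testPts R,
      (wid R ≤ det2 (unitDir (R ^ 12) a) (p - colPt R c) → g (lift2 p i) = e) ∧
      (det2 (unitDir (R ^ 12) a) (p - colPt R c) ≤ -wid R → g (lift2 p i) = !e)) :
    1 ≤ crossCut (cutI g) i := by
  obtain ⟨⟨h1, h2⟩, h3, h4⟩ := abs_colPt hc
  have hR' : (1000 : ℝ) ≤ R := by exact_mod_cast hR
  have hw : wid R ≤ 1 / 10 := by
    rw [wid]
    have : (1000 : ℝ) ^ 3 ≤ R ^ 3 := by gcongr
    apply one_div_le_one_div_of_le (by norm_num)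
    linarith
  have t1 : ((3, 0) : ℝ × ℝ) ∈ testPts R := by simp [testPts]
  have t2 : ((-3, 0) : ℝ × ℝ) ∈ testPts R := by simp [testPts]
  have t3 : ((0, 3) : ℝ × ℝ) ∈ testPts R := by simp [testPts]
  have t4 : ((0, -3) : ℝ × ℝ) ∈ testPts R := by simp [testPts]
  have k1 := h _ t1
  have k2 := h _ t2
  have k3 := h _ t3
  have k4 := h _ t4
  have hcs : (unitDir (R ^ 12) a).1 ^ 2 + (unitDir (R ^ 12) a).2 ^ 2 = 1 :=
    Real.cos_sq_add_sin_sq _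
  generalize colPt R c = v at *
  generalize unitDir (R ^ 12) a = u at *
  simp only [det2, Prod.fst_sub, Prod.snd_sub] at k1 k2 k3 k4
  have hconst : |u.2 * v.1 - u.1 * v.2| ≤ 3 / 2 := by
    apply abs_le_of_sq_le_sq _ (by norm_num)
    have heq : (u.2 * v.1 - u.1 * v.2) ^ 2 + (u.1 * v.1 + u.2 * v.2) ^ 2 = v.1 ^ 2 + v.2 ^ 2 := by
      linear_combination (v.1 ^ 2 + v.2 ^ 2) * hcs
    have hv1 : v.1 ^ 2 ≤ 1 := pow_le_one₀ h1 h2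
    have hv2 : v.2 ^ 2 ≤ 1 := pow_le_one₀ h3 h4
    linarith [sq_nonneg (u.1 * v.1 + u.2 * v.2)]
  obtain ⟨b1, b2⟩ := abs_le.1 hconst
  have n1 := cutI_nonneg g (lift2 (3, 0) i) (lift2 (-3, 0) i)
  have n2 := cutI_nonneg g (lift2 (0, 3) i) (lift2 (0, -3) i)
  have cut1 : ∀ p q : H, g p ≠ g q → cutI g p q = 1 := fun p q h => by rw [cutI, if_neg h]
  have neb : e ≠ !e := by cases e <;> simp
  have big : 7 / 10 ≤ |u.1| ∨ 7 / 10 ≤ |u.2| := by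
    by_contra hcon
    push Not at hcon
    have a1 : u.1 ^ 2 ≤ (7 / 10) ^ 2 := by
      rw [← sq_abs]
      exact pow_le_pow_left₀ (abs_nonneg _) hcon.1.le 2
    have a2 : u.2 ^ 2 ≤ (7 / 10) ^ 2 := by
      rw [← sq_abs]
      exact pow_le_pow_left₀ (abs_nonneg _) hcon.2.le 2
    norm_num at a1 a2
    linarith
  rw [crossCut]
  rcases big with hb | hb <;> rcases le_abs.1 hb with hb | hb
  · have := cut1 (lift2 (0, 3) i) (lift2 (0, -3) i) (by
      rw [k3.1 (by linarith), k4.2 (by linarith)]; exact neb)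
    linarith
  · have := cut1 (lift2 (0, 3) i) (lift2 (0, -3) i) (by
      rw [k3.2 (by linarith), k4.1 (by linarith)]; exact neb.symm)
    linarith
  · have := cut1 (lift2 (3, 0) i) (lift2 (-3, 0) i) (by
      rw [k1.2 (by linarith), k2.1 (by linarith)]; exact neb.symm)
    linarith
  · have := cut1 (lift2 (3, 0) i) (lift2 (-3, 0) i) (by
      rw [k1.1 (by linarith), k2.2 (by linarith)]; exact neb)
    linarith

lemma no_three_in_slab {R c₁ c₂ c₃ : ℕ} (h₃ : c₃ < R) (h12 : c₁ < c₂)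
    (h23 : c₂ < c₃) {u v : ℝ × ℝ} (hu : |u.1| ≤ 1 ∧ |u.2| ≤ 1) (hu2 : u.1 ^ 2 + u.2 ^ 2 = 1)
    (d1 : |det2 u (colPt R c₁ - v)| < wid R) (d2 : |det2 u (colPt R c₂ - v)| < wid R)
    (d3 : |det2 u (colPt R c₃ - v)| < wid R) : False := by
  have hR0 : (0 : ℝ) < R := by exact_mod_cast (by omega : 0 < R)
  have e : ∀ p q : ℝ × ℝ, p.1 * q.2 - p.2 * q.1 =
      (u.1 * p.1 + u.2 * p.2) * det2 u q - det2 u p * (u.1 * q.1 + u.2 * q.2) := by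
    intro p q
    simp only [det2]
    linear_combination (-(p.1 * q.2 - p.2 * q.1)) * hu2
  have hd : ∀ c, |det2 u (colPt R c - v)| < wid R →
      |det2 u (colPt R c - colPt R c₁)| < 2 * wid R := by
    intro c hc
    have : det2 u (colPt R c - colPt R c₁) = det2 u (colPt R c - v) - det2 u (colPt R c₁ - v) := by
      simp only [det2, Prod.fst_sub, Prod.snd_sub]; ring
    rw [this]
    refine (abs_sub _ _).trans_lt ?_
    linarith
  have hs : ∀ c < R, |u.1 * (colPt R c - colPt R c₁).1 + u.2 * (colPt R c - colPt R c₁).2| ≤ 2 := by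
    intro c hc
    obtain ⟨⟨p1, p2⟩, p3, p4⟩ := abs_colPt (R := R) (c := c₁) (by omega)
    obtain ⟨⟨q1, q2⟩, q3, q4⟩ := abs_colPt hc
    have r1 : |(colPt R c - colPt R c₁).1| ≤ 1 := by
      rw [Prod.fst_sub, abs_le]; constructor <;> linarith
    have r2 : |(colPt R c - colPt R c₁).2| ≤ 1 := by
      rw [Prod.snd_sub, abs_le]; constructor <;> linarith
    refine (abs_add_le _ _).trans ?_
    rw [abs_mul, abs_mul]
    have := mul_le_mul hu.1 r1 (abs_nonneg _) zero_le_one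
    have := mul_le_mul hu.2 r2 (abs_nonneg _) zero_le_one
    linarith
  have key := e (colPt R c₂ - colPt R c₁) (colPt R c₃ - colPt R c₁)
  have lhs : (colPt R c₂ - colPt R c₁).1 * (colPt R c₃ - colPt R c₁).2 -
      (colPt R c₂ - colPt R c₁).2 * (colPt R c₃ - colPt R c₁).1 =
      ((c₂ - c₁) * (c₃ - c₁) * (c₃ - c₂) : ℝ) / R ^ 3 := by
    simp only [colPt, Prod.fst_sub, Prod.snd_sub]
    field_simp
    ring
  have m1 : (1 : ℝ) ≤ c₂ - c₁ := by
    have : (c₁ : ℝ) + 1 ≤ c₂ := by exact_mod_cast h12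
    linarith
  have m2 : (1 : ℝ) ≤ c₃ - c₂ := by
    have : (c₂ : ℝ) + 1 ≤ c₃ := by exact_mod_cast h23
    linarith
  have low : 1 / (R : ℝ) ^ 3 ≤ ((c₂ - c₁) * (c₃ - c₁) * (c₃ - c₂) : ℝ) / R ^ 3 := by
    gcongr
    have m3 : (1 : ℝ) ≤ (c₂ - c₁) * (c₃ - c₁) := one_le_mul_of_one_le_of_one_le m1 (by linarith)
    exact one_le_mul_of_one_le_of_one_le m3 m2
  rw [← lhs, key] at low
  have up := (le_abs_self _).trans (abs_sub
    ((u.1 * (colPt R c₂ - colPt R c₁).1 + u.2 * (colPt R c₂ - colPt R c₁).2) *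
      det2 u (colPt R c₃ - colPt R c₁))
    (det2 u (colPt R c₂ - colPt R c₁) *
      (u.1 * (colPt R c₃ - colPt R c₁).1 + u.2 * (colPt R c₃ - colPt R c₁).2)))
  rw [abs_mul, abs_mul] at up
  have s2 := hs c₂ (by omega)
  have s3 := hs c₃ h₃
  have w2 := hd c₂ d2
  have w3 := hd c₃ d3
  have hw : 8 * wid R = 1 / (R : ℝ) ^ 3 := by rw [wid]; field_simp
  have z1 := mul_le_mul_of_nonneg_right s2 (abs_nonneg (det2 u (colPt R c₃ - colPt R c₁)))
  have z2 := mul_le_mul_of_nonneg_left s3 (abs_nonneg (det2 u (colPt R c₂ - colPt R c₁)))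
  linarith

/-- At each height, few columns have an inner change of color unless the cross is bichromatic. -/
lemma card_inner_le {R : ℕ} (hR : 1000 ≤ R) {g : H → Bool}
    (hG : ∀ c < R, AxisMono (R ^ 12) (R ^ 2) (wid R) (1 / (R : ℝ) ^ 12) (slabPts R) (dirs R)
      (params R) fun x => g (hmul (lift2 (colPt R c) 0) x)) (i : ℕ) :
    (((Finset.range R).filter fun c => i ∈ innerWiggles (colColor g (colPt R c)) (R ^ 2)).card : ℝ)
      ≤ 2 * crossCut (cutI g) i := by
  rcases Finset.eq_empty_or_nonempty
    ((Finset.range R).filter fun c => i ∈ innerWiggles (colColor g (colPt R c)) (R ^ 2)) with h | h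
  · rw [h, Finset.card_empty, Nat.cast_zero]
    exact mul_nonneg two_pos.le (add_nonneg (cutI_nonneg _ _ _) (cutI_nonneg _ _ _))
  · obtain ⟨c₀, hc₀⟩ := h
    obtain ⟨hc₀R, hi⟩ := Finset.mem_filter.1 hc₀
    rw [Finset.mem_range] at hc₀R
    obtain ⟨a, e, hd⟩ := halfPlane_of_inner hc₀R (hG c₀ hc₀R) hi
    have h1 := one_le_crossCut hR hc₀R fun p hp => hd p hp i le_rfl (by omega)
    have slab : ∀ c < R, i ∈ innerWiggles (colColor g (colPt R c)) (R ^ 2) →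
        |det2 (unitDir (R ^ 12) a) (colPt R c - colPt R c₀)| < wid R := by
      intro c hc hic
      by_contra hcon
      push Not at hcon
      have hw := (mem_wiggles.1 (Finset.mem_filter.1 hic).1).2
      have k0 := hd _ (colPt_mem_testPts hc) i le_rfl (by omega)
      have k1 := hd _ (colPt_mem_testPts hc) (i + 1) (by omega) le_rfl
      apply hw
      simp only [colColor]
      rcases le_abs.1 hcon with h | h
      · rw [k0.1 h, k1.1 h]
      · rw [k0.2 (by linarith), k1.2 (by linarith)]
    have h2 : ((Finset.range R).filter fun c =>
        i ∈ innerWiggles (colColor g (colPt R c)) (R ^ 2)).card ≤ 2 := by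
      by_contra hcon
      push Not at hcon
      obtain ⟨s, hs, hs3⟩ := Finset.exists_subset_card_eq (Nat.succ_le_of_lt hcon)
      have hmem : ∀ k : Fin 3, s.orderEmbOfFin hs3 k < R ∧
          i ∈ innerWiggles (colColor g (colPt R (s.orderEmbOfFin hs3 k))) (R ^ 2) := fun k => by
        have := Finset.mem_filter.1 (hs (Finset.orderEmbOfFin_mem s hs3 k))
        rwa [Finset.mem_range] at this
      exact no_three_in_slab (hmem 2).1
        ((s.orderEmbOfFin hs3).strictMono (show (0 : Fin 3) < 1 by decide))
        ((s.orderEmbOfFin hs3).strictMono (show (1 : Fin 3) < 2 by decide))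
        (abs_unitDir (R ^ 12) a) (Real.cos_sq_add_sin_sq _)
        (slab _ (hmem 0).1 (hmem 0).2) (slab _ (hmem 1).1 (hmem 1).2)
        (slab _ (hmem 2).1 (hmem 2).2)
    have h2' : (((Finset.range R).filter fun c =>
        i ∈ innerWiggles (colColor g (colPt R c)) (R ^ 2)).card : ℝ) ≤ 2 := by exact_mod_cast h2
    linarith

/-- The failure of additivity of a kernel along a translated frame. -/
def defect (d : H → H → ℝ) (q : H) (τ : Frame) : ℝ :=
  d (hmul q τ.1) (hmul q (hmul τ.1 (lift2 (τ.2.2.1 • τ.2.1) 0))) +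
    d (hmul q (hmul τ.1 (lift2 (τ.2.2.1 • τ.2.1) 0)))
      (hmul q (hmul τ.1 (lift2 ((τ.2.2.1 + τ.2.2.2) • τ.2.1) 0))) -
    d (hmul q τ.1) (hmul q (hmul τ.1 (lift2 ((τ.2.2.1 + τ.2.2.2) • τ.2.1) 0)))

lemma defect_cutI_nonneg (g : H → Bool) (q : H) (τ : Frame) : 0 ≤ defect (cutI g) q τ :=
  sub_nonneg.2 ((CutPos.cutI g).triangle _ _ _)

lemma one_le_defect_cutI {g : H → Bool} {q : H} {τ : Frame}
    (h : ¬FrameMono (fun x => g (hmul q x)) τ) : 1 ≤ defect (cutI g) q τ := by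
  simp only [FrameMono, LineMono, not_forall] at h
  obtain ⟨h1, h2⟩ := h
  simp only [defect, cutI]
  rw [if_neg (fun e => h2 e.symm), if_neg (fun e => h2 (e.trans h1.symm)), if_pos h1]
  norm_num

/-- All the frames used in the analysis of a column. -/
def allFrames (R : ℕ) : Finset Frame :=
  rayFrames R ∪ (transFrames R ∪ (footFrames R ∪
    (walkFrames₁ R ∪ (walkFrames₂ R ∪ walkFrames₃ R))))

lemma allFrames_bounded {R : ℕ} (hR : 1000 ≤ R) {τ : Frame} (hτ : τ ∈ allFrames R) :
    τ.Bounded ((R : ℝ) ^ 58) := by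
  rcases Finset.mem_union.1 hτ with h | h
  · exact rayFrames_bounded hR h
  rcases Finset.mem_union.1 h with h | h
  · exact transFrames_bounded hR h
  rcases Finset.mem_union.1 h with h | h
  · exact footFrames_bounded hR h
  · exact walkFrames_bounded hR h

lemma card_allFrames_le {R : ℕ} (hR : 1000 ≤ R) : (allFrames R).card ≤ R ^ 179 := by
  have h1 := card_rayFrames_le hR
  have h2 := card_transFrames_le hR
  have h3 := card_footFrames_le hR
  have h4 := card_walkFrames_le hR
  have h5 : R ^ 179 = R ^ 178 * R := pow_succ _ _
  have h6 : R ^ 178 * 4 ≤ R ^ 178 * R := Nat.mul_le_mul_left _ (by omega)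
  have u1 := Finset.card_union_le (footFrames R) (walkFrames₁ R ∪ (walkFrames₂ R ∪ walkFrames₃ R))
  have u2 := Finset.card_union_le (transFrames R)
    (footFrames R ∪ (walkFrames₁ R ∪ (walkFrames₂ R ∪ walkFrames₃ R)))
  have u3 := Finset.card_union_le (rayFrames R) (transFrames R ∪ (footFrames R ∪
    (walkFrames₁ R ∪ (walkFrames₂ R ∪ walkFrames₃ R))))
  rw [allFrames]
  omega

/-- The total variation of a kernel along the columns. -/
def columnSum (R : ℕ) (d : H → H → ℝ) : ℝ :=
  ∑ c ∈ Finset.range R, ∑ i ∈ Finset.range (R ^ 2),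
    d (lift2 (colPt R c) i) (lift2 (colPt R c) (i + 1 : ℕ))

/-- The total of a kernel over the endpoints of zigzag walks. -/
def cornerSum (R : ℕ) (d : H → H → ℝ) : ℝ :=
  ∑ c ∈ Finset.range R, ∑ x ∈ cornerIdx R,
    d (hmul (lift2 (colPt R c) 0) 0) (hmul (lift2 (colPt R c) 0) (cornerPt R x))

/-- The total of a kernel over the crosses. -/
def crossSum (R : ℕ) (d : H → H → ℝ) : ℝ := ∑ i ∈ Finset.range (R ^ 2), crossCut d i

/-- The total failure of additivity over all the frames. -/
def defectSum (R : ℕ) (d : H → H → ℝ) : ℝ :=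
  ∑ c ∈ Finset.range R, ∑ τ ∈ allFrames R, defect d (lift2 (colPt R c) 0) τ

lemma cutI_le_one (g : H → Bool) (p q : H) : cutI g p q ≤ 1 := by
  rw [cutI]; split_ifs <;> norm_num

lemma columnSum_cutI (R : ℕ) (g : H → Bool) : columnSum R (cutI g) =
    ∑ c ∈ Finset.range R, ((wiggles (colColor g (colPt R c)) (R ^ 2)).card : ℝ) := by
  refine Finset.sum_congr rfl fun c _ => ?_
  rw [wiggles, Finset.card_filter, Nat.cast_sum]
  refine Finset.sum_congr rfl fun i _ => ?_
  simp only [cutI, colColor]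
  split_ifs <;> simp_all

lemma card_wiggles_le_corner {R : ℕ} (hR : 1000 ≤ R) {g : H → Bool} {v : ℝ × ℝ}
    (hG : ∀ τ ∈ walkFrames₁ R ∪ (walkFrames₂ R ∪ walkFrames₃ R),
      FrameMono (fun x => g (hmul (lift2 v 0) x)) τ) :
    ((wiggles (colColor g v) (R ^ 2)).card : ℝ) ≤
      20 / ((R : ℝ) ^ 2 + 1) ^ 2 * ∑ x ∈ cornerIdx R,
        cutI g (hmul (lift2 v 0) 0) (hmul (lift2 v 0) (cornerPt R x)) +
      (innerWiggles (colColor g v) (R ^ 2)).card := by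
  have h0 : 0 ≤ ∑ x ∈ cornerIdx R,
      cutI g (hmul (lift2 v 0) 0) (hmul (lift2 v 0) (cornerPt R x)) :=
    Finset.sum_nonneg fun x _ => cutI_nonneg _ _ _
  by_cases hc : ∀ i ≤ R ^ 2, colColor g v i = colColor g v 0
  · rw [wiggles_eq_empty hc, Finset.card_empty, Nat.cast_zero]
    positivity
  · push Not at hc
    obtain ⟨i, hi, hne⟩ := hc
    have e0 : hmul (lift2 v 0) 0 = lift2 v ((0 : ℕ) : ℝ) := by simp [hmul, lift2]
    have hcard := card_corner hR hG hi (by simpa only [hmul_axis, e0, colColor] using hne)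
    have hcard' : ((R : ℝ) ^ 2 + 1) ^ 2 ≤ ∑ x ∈ cornerIdx R,
        cutI g (hmul (lift2 v 0) 0) (hmul (lift2 v 0) (cornerPt R x)) := by
      rw [Finset.card_filter] at hcard
      have hcast := (Nat.cast_le (α := ℝ)).2 hcard
      push_cast at hcast
      refine hcast.trans (le_of_eq ?_)
      refine Finset.sum_congr rfl fun x _ => ?_
      rw [cutI]
      split_ifs <;> simp_all
    have h20 : 20 ≤ 20 / ((R : ℝ) ^ 2 + 1) ^ 2 * ∑ x ∈ cornerIdx R,
        cutI g (hmul (lift2 v 0) 0) (hmul (lift2 v 0) (cornerPt R x)) := by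
      rw [div_mul_eq_mul_div, le_div_iff₀ (by positivity)]
      gcongr
    have : ((wiggles (colColor g v) (R ^ 2)).card : ℝ) ≤
        20 + (innerWiggles (colColor g v) (R ^ 2)).card := by exact_mod_cast card_wiggles_le
    linarith

lemma sum_card_inner_le {R : ℕ} (hR : 1000 ≤ R) {g : H → Bool}
    (hG : ∀ c < R, AxisMono (R ^ 12) (R ^ 2) (wid R) (1 / (R : ℝ) ^ 12) (slabPts R) (dirs R)
      (params R) fun x => g (hmul (lift2 (colPt R c) 0) x)) :
    ∑ c ∈ Finset.range R, ((innerWiggles (colColor g (colPt R c)) (R ^ 2)).card : ℝ) ≤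
      2 * crossSum R (cutI g) := by
  have h1 : ∀ c, innerWiggles (colColor g (colPt R c)) (R ^ 2) =
      (Finset.range (R ^ 2)).filter fun i =>
        i ∈ innerWiggles (colColor g (colPt R c)) (R ^ 2) := fun c => by
    ext i
    rw [Finset.mem_filter, Finset.mem_range]
    exact ⟨fun h => ⟨(mem_wiggles.1 (Finset.mem_filter.1 h).1).1, h⟩, fun h => h.2⟩
  rw [crossSum, Finset.mul_sum]
  calc _ = ∑ c ∈ Finset.range R, ∑ i ∈ Finset.range (R ^ 2),
        (if i ∈ innerWiggles (colColor g (colPt R c)) (R ^ 2) then (1 : ℝ) else 0) := by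
        refine Finset.sum_congr rfl fun c _ => ?_
        rw [h1, Finset.card_filter]
        push_cast
        refine Finset.sum_congr rfl fun i hi => ?_
        simp only [Finset.mem_filter, hi, true_and]
    _ = ∑ i ∈ Finset.range (R ^ 2), (((Finset.range R).filter fun c =>
          i ∈ innerWiggles (colColor g (colPt R c)) (R ^ 2)).card : ℝ) := by
        rw [Finset.sum_comm]
        refine Finset.sum_congr rfl fun i _ => ?_
        rw [Finset.card_filter]
        push_cast
        rfl
    _ ≤ _ := Finset.sum_le_sum fun i _ => card_inner_le hR hG i

lemma columnSum_cutI_le {R : ℕ} (hR : 1000 ≤ R) (g : H → Bool) :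
    columnSum R (cutI g) ≤ 20 / ((R : ℝ) ^ 2 + 1) ^ 2 * cornerSum R (cutI g) +
      2 * crossSum R (cutI g) + (R : ℝ) ^ 3 * defectSum R (cutI g) := by
  have hcorner : 0 ≤ cornerSum R (cutI g) :=
    Finset.sum_nonneg fun c _ => Finset.sum_nonneg fun x _ => cutI_nonneg _ _ _
  have hcross : 0 ≤ crossSum R (cutI g) :=
    Finset.sum_nonneg fun c _ => add_nonneg (cutI_nonneg _ _ _) (cutI_nonneg _ _ _)
  have hdefect : ∀ c, 0 ≤ ∑ τ ∈ allFrames R, defect (cutI g) (lift2 (colPt R c) 0) τ :=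
    fun c => Finset.sum_nonneg fun x _ => defect_cutI_nonneg _ _ _
  have hdef : 0 ≤ defectSum R (cutI g) := Finset.sum_nonneg fun c _ => hdefect c
  by_cases hall : ∀ c < R, ∀ τ ∈ allFrames R,
      FrameMono (fun x => g (hmul (lift2 (colPt R c) 0) x)) τ
  · have hAxis := fun c hc => axisMono_of_frames hR
      (fun τ hτ => hall c hc τ (Finset.mem_union_left _ hτ))
      (fun τ hτ => hall c hc τ (Finset.mem_union_right _ (Finset.mem_union_left _ hτ)))
      (fun τ hτ => hall c hc τ (Finset.mem_union_right _ (Finset.mem_union_right _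
        (Finset.mem_union_left _ hτ))))
    have h1 := sum_card_inner_le hR hAxis
    have h2 : columnSum R (cutI g) ≤ 20 / ((R : ℝ) ^ 2 + 1) ^ 2 * cornerSum R (cutI g) +
        ∑ c ∈ Finset.range R, ((innerWiggles (colColor g (colPt R c)) (R ^ 2)).card : ℝ) := by
      rw [columnSum_cutI, cornerSum, Finset.mul_sum, ← Finset.sum_add_distrib]
      refine Finset.sum_le_sum fun c hc => card_wiggles_le_corner hR fun τ hτ =>
        hall c (Finset.mem_range.1 hc) τ (Finset.mem_union_right _ (Finset.mem_union_right _
          (Finset.mem_union_right _ hτ)))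
    have : 0 ≤ (R : ℝ) ^ 3 * defectSum R (cutI g) := by positivity
    linarith
  · push Not at hall
    obtain ⟨c, hc, τ, hτ, hv⟩ := hall
    have h1 : 1 ≤ defectSum R (cutI g) :=
      (one_le_defect_cutI hv).trans <|
        (Finset.single_le_sum (fun x _ => defect_cutI_nonneg _ _ x) hτ).trans <|
        Finset.single_le_sum (fun c _ => hdefect c) (Finset.mem_range.2 hc)
    have h2 : columnSum R (cutI g) ≤ (R : ℝ) ^ 3 := by
      have : columnSum R (cutI g) ≤ ∑ _c ∈ Finset.range R, ∑ _i ∈ Finset.range (R ^ 2), (1 : ℝ) :=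
        Finset.sum_le_sum fun c _ => Finset.sum_le_sum fun i _ => cutI_le_one _ _ _
      refine this.trans (le_of_eq ?_)
      simp
      ring
    have h3 : (R : ℝ) ^ 3 ≤ (R : ℝ) ^ 3 * defectSum R (cutI g) :=
      le_mul_of_one_le_right (by positivity) h1
    have : 0 ≤ 20 / ((R : ℝ) ^ 2 + 1) ^ 2 * cornerSum R (cutI g) := by positivity
    linarith

lemma evals_sum {ι : Type*} {s : Finset ι} {F : ι → (H → H → ℝ) → ℝ} (h : ∀ i, F i ∈ evals) :
    (fun d => ∑ i ∈ s, F i d) ∈ evals := by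
  rw [← Finset.sum_fn]
  exact evals.sum_mem fun i _ => h i

lemma crossCut_mem_evals (i : ℕ) : (fun d => crossCut d i) ∈ evals :=
  evals.add_mem (eval_mem _ _) (eval_mem _ _)

lemma defect_mem_evals (q : H) (τ : Frame) : (fun d => defect d q τ) ∈ evals :=
  evals.sub_mem (evals.add_mem (eval_mem _ _) (eval_mem _ _)) (eval_mem _ _)

/-- The basic inequality between the variation along columns and horizontal quantities. -/
lemma CutPos.columnSum_le {d : H → H → ℝ} (hd : CutPos d) {R : ℕ} (hR : 1000 ≤ R) :
    columnSum R d ≤ 20 / ((R : ℝ) ^ 2 + 1) ^ 2 * cornerSum R d +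
      2 * crossSum R d + (R : ℝ) ^ 3 * defectSum R d :=
  hd.le_of (l := columnSum R) (r := fun d => 20 / ((R : ℝ) ^ 2 + 1) ^ 2 * cornerSum R d +
      2 * crossSum R d + (R : ℝ) ^ 3 * defectSum R d)
    (evals_sum fun _ => evals_sum fun _ => eval_mem _ _)
    (evals.add_mem (evals.add_mem
      (evals.smul_mem _ (evals_sum fun _ => evals_sum fun _ => eval_mem _ _))
      (evals.smul_mem _ (evals_sum crossCut_mem_evals)))
      (evals.smul_mem _ (evals_sum fun _ => evals_sum fun _ => defect_mem_evals _ _)))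
    (columnSum_cutI_le hR)

/-- Pulling back preserves the linear inequalities satisfied by cut semimetrics. -/
lemma CutPos.comp {d : H → H → ℝ} (hd : CutPos d) (σ : H → H) :
    CutPos fun p q => d (σ p) (σ q) := by
  intro l hl hg
  have : (fun d : H → H → ℝ => l fun p q => d (σ p) (σ q)) ∈ evals := by
    clear hg
    unfold evals at hl
    induction hl using Submodule.span_induction with
    | mem x hx =>
      obtain ⟨pq, rfl⟩ := hx
      exact eval_mem _ _
    | zero => exact evals.zero_mem
    | add x y _ _ hx hy => exact evals.add_mem hx hy
    | smul a x _ hx => exact evals.smul_mem a hx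
  exact hd _ this fun g => hg (g ∘ σ)

/-- The Heisenberg dilation by `s`. -/
def dil (s : ℝ) (p : H) : H := (s * p.1, s * p.2.1, s ^ 2 * p.2.2)

lemma dil_hmul (s : ℝ) (p q : H) : dil s (hmul p q) = hmul (dil s p) (dil s q) := by
  simp only [dil, hmul, Prod.mk.injEq]
  refine ⟨by ring, by ring, by ring⟩

lemma dil_lift2 (s z : ℝ) (v : ℝ × ℝ) : dil s (lift2 v z) = lift2 (s • v) (s ^ 2 * z) := rfl

lemma hmul_zero' (p : H) : hmul p 0 = p := by simp [hmul]

section Scales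

variable {d : H → H → ℝ} {K : ℝ}

lemma dist_dil_hmul (hinv : ∀ a p q, d (hmul a p) (hmul a q) = d p q) (s : ℝ) (p q : H) :
    d (dil s p) (dil s (hmul p q)) = d 0 (dil s q) := by
  simpa only [dil_hmul, hmul_zero'] using hinv (dil s p) 0 (dil s q)

lemma le_columnSum {M : ℕ} (hinv : ∀ a p q, d (hmul a p) (hmul a q) = d p q)
    (hlow : ∀ t : ℝ, 1 ≤ t → t ≤ (M : ℝ) ^ 2 / 8 → √t ≤ d 0 (0, 0, t)) {s : ℝ} (hs : 1 ≤ s)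
    (hsM : s ^ 2 ≤ (M : ℝ) ^ 2 / 8) (R : ℕ) :
    (R : ℝ) ^ 3 * s ≤ columnSum R fun p q => d (dil s p) (dil s q) := by
  have h : ∀ (v : ℝ × ℝ) (i : ℕ), s ≤ d (dil s (lift2 v i)) (dil s (lift2 v (i + 1 : ℕ))) := by
    intro v i
    have e : lift2 v (i + 1 : ℕ) = hmul (lift2 v i) (0, 0, 1) := by
      simp [lift2, hmul]
    rw [e, dist_dil_hmul hinv]
    have := hlow (s ^ 2) (one_le_pow₀ hs) hsM
    rw [Real.sqrt_sq (by linarith)] at this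
    simpa [dil] using this
  calc (R : ℝ) ^ 3 * s = ∑ _c ∈ Finset.range R, ∑ _i ∈ Finset.range (R ^ 2), s := by
        simp
        ring
    _ ≤ _ := Finset.sum_le_sum fun c _ => Finset.sum_le_sum fun i _ => h _ _

lemma card_cornerIdx_le (R : ℕ) : ((cornerIdx R).card : ℝ) ≤ 48 * ((R : ℝ) ^ 2 + 1) ^ 2 := by
  have h : (cornerIdx R).card ≤ 48 * (R ^ 2 + 1) ^ 2 := by
    rw [cornerIdx, Finset.card_product, Finset.card_product, Int.card_Icc, Int.card_Icc]
    have h1 : ({1, -1} : Finset ℤ).card ≤ 2 := Finset.card_le_two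
    have h2 : (2 * (R : ℤ) ^ 2 + 1 - -2 * (R : ℤ) ^ 2).toNat = 4 * R ^ 2 + 1 := by
      zify
      rw [Int.toNat_of_nonneg (by nlinarith [sq_nonneg (R : ℤ)])]
      ring
    have h3 : (4 * (R : ℤ) ^ 2 + 1 - -2 * (R : ℤ) ^ 2).toNat = 6 * R ^ 2 + 1 := by
      zify
      rw [Int.toNat_of_nonneg (by nlinarith [sq_nonneg (R : ℤ)])]
      ring
    rw [h2, h3]
    calc _ ≤ 2 * ((4 * R ^ 2 + 1) * (6 * R ^ 2 + 1)) := Nat.mul_le_mul_right _ h1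
      _ ≤ _ := by nlinarith
  exact_mod_cast h

lemma cornerSum_le
    (hup : ∀ r : ℝ, 1 ≤ r → ∀ p : H, |p.1| ≤ r → |p.2.1| ≤ r → |p.2.2| ≤ r ^ 2 → d 0 p ≤ K * r)
    (hK : 0 ≤ K) (hinv : ∀ a p q, d (hmul a p) (hmul a q) = d p q) {s : ℝ}
    (hs : 1 ≤ s) {R : ℕ} (hR : 1000 ≤ R) :
    20 / ((R : ℝ) ^ 2 + 1) ^ 2 * cornerSum R (fun p q => d (dil s p) (dil s q)) ≤
      1920 * (R : ℝ) ^ 2 * K * s := by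
  have hR' : (1000 : ℝ) ≤ R := by exact_mod_cast hR
  have hs2 : 0 ≤ s ^ 2 := sq_nonneg s
  have h : ∀ (q : H), ∀ x ∈ cornerIdx R,
      d (dil s (hmul q 0)) (dil s (hmul q (cornerPt R x))) ≤ K * (2 * R * s) := by
    intro q x hx
    rw [hmul_zero', dist_dil_hmul hinv]
    simp only [cornerIdx, Finset.mem_product, Finset.mem_insert, Finset.mem_singleton,
      Finset.mem_Icc] at hx
    obtain ⟨hx1, ⟨hx2, hx3⟩, hx4, hx5⟩ := hx
    have hx2' : -2 * (R : ℝ) ^ 2 ≤ x.2.1 := by exact_mod_cast hx2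
    have hx3' : (x.2.1 : ℝ) ≤ 2 * (R : ℝ) ^ 2 := by exact_mod_cast hx3
    have hx4' : -2 * (R : ℝ) ^ 2 ≤ x.2.2 := by exact_mod_cast hx4
    have hx5' : (x.2.2 : ℝ) ≤ 4 * (R : ℝ) ^ 2 := by exact_mod_cast hx5
    have hx1' : |(x.1 : ℝ)| = 1 := by rcases hx1 with h | h <;> rw [h] <;> norm_num
    have b1 : |(x.2.1 / (2 * R) : ℝ)| ≤ R := by
      rw [abs_div, abs_of_pos (by linarith : (0 : ℝ) < 2 * R), div_le_iff₀ (by linarith), abs_le]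
      constructor <;> nlinarith
    have b3 : |(x.2.2 / 2 : ℝ)| ≤ 2 * R ^ 2 := by
      rw [abs_le]
      constructor <;> linarith
    have hRs : R * s ≤ 2 * R * s := by nlinarith
    apply hup _ (by nlinarith)
    · simp only [dil, cornerPt, lift2]
      rw [abs_mul, abs_of_nonneg (by linarith : 0 ≤ s)]
      nlinarith
    · simp only [dil, cornerPt, lift2]
      rw [abs_mul, abs_mul, hx1', one_mul, Nat.abs_cast, abs_of_nonneg (by linarith : 0 ≤ s)]
      linarith
    · simp only [dil, cornerPt, lift2]
      rw [abs_mul, abs_of_nonneg hs2]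
      have := mul_le_mul_of_nonneg_left b3 hs2
      have : 0 ≤ s ^ 2 * (R : ℝ) ^ 2 := by positivity
      linarith [this, (by ring : (2 * R * s) ^ 2 = 4 * (s ^ 2 * (R : ℝ) ^ 2))]
  have h1 : cornerSum R (fun p q => d (dil s p) (dil s q)) ≤
      R * ((48 * ((R : ℝ) ^ 2 + 1) ^ 2) * (K * (2 * R * s))) := by
    calc _ ≤ ∑ _c ∈ Finset.range R, ∑ _x ∈ cornerIdx R, K * (2 * R * s) :=
          Finset.sum_le_sum fun c _ => Finset.sum_le_sum fun x hx => h _ x hx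
      _ = R * ((cornerIdx R).card * (K * (2 * R * s))) := by simp
      _ ≤ _ := by
        have := card_cornerIdx_le R
        gcongr
  calc _ ≤ 20 / ((R : ℝ) ^ 2 + 1) ^ 2 *
        (R * ((48 * ((R : ℝ) ^ 2 + 1) ^ 2) * (K * (2 * R * s)))) := by gcongr
    _ = _ := by
      field_simp
      ring

lemma crossSum_le
    (hup : ∀ r : ℝ, 1 ≤ r → ∀ p : H, |p.1| ≤ r → |p.2.1| ≤ r → |p.2.2| ≤ r ^ 2 → d 0 p ≤ K * r)
    (hinv : ∀ a p q, d (hmul a p) (hmul a q) = d p q) {s : ℝ}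
    (hs : 1 ≤ s) (R : ℕ) :
    crossSum R (fun p q => d (dil s p) (dil s q)) ≤ 12 * (R : ℝ) ^ 2 * K * s := by
  have h : ∀ i : ℕ, crossCut (fun p q => d (dil s p) (dil s q)) i ≤ 12 * K * s := by
    intro i
    have e1 : lift2 (-3, 0) (i : ℝ) = hmul (lift2 (3, 0) i) (-6, 0, 0) := by
      simp [lift2, hmul]; norm_num
    have e2 : lift2 (0, -3) (i : ℝ) = hmul (lift2 (0, 3) i) (0, -6, 0) := by
      simp [lift2, hmul]; norm_num
    have a6 : |s * (-6)| ≤ 6 * s := by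
      rw [abs_mul, abs_of_nonneg (by linarith : 0 ≤ s)]; norm_num; linarith
    have h1 : d 0 (dil s (-6, 0, 0)) ≤ K * (6 * s) :=
      hup _ (by linarith) _ a6 (by simp only [dil, mul_zero, abs_zero]; linarith)
        (by simp only [dil, mul_zero, abs_zero]; positivity)
    have h2 : d 0 (dil s (0, -6, 0)) ≤ K * (6 * s) :=
      hup _ (by linarith) _ (by simp only [dil, mul_zero, abs_zero]; linarith) a6
        (by simp only [dil, mul_zero, abs_zero]; positivity)
    simp only [crossCut]
    rw [e1, e2, dist_dil_hmul hinv, dist_dil_hmul hinv]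
    linarith
  calc _ ≤ ∑ _i ∈ Finset.range (R ^ 2), 12 * K * s := Finset.sum_le_sum fun i _ => h i
    _ = _ := by
      simp
      ring

lemma defect_dil (hinv : ∀ a p q, d (hmul a p) (hmul a q) = d p q) (s : ℝ) (q p : H) (w : ℝ × ℝ)
    (a b : ℝ) : defect (fun p q => d (dil s p) (dil s q)) q (p, w, a, b) =
      d 0 (lift2 ((s * a) • w) 0) + d 0 (lift2 ((s * b) • w) 0) -
        d 0 (lift2 ((s * (a + b)) • w) 0) := by
  have e : lift2 ((a + b) • w) 0 = hmul (lift2 (a • w) 0) (lift2 (b • w) 0) := by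
    rw [hmul_lift2, add_smul]
    congr 1
    simp only [det2, Prod.smul_fst, Prod.smul_snd, smul_eq_mul]
    ring
  have e3 : d (dil s (hmul q p)) (dil s (hmul q (hmul p (lift2 ((a + b) • w) 0)))) =
      d 0 (lift2 ((s * (a + b)) • w) 0) := by
    rw [← hmul_assoc, dist_dil_hmul hinv, dil_lift2, smul_smul, mul_zero]
  simp only [defect]
  rw [e3, e, ← hmul_assoc, ← hmul_assoc, ← hmul_assoc, dist_dil_hmul hinv, dist_dil_hmul hinv,
    dil_lift2, dil_lift2, smul_smul, smul_smul, mul_zero]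

lemma sum_defect_le
    (hup : ∀ r : ℝ, 1 ≤ r → ∀ p : H, |p.1| ≤ r → |p.2.1| ≤ r → |p.2.2| ≤ r ^ 2 → d 0 p ≤ K * r)
    (hd : CutPos d) (hK : 0 ≤ K)
    (hinv : ∀ a p q, d (hmul a p) (hmul a q) = d p q) (q : H) {τ : Frame} {L : ℝ}
    (hτ : τ.Bounded L) {m : ℕ} (hm : 1 ≤ m) :
    ∑ k ∈ Finset.range m,
      defect (fun p q => d (dil (2 ^ k) p) (dil (2 ^ k) q)) q τ / 2 ^ k ≤ 9 * K * √m * (1 + L) := by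
  obtain ⟨p, w, a, b⟩ := τ
  simp only [defect_dil hinv]
  refine scale_sum (Q := fun r => d 0 (lift2 (r • w) 0)) (β := |w.1| + |w.2|) hK (by positivity)
    ?_ (fun _ _ => hd.nonneg _ _) ?_ ?_ hτ.nonneg_left hτ.nonneg_right hτ.extent hm
  · simp only [zero_smul]
    exact hd.self 0
  · intro a b _ _
    have e : lift2 ((a + b) • w) 0 = hmul (lift2 (a • w) 0) (lift2 (b • w) 0) := by
      rw [hmul_lift2, add_smul]
      congr 1
      simp only [det2, Prod.smul_fst, Prod.smul_snd, smul_eq_mul]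
      ring
    have h1 := hd.triangle 0 (lift2 (a • w) 0) (lift2 ((a + b) • w) 0)
    have h2 := hinv (lift2 (a • w) 0) 0 (lift2 (b • w) 0)
    rw [hmul_zero', ← e] at h2
    linarith
  · intro a ha
    have h1 := mul_nonneg (abs_nonneg w.1) ha
    have h2 := mul_nonneg (abs_nonneg w.2) ha
    refine hup _ (by linarith) _ ?_ ?_ ?_
    · simp only [lift2, Prod.smul_fst, smul_eq_mul]
      rw [abs_mul, abs_of_nonneg ha]
      linarith
    · simp only [lift2, Prod.smul_snd, smul_eq_mul]
      rw [abs_mul, abs_of_nonneg ha]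
      linarith
    · simp only [lift2, abs_zero]
      positivity

lemma sum_defectSum_le
    (hup : ∀ r : ℝ, 1 ≤ r → ∀ p : H, |p.1| ≤ r → |p.2.1| ≤ r → |p.2.2| ≤ r ^ 2 → d 0 p ≤ K * r)
    (hd : CutPos d) (hK : 0 ≤ K)
    (hinv : ∀ a p q, d (hmul a p) (hmul a q) = d p q) {R m : ℕ} (hR : 1000 ≤ R) (hm : 1 ≤ m) :
    ∑ k ∈ Finset.range m, defectSum R (fun p q => d (dil (2 ^ k) p) (dil (2 ^ k) q)) / 2 ^ k ≤
      (R : ℝ) ^ 240 * K * √m := by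
  have hR' : (1000 : ℝ) ≤ R := by exact_mod_cast hR
  have hcard : ((allFrames R).card : ℝ) ≤ (R : ℝ) ^ 179 := by exact_mod_cast card_allFrames_le hR
  have h9 : 9 * (1 + (R : ℝ) ^ 58) ≤ R ^ 60 := by
    have h1 : 1 ≤ (R : ℝ) ^ 58 := one_le_pow₀ (by linarith)
    have h2 : (1000 : ℝ) ^ 2 ≤ (R : ℝ) ^ 2 := by gcongr
    rw [show (R : ℝ) ^ 60 = R ^ 58 * R ^ 2 by ring]
    nlinarith
  have hKm : 0 ≤ K * √m := by positivity
  calc _ = ∑ c ∈ Finset.range R, ∑ τ ∈ allFrames R, ∑ k ∈ Finset.range m,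
        defect (fun p q => d (dil (2 ^ k) p) (dil (2 ^ k) q)) (lift2 (colPt R c) 0) τ / 2 ^ k := by
        simp only [defectSum, Finset.sum_div]
        rw [Finset.sum_comm]
        refine Finset.sum_congr rfl fun c _ => Finset.sum_comm
    _ ≤ ∑ _c ∈ Finset.range R, ∑ _τ ∈ allFrames R, 9 * K * √m * (1 + (R : ℝ) ^ 58) :=
        Finset.sum_le_sum fun c _ => Finset.sum_le_sum fun τ hτ =>
          sum_defect_le hup hd hK hinv _ (allFrames_bounded hR hτ) hm
    _ = R * ((allFrames R).card * (9 * (1 + (R : ℝ) ^ 58) * (K * √m))) := by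
        simp only [Finset.sum_const, Finset.card_range, nsmul_eq_mul]
        ring
    _ ≤ R * ((R : ℝ) ^ 179 * (R ^ 60 * (K * √m))) := by gcongr
    _ = _ := by ring

/-- Invariant kernels which grow like the square root along the center are distorted. -/
lemma le_of_scales {M : ℕ}
    (hup : ∀ r : ℝ, 1 ≤ r → ∀ p : H, |p.1| ≤ r → |p.2.1| ≤ r → |p.2.2| ≤ r ^ 2 → d 0 p ≤ K * r)
    (hd : CutPos d) (hK : 0 ≤ K)
    (hinv : ∀ a p q, d (hmul a p) (hmul a q) = d p q)
    (hlow : ∀ t : ℝ, 1 ≤ t → t ≤ (M : ℝ) ^ 2 / 8 → √t ≤ d 0 (0, 0, t)) {R m : ℕ} (hR : 1000 ≤ R)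
    (hRm : R ^ 482 ≤ m) (hM : 2 ^ (m + 1) ≤ M) : (R : ℝ) ≤ 1945 * K := by
  have hR' : (1000 : ℝ) ≤ R := by exact_mod_cast hR
  have hm : 1 ≤ m := le_trans (Nat.one_le_pow _ _ (by omega)) hRm
  have hm0 : (0 : ℝ) < m := by exact_mod_cast hm
  have scale : ∀ k ∈ Finset.range m, (R : ℝ) ^ 3 ≤ 1944 * (R : ℝ) ^ 2 * K +
      (R : ℝ) ^ 3 * (defectSum R (fun p q => d (dil (2 ^ k) p) (dil (2 ^ k) q)) / 2 ^ k) := by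
    intro k hk
    have hs : (1 : ℝ) ≤ 2 ^ k := one_le_pow₀ (by norm_num)
    have hsM : ((2 : ℝ) ^ k) ^ 2 ≤ (M : ℝ) ^ 2 / 8 := by
      have h1 : (2 : ℝ) ^ (m + 1) ≤ M := by exact_mod_cast hM
      have h2 : (2 : ℝ) ^ (k + 2) ≤ M :=
        (pow_le_pow_right₀ (by norm_num) (by have := Finset.mem_range.1 hk; omega)).trans h1
      have h3 : ((2 : ℝ) ^ (k + 2)) ^ 2 ≤ (M : ℝ) ^ 2 := by gcongr
      rw [pow_add] at h3
      nlinarith [sq_nonneg ((2 : ℝ) ^ k)]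
    have h1 := le_columnSum hinv hlow hs hsM R
    have h2 := (hd.comp (dil (2 ^ k))).columnSum_le hR
    have h3 := cornerSum_le hup hK hinv hs hR
    have h4 := crossSum_le hup hinv hs R
    have h5 : (R : ℝ) ^ 3 * 2 ^ k ≤ 1944 * (R : ℝ) ^ 2 * K * 2 ^ k +
        (R : ℝ) ^ 3 * defectSum R (fun p q => d (dil (2 ^ k) p) (dil (2 ^ k) q)) := by linarith
    have h6 : (0 : ℝ) < 2 ^ k := by positivity
    refine le_of_mul_le_mul_right (h5.trans (le_of_eq ?_)) h6
    field_simp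
  have sum := Finset.sum_le_sum scale
  rw [Finset.sum_add_distrib, Finset.sum_const, Finset.sum_const, ← Finset.mul_sum,
    Finset.card_range, nsmul_eq_mul, nsmul_eq_mul] at sum
  have hdef := mul_le_mul_of_nonneg_left (sum_defectSum_le hup hd hK hinv hR hm)
    (by positivity : 0 ≤ (R : ℝ) ^ 3)
  have hsqrt : (R : ℝ) ^ 241 ≤ √m := by
    apply Real.le_sqrt_of_sq_le
    rw [← pow_mul]
    have := (Nat.cast_le (α := ℝ)).2 hRm
    rwa [Nat.cast_pow] at this
  have hmm : √(m : ℝ) * √m = m := Real.mul_self_sqrt hm0.le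
  have h7 : (R : ℝ) ^ 241 * √m ≤ m := by
    calc _ ≤ √(m : ℝ) * √m := by gcongr
      _ = m := hmm
  have h8 : (R : ℝ) ^ 2 * K * ((R : ℝ) ^ 241 * √m) ≤ (R : ℝ) ^ 2 * K * m := by gcongr
  have h9 : ((R : ℝ) ^ 2 * m) * R ≤ ((R : ℝ) ^ 2 * m) * (1945 * K) := by
    calc ((R : ℝ) ^ 2 * m) * R = m * (R : ℝ) ^ 3 := by ring
      _ ≤ m * (1944 * (R : ℝ) ^ 2 * K) + (R : ℝ) ^ 3 * ((R : ℝ) ^ 240 * K * √m) := by linarith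
      _ = m * (1944 * (R : ℝ) ^ 2 * K) + (R : ℝ) ^ 2 * K * ((R : ℝ) ^ 241 * √m) := by ring
      _ ≤ m * (1944 * (R : ℝ) ^ 2 * K) + (R : ℝ) ^ 2 * K * m := by linarith
      _ = _ := by ring
  exact le_of_mul_le_mul_left h9 (by positivity)

end Scales

lemma two_pow_sq_le {n m : ℕ} (hm : 1000 ≤ m) (hn : 2 * (m : ℝ) ≤ Real.log n) :
    (2 ^ (m + 1)) ^ 2 ≤ n := by
  have hm' : (1000 : ℝ) ≤ m := by exact_mod_cast hm
  have hn0 : (0 : ℝ) < n := by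
    rcases Nat.eq_zero_or_pos n with h | h
    · rw [h, Nat.cast_zero, Real.log_zero] at hn
      linarith
    · exact_mod_cast h
  have : ((2 : ℝ) ^ (m + 1)) ^ 2 ≤ n := by
    rw [← Real.log_le_log_iff (by positivity) hn0, Real.log_pow, Real.log_pow]
    have := Real.log_two_lt_d9
    push_cast
    nlinarith
  exact_mod_cast this

/-- The distortion of the grid of side `n` exceeds `R` if `log n` is at least a power of `R`. -/
lemma le_distortion {Ω : Type} [MeasurableSpace Ω] {ν : Measure Ω} {n R m : ℕ} {D : ℝ}
    {f : H → Lp ℝ 1 ν} (hD : 1 ≤ D)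
    (hf : ∀ x ∈ cube n, ∀ y ∈ cube n, rho x y ≤ ‖f x - f y‖ ∧ ‖f x - f y‖ ≤ D * rho x y)
    (hR : 1000 ≤ R) (hRm : R ^ 482 ≤ m) (hn : 2 * (m : ℝ) ≤ Real.log n) :
    (R : ℝ) ≤ 1945 * (1000000 * D) := by
  have hm : 1000 ≤ m := hR.trans ((Nat.le_self_pow (by norm_num) R).trans hRm)
  obtain ⟨M, hM⟩ : ∃ M, M = 2 ^ (m + 1) := ⟨_, rfl⟩
  have h8 : 8 ≤ M := by
    rw [hM]
    exact (by norm_num : 8 = 2 ^ 3).le.trans (Nat.pow_le_pow_right two_pos (by omega))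
  obtain ⟨d, hd, hinv, hup, hlow⟩ := exists_invariant h8 (hM ▸ two_pow_sq_le hm hn) hD hf
  exact le_of_scales hup hd (by positivity) hinv hlow hR hRm hM.ge

/-- **L¹ distortion of the grid.** There are universal `δ ∈ (0,1)` and `c > 0`
such that for every `n ≥ 2`: if `f : {0,…,n}³ → L¹(ν)` satisfies
`ρ(x,y) ≤ ‖f(x)−f(y)‖₁ ≤ D·ρ(x,y)` for some `D ≥ 1`, then `D ≥ c·(log n)^δ`. -/
theorem statement1 :
    ∃ δ c : ℝ, 0 < δ ∧ δ < 1 ∧ 0 < c ∧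
      ∀ n : ℕ, 2 ≤ n →
        ∀ (Ω : Type) [MeasurableSpace Ω] (ν : Measure Ω) [SigmaFinite ν] (D : ℝ),
          1 ≤ D →
          ∀ f : H → Lp ℝ 1 ν,
            (∀ x ∈ cube n, ∀ y ∈ cube n,
              rho x y ≤ ‖f x - f y‖ ∧ ‖f x - f y‖ ≤ D * rho x y) →
            c * (Real.log (n : ℝ)) ^ δ ≤ D := by
  refine ⟨1 / 482, 1 / 10 ^ 10, by norm_num, by norm_num, by norm_num, ?_⟩
  intro n hn Ω _ ν _ D hD f hf
  have hlog : 0 ≤ Real.log n := Real.log_natCast_nonneg n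
  set X : ℝ := (Real.log n / 2) ^ (1 / 482 : ℝ) with hX
  have hX0 : 0 ≤ X := by positivity
  have hXL : Real.log n ^ (1 / 482 : ℝ) ≤ 2 * X := by
    have h1 : Real.log n ^ (1 / 482 : ℝ) = 2 ^ (1 / 482 : ℝ) * X := by
      rw [hX, ← Real.mul_rpow (by norm_num) (by positivity)]
      congr 1
      ring
    have h2 : (2 : ℝ) ^ (1 / 482 : ℝ) ≤ 2 ^ (1 : ℝ) :=
      Real.rpow_le_rpow_of_exponent_le (by norm_num) (by norm_num)
    rw [Real.rpow_one] at h2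
    rw [h1]
    gcongr
  have hfl := Nat.lt_floor_add_one X
  by_cases hR : 1000 ≤ ⌊X⌋₊
  · have hpow : X ^ 482 = Real.log n / 2 := by
      rw [hX, ← Real.rpow_natCast, ← Real.rpow_mul (by positivity)]
      norm_num
    have h1 : (⌊X⌋₊ : ℝ) ^ 482 ≤ X ^ 482 := by
      gcongr
      exact Nat.floor_le hX0
    obtain ⟨m, hm⟩ : ∃ m, m = ⌊X⌋₊ ^ 482 := ⟨_, rfl⟩
    have h2 := le_distortion hD hf hR hm.ge (by rw [hm, Nat.cast_pow]; linarith)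
    linarith
  · have : (⌊X⌋₊ : ℝ) ≤ 1000 := by exact_mod_cast (by omega : ⌊X⌋₊ ≤ 1000)
    linarith

end Heis
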